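/- Let f:(R,m) → (S,n) be a local homomorphism of noetherian local rings such that the flat dimension of S as an R-module is finite, and let M be a non-zero finitely generated S-module. Then Gfd_R(M) ≥ edim(R) − edim(S), and if equality holds, then f is an exceptional complete intersection map. -/

import Mathlib

/- ## Preliminary definitions -/

universe u

open IsLocalRing

noncomputable section

/-- The embedding dimension of a local ring: `dim_k (m/m²)`. -/
def embDim (R : Type u) [CommRing R] [IsLocalRing R] : ℕ :=
  Module.finrank (ResidueField R) (CotangentSpace R)

/-- Witness that `Q` is a Gorenstein flat `R`-module: a two-sided exact complex `F` of
flat modules, which stays exact after applying `I ⊗ᵣ -` for every injective module `I`,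
with `Q` isomorphic to the image of the differential `F₁ → F₀`. -/
structure GorensteinFlatWitness (R : Type u) [CommRing R] (Q : Type u) [AddCommGroup Q]
    [Module R Q] where
  F : ℤ → Type u
  [instAdd : ∀ i, AddCommGroup (F i)]
  [instMod : ∀ i, Module R (F i)]
  d : (i : ℤ) → F (i + 1) →ₗ[R] F i
  flat : ∀ i, Module.Flat R (F i)
  exact : ∀ i : ℤ, Function.Exact (d (i + 1)) (d i)
  exact_tensor : ∀ (I : Type u) [AddCommGroup I] [Module R I], Module.Injective R I →
    ∀ i : ℤ, Function.Exact (LinearMap.lTensor I (d (i + 1))) (LinearMap.lTensor I (d i))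
  iso : Nonempty (Q ≃ₗ[R] LinearMap.range (d 0))

/-- `Q` is a Gorenstein flat `R`-module. -/
def IsGorensteinFlat (R : Type u) [CommRing R] (Q : Type u) [AddCommGroup Q]
    [Module R Q] : Prop :=
  Nonempty (GorensteinFlatWitness R Q)

/-- Witness that `J` is a Gorenstein injective `R`-module: a two-sided exact complex `I` of
injective modules, which stays exact after applying `Hom_R(E, -)` for every injective module
`E`, with `J` isomorphic to the image of the differential `I₁ → I₀`. -/
structure GorensteinInjectiveWitness (R : Type u) [CommRing R] (J : Type u) [AddCommGroup J]
    [Module R J] where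
  I : ℤ → Type u
  [instAdd : ∀ i, AddCommGroup (I i)]
  [instMod : ∀ i, Module R (I i)]
  d : (i : ℤ) → I (i + 1) →ₗ[R] I i
  injective : ∀ i, Module.Injective R (I i)
  exact : ∀ i : ℤ, Function.Exact (d (i + 1)) (d i)
  exact_hom : ∀ (E : Type u) [AddCommGroup E] [Module R E], Module.Injective R E →
    ∀ i : ℤ, Function.Exact (LinearMap.llcomp (σ₁₂ := RingHom.id R) (σ₁₃ := RingHom.id R)
        R E (I (i + 1 + 1)) (I (i + 1)) (d (i + 1)))
      (LinearMap.llcomp (σ₁₂ := RingHom.id R) (σ₁₃ := RingHom.id R)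
        R E (I (i + 1)) (I i) (d i))
  iso : Nonempty (J ≃ₗ[R] LinearMap.range (d 0))

/-- `J` is a Gorenstein injective `R`-module. -/
def IsGorensteinInjective (R : Type u) [CommRing R] (J : Type u) [AddCommGroup J]
    [Module R J] : Prop :=
  Nonempty (GorensteinInjectiveWitness R J)

/-- A surjection onto `M` whose source is Gorenstein flat. -/
structure GorensteinFlatCover (R : Type u) [CommRing R] (M : Type u) [AddCommGroup M]
    [Module R M] where
  Q : Type u
  [instAdd : AddCommGroup Q]
  [instMod : Module R Q]
  π : Q →ₗ[R] M
  gflat : IsGorensteinFlat R Q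
  surj : Function.Surjective π

attribute [instance] GorensteinFlatCover.instAdd GorensteinFlatCover.instMod

/-- `M` admits an exact sequence `0 → Qₙ → ⋯ → Q₀ → M → 0` with all `Qᵢ` Gorenstein flat;
equivalently (by splicing), defined by recursion on `n`. -/
def gfdLE (R : Type u) [CommRing R] :
    (n : ℕ) → (M : Type u) → [AddCommGroup M] → [Module R M] → Prop
  | 0, M, _, _ => IsGorensteinFlat R M
  | n + 1, M, _, _ => ∃ c : GorensteinFlatCover R M, gfdLE R n (LinearMap.ker c.π)

/-- The Gorenstein flat dimension of `M` over `R`, as an element of `ℕ∞`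
(the zero module has Gorenstein flat dimension `0` here, and `⊤` means infinite). -/
def gfd (R : Type u) [CommRing R] (M : Type u) [AddCommGroup M] [Module R M] : ℕ∞ :=
  sInf ((↑) '' { n : ℕ | gfdLE R n M })

/-- A flat cover of `M`. -/
structure FlatCover (R : Type u) [CommRing R] (M : Type u) [AddCommGroup M]
    [Module R M] where
  Q : Type u
  [instAdd : AddCommGroup Q]
  [instMod : Module R Q]
  π : Q →ₗ[R] M
  flat : Module.Flat R Q
  surj : Function.Surjective π

attribute [instance] FlatCover.instAdd FlatCover.instMod

/-- `M` admits a flat resolution of length `≤ n`. -/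
def fdLE (R : Type u) [CommRing R] :
    (n : ℕ) → (M : Type u) → [AddCommGroup M] → [Module R M] → Prop
  | 0, M, _, _ => Module.Flat R M
  | n + 1, M, _, _ => ∃ c : FlatCover R M, fdLE R n (LinearMap.ker c.π)

/-- The flat dimension of `M` over `R`, as an element of `ℕ∞`. -/
def flatDim (R : Type u) [CommRing R] (M : Type u) [AddCommGroup M] [Module R M] : ℕ∞ :=
  sInf ((↑) '' { n : ℕ | fdLE R n M })

/-- An embedding of `M` into a Gorenstein injective module. -/
structure GorensteinInjectiveHull (R : Type u) [CommRing R] (M : Type u) [AddCommGroup M]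
    [Module R M] where
  J : Type u
  [instAdd : AddCommGroup J]
  [instMod : Module R J]
  ι : M →ₗ[R] J
  ginj : IsGorensteinInjective R J
  inj : Function.Injective ι

attribute [instance] GorensteinInjectiveHull.instAdd GorensteinInjectiveHull.instMod

/-- `M` admits an exact sequence `0 → M → J₀ → ⋯ → J₋ₙ → 0` with all `Jᵢ`
Gorenstein injective. -/
def gidLE (R : Type u) [CommRing R] :
    (n : ℕ) → (M : Type u) → [AddCommGroup M] → [Module R M] → Prop
  | 0, M, _, _ => IsGorensteinInjective R M
  | n + 1, M, _, _ => ∃ c : GorensteinInjectiveHull R M,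
      gidLE R n (c.J ⧸ LinearMap.range c.ι)

/-- The Gorenstein injective dimension of `M` over `R`, as an element of `ℕ∞`. -/
def gid (R : Type u) [CommRing R] (M : Type u) [AddCommGroup M] [Module R M] : ℕ∞ :=
  sInf ((↑) '' { n : ℕ | gidLE R n M })

/-- An embedding of `M` into an injective module. -/
structure InjectiveHullStep (R : Type u) [CommRing R] (M : Type u) [AddCommGroup M]
    [Module R M] where
  J : Type u
  [instAdd : AddCommGroup J]
  [instMod : Module R J]
  ι : M →ₗ[R] J
  injective : Module.Injective R J
  inj : Function.Injective ι

attribute [instance] InjectiveHullStep.instAdd InjectiveHullStep.instMod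

/-- `M` admits an injective resolution of length `≤ n`. -/
def idLE (R : Type u) [CommRing R] :
    (n : ℕ) → (M : Type u) → [AddCommGroup M] → [Module R M] → Prop
  | 0, M, _, _ => Module.Injective R M
  | n + 1, M, _, _ => ∃ c : InjectiveHullStep R M, idLE R n (c.J ⧸ LinearMap.range c.ι)

/-- The injective dimension of `M` over `R`, as an element of `ℕ∞`. -/
def injDim (R : Type u) [CommRing R] (M : Type u) [AddCommGroup M] [Module R M] : ℕ∞ :=
  sInf ((↑) '' { n : ℕ | idLE R n M })

/-- The `i`-th Ext module `Ext_R^i(N, M)`. -/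
def extModule (R : Type u) [CommRing R] (i : ℕ) (N M : Type u) [AddCommGroup N] [Module R N]
    [AddCommGroup M] [Module R M] : ModuleCat.{u} R :=
  ((Ext R (ModuleCat.{u} R) i).obj (Opposite.op (ModuleCat.of R N))).obj (ModuleCat.of R M)

/-- The depth of `M` with respect to the ideal `I`: the least `i` such that
`Ext_R^i(R/I, M) ≠ 0` (with value `⊤ : ℕ∞` if no such `i` exists). -/
def idealDepth (R : Type u) [CommRing R] (I : Ideal R) (M : Type u) [AddCommGroup M]
    [Module R M] : ℕ∞ :=
  sInf ((↑) '' { i : ℕ | ¬ Subsingleton (extModule R i (R ⧸ I) M) })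

/-- A finitely generated `S`-module `M` is totally reflexive if the biduality map
`M → Hom_S(Hom_S(M,S),S)` is bijective and `Ext_S^i(M,S) = 0 = Ext_S^i(M^*,S)`
for all `i ≥ 1`. -/
def IsTotallyReflexive (S : Type u) [CommRing S] (M : Type u) [AddCommGroup M]
    [Module S M] : Prop :=
  Module.Finite S M ∧ Function.Bijective (Module.Dual.eval S M) ∧
    ∀ i : ℕ, 1 ≤ i → Subsingleton (extModule S i M S) ∧
      Subsingleton (extModule S i (Module.Dual S M) S)

/-- A noetherian local ring is G-regular if every totally reflexive module is free. -/
def IsGRegular (S : Type u) [CommRing S] : Prop :=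
  ∀ (M : Type u) [AddCommGroup M] [Module S M], IsTotallyReflexive S M → Module.Free S M

/-- A commutative ring is a regular local ring if it is a noetherian local ring whose
maximal ideal is generated by a regular sequence. -/
def IsRegularLocal (A : Type u) [CommRing A] : Prop :=
  IsNoetherianRing A ∧ ∃ h : IsLocalRing A, ∃ rs : List A,
    RingTheory.Sequence.IsRegular A rs ∧
      Ideal.span { x | x ∈ rs } = @IsLocalRing.maximalIdeal A _ h

/-- A Gorenstein local ring: a noetherian local ring of finite self-injective dimension. -/
def IsGorensteinLocal (A : Type u) [CommRing A] : Prop :=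
  IsNoetherianRing A ∧ IsLocalRing A ∧ injDim A A < ⊤

/-- `E` is an injective envelope (injective hull) of the residue field of the local
ring `S`: an injective module containing the residue field as an essential submodule. -/
def IsInjEnvResidueField (S : Type u) [CommRing S] [IsLocalRing S] (E : Type u)
    [AddCommGroup E] [Module S E] : Prop :=
  Module.Injective S E ∧ ∃ ι : ResidueField S →ₗ[S] E, Function.Injective ι ∧
    ∀ N : Submodule S E, N ≠ ⊥ → N ⊓ LinearMap.range ι ≠ ⊥

end
/- ## Cohen factorizations and (exceptional) complete intersection maps -/

noncomputable section

/-- The canonical ring homomorphism from a local ring `S` to its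
maximal-adic completion. -/
def completionHom (S : Type u) [CommRing S] [IsLocalRing S] :
    S →+* AdicCompletion (maximalIdeal S) S :=
  algebraMap S (AdicCompletion (maximalIdeal S) S)

/-- `R → R' → Ŝ` is a Cohen factorization of the local homomorphism `f : R → S`:
`R'` is a complete noetherian local ring, `R → R'` is a flat local homomorphism with
regular closed fiber `R'/mR'`, and `R' → Ŝ` is surjective, the composite being the
composition of `f` with the completion map of `S`. -/
def IsCohenFactorization {R S R' : Type u} [CommRing R] [CommRing S] [IsLocalRing R]
    [IsLocalRing S] [CommRing R'] (f : R →+* S) (g : R →+* R')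
    (h : R' →+* AdicCompletion (maximalIdeal S) S) : Prop :=
  IsNoetherianRing R' ∧ IsLocalRing R' ∧ IsAdicComplete ((⊥ : Ideal R').jacobson) R' ∧
    h.comp g = (completionHom S).comp f ∧ IsLocalHom g ∧ g.Flat ∧
    IsRegularLocal (R' ⧸ (maximalIdeal R).map g) ∧ Function.Surjective h

/-- A local homomorphism `f : R → S` of noetherian local rings is a complete intersection
map if in some Cohen factorization `R → R' → Ŝ` the kernel of `R' → Ŝ` is generated by a
regular sequence. -/
def IsCIMap {R S : Type u} [CommRing R] [CommRing S] [IsLocalRing R] [IsLocalRing S]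
    (f : R →+* S) : Prop :=
  ∃ (R' : Type u) (_ : CommRing R') (g : R →+* R')
    (h : R' →+* AdicCompletion (maximalIdeal S) S),
    IsCohenFactorization f g h ∧ ∃ rs : List R',
      RingTheory.Sequence.IsRegular R' rs ∧ RingHom.ker h = Ideal.span { x | x ∈ rs }

/-- A local homomorphism `f : R → S` of noetherian local rings is an exceptional complete
intersection map if it is a complete intersection map and
`edim R - dim R = edim S - dim S`. -/
def IsExceptionalCIMap {R S : Type u} [CommRing R] [CommRing S] [IsLocalRing R]
    [IsLocalRing S] (f : R →+* S) : Prop :=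
  IsCIMap f ∧
    (embDim R : WithBot ℕ∞) + ringKrullDim S =
      (embDim S : WithBot ℕ∞) + ringKrullDim R

end
/- ## Homological dimensions along a ring homomorphism -/

noncomputable section

variable {R S : Type u} [CommRing R] [CommRing S]

/-- The flat dimension `fd_R S` of `S` as an `R`-module along `f : R → S`. -/
def flatDimAlong (f : R →+* S) : ℕ∞ :=
  letI := f.toModule; flatDim R S

/-- The Gorenstein flat dimension over `R` of an `S`-module `M`, viewed as an
`R`-module along `f : R → S`. -/
def gfdAlong (f : R →+* S) (M : Type u) [AddCommGroup M] [Module S M] : ℕ∞ :=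
  letI := Module.compHom M f; gfd R M

/-- The Gorenstein injective dimension over `R` of an `S`-module `M`, viewed as an
`R`-module along `f : R → S`. -/
def gidAlong (f : R →+* S) (M : Type u) [AddCommGroup M] [Module S M] : ℕ∞ :=
  letI := Module.compHom M f; gid R M

/-- `M` is Gorenstein flat as an `R`-module along `f : R → S`. -/
def IsGorensteinFlatAlong (f : R →+* S) (M : Type u) [AddCommGroup M] [Module S M] : Prop :=
  letI := Module.compHom M f; IsGorensteinFlat R M

/-- `M` is Gorenstein injective as an `R`-module along `f : R → S`. -/
def IsGorensteinInjectiveAlong (f : R →+* S) (M : Type u) [AddCommGroup M]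
    [Module S M] : Prop :=
  letI := Module.compHom M f; IsGorensteinInjective R M

end

section ProjectiveDimension

open CategoryTheory TensorProduct

/-- The short complex in `ModuleCat A` attached to an exact pair of linear maps. -/
abbrev linearShortComplex {A : Type u} [CommRing A] {X Y Z : Type u} [AddCommGroup X]
    [AddCommGroup Y] [AddCommGroup Z] [Module A X] [Module A Y] [Module A Z]
    (f : X →ₗ[A] Y) (g : Y →ₗ[A] Z) (h : Function.Exact f g) : ShortComplex (ModuleCat.{u} A) :=
  ShortComplex.mk (ModuleCat.ofHom f) (ModuleCat.ofHom g)
    (by ext x; simpa using h.apply_apply_eq_zero x)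

theorem linearShortComplex_shortExact {A : Type u} [CommRing A] {X Y Z : Type u}
    [AddCommGroup X] [AddCommGroup Y] [AddCommGroup Z] [Module A X] [Module A Y] [Module A Z]
    (f : X →ₗ[A] Y) (g : Y →ₗ[A] Z) (h : Function.Exact f g) (hf : Function.Injective f)
    (hg : Function.Surjective g) : (linearShortComplex f g h).ShortExact where
  exact := (ShortComplex.ShortExact.moduleCat_exact_iff_function_exact _).2 h
  mono_f := (ModuleCat.mono_iff_injective _).2 hf
  epi_g := (ModuleCat.epi_iff_surjective _).2 hg

/-- `M` has projective dimension at most `n` over `A`. -/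
abbrev PdLE (A : Type u) [CommRing A] (M : Type u) [AddCommGroup M] [Module A M] (n : ℕ) : Prop :=
  HasProjectiveDimensionLE (ModuleCat.of A M) n

variable {A : Type u} [CommRing A] {X Y Z : Type u}
    [AddCommGroup X] [AddCommGroup Y] [AddCommGroup Z] [Module A X] [Module A Y] [Module A Z]

theorem pdLE_zero_iff : PdLE A X 0 ↔ Module.Projective A X := by
  rw [PdLE, ← projective_iff_hasProjectiveDimensionLE_zero, IsProjective.iff_projective]

theorem PdLE.mono {n m : ℕ} (h : PdLE A X n) (hnm : n ≤ m) : PdLE A X m :=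
  hasProjectiveDimensionLT_of_ge _ (n + 1) (m + 1) (by omega)

theorem PdLE.of_projective [h : Module.Projective A X] (n : ℕ) : PdLE A X n :=
  (pdLE_zero_iff.2 h).mono (Nat.zero_le n)

theorem PdLE.left {f : X →ₗ[A] Y} {g : Y →ₗ[A] Z} (h : Function.Exact f g)
    (hf : Function.Injective f) (hg : Function.Surjective g) {n : ℕ} (hY : PdLE A Y n)
    (hZ : PdLE A Z (n + 1)) : PdLE A X n :=
  (linearShortComplex_shortExact f g h hf hg).hasProjectiveDimensionLT_X₁ (n + 1) hY hZ

theorem PdLE.right {f : X →ₗ[A] Y} {g : Y →ₗ[A] Z} (h : Function.Exact f g)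
    (hf : Function.Injective f) (hg : Function.Surjective g) {n : ℕ} (hX : PdLE A X n)
    (hY : PdLE A Y (n + 1)) : PdLE A Z (n + 1) :=
  (linearShortComplex_shortExact f g h hf hg).hasProjectiveDimensionLT_X₃ (n + 1) hX hY

end ProjectiveDimension

section LocalRing

open TensorProduct

variable {A : Type u} [CommRing A]

theorem mem_smul_top_of_forall_coord {M : Type u} [AddCommGroup M] [Module A M] {ι : Type*}
    (b : Module.Basis ι A M) (I : Ideal A) (x : M) (h : ∀ i, b.repr x i ∈ I) :
    x ∈ I • (⊤ : Submodule A M) := by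
  rw [← b.linearCombination_repr x, Finsupp.linearCombination_apply]
  exact Submodule.sum_mem _ fun i _ => Submodule.smul_mem_smul (h i) trivial

variable [IsLocalRing A]

theorem lTensor_residueField_injective {M N : Type u} [AddCommGroup M] [AddCommGroup N]
    [Module A M] [Module A N] (φ : M →ₗ[A] N)
    (h : ∀ x, φ x ∈ maximalIdeal A • (⊤ : Submodule A N) →
      x ∈ maximalIdeal A • (⊤ : Submodule A M)) :
    Function.Injective (φ.lTensor (ResidueField A)) := by
  rw [injective_iff_map_eq_zero]
  intro t ht
  obtain ⟨x, rfl⟩ := TensorProduct.mk_surjective A M (ResidueField A) Ideal.Quotient.mk_surjective t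
  have h1 : φ x ∈ LinearMap.ker (TensorProduct.mk A (ResidueField A) N 1) := by
    simpa using ht
  have := h x (by rw [← LinearMap.ker_tensorProductMk]; exact h1)
  rw [← LinearMap.ker_tensorProductMk] at this
  exact this

/-- Over a local ring whose maximal ideal is killed by a non-zero element, a cokernel of an
injection of finite free modules is free. -/
theorem free_of_socle {s : A} (hs : s ≠ 0) (hsm : ∀ a ∈ maximalIdeal A, s * a = 0)
    {Z F M : Type u} [AddCommGroup Z] [AddCommGroup F] [AddCommGroup M] [Module A Z] [Module A F]
    [Module A M] [Module.Finite A Z] [Module.Finite A F] [Module.Free A Z] [Module.Free A F]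
    (f : Z →ₗ[A] F) (g : F →ₗ[A] M) (h : Function.Exact f g) (hf : Function.Injective f)
    (hg : Function.Surjective g) : Module.Free A M := by
  refine Module.free_of_lTensor_residueField_injective f g hg h
    (lTensor_residueField_injective f fun x hx => ?_)
  have h0 : s • f x = 0 := by
    refine Submodule.smul_induction_on hx (fun r hr n _ => ?_) (fun x y hx hy => ?_)
    · rw [smul_smul, hsm r hr, zero_smul]
    · rw [smul_add, hx, hy, add_zero]
  have h1 : s • x = 0 := hf (by rw [map_smul, h0, map_zero])
  let b := Module.Free.chooseBasis A Z
  refine mem_smul_top_of_forall_coord b _ _ fun i => ?_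
  have h2 : s * b.repr x i = 0 := by
    have := congrArg (fun y => b.repr y i) h1
    simpa using this
  rw [mem_maximalIdeal, mem_nonunits_iff]
  exact fun hu => hs (hu.mul_left_eq_zero.1 h2)

theorem finrank_eq_add_of_free {Z F M : Type u} [AddCommGroup Z] [AddCommGroup F] [AddCommGroup M]
    [Module A Z] [Module A F] [Module A M] [Module.Finite A Z] [Module.Finite A M]
    [Module.Free A Z] [Module.Free A M]
    (f : Z →ₗ[A] F) (g : F →ₗ[A] M) (h : Function.Exact f g) (hf : Function.Injective f)
    (hg : Function.Surjective g) :
    Module.finrank A F = Module.finrank A Z + Module.finrank A M := by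
  obtain ⟨l, hl⟩ := Module.projective_lifting_property g LinearMap.id hg
  rw [((h.splitSurjectiveEquiv hf) ⟨l, hl⟩).1.finrank_eq, Module.finrank_prod]

end LocalRing

section RegularElement

open TensorProduct

variable {A : Type u} [CommRing A] [IsNoetherianRing A]

theorem exists_socle_of_isAssociatedPrime {q : Ideal A} [hqp : q.IsPrime]
    (hq : q ∈ associatedPrimes A A) :
    ∃ s : Localization.AtPrime q, s ≠ 0 ∧
      ∀ a ∈ maximalIdeal (Localization.AtPrime q), s * a = 0 := by
  obtain ⟨_, t, ht⟩ := isAssociatedPrime_iff.1 hq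
  have hmem : ∀ a, a ∈ q ↔ a * t = 0 := fun a => by
    conv_lhs => rw [ht]
    simp [Submodule.mem_colon_singleton]
  refine ⟨algebraMap A _ t, fun h0 => ?_, fun a ha => ?_⟩
  · obtain ⟨c, hc⟩ := (IsLocalization.map_eq_zero_iff q.primeCompl _ t).1 h0
    exact c.2 ((hmem c).2 hc)
  · obtain ⟨b, c, rfl⟩ := IsLocalization.exists_mk'_eq q.primeCompl a
    have hb : b ∈ q := by
      exact (IsLocalization.AtPrime.mk'_mem_maximal_iff (Localization.AtPrime q) q b c).1 ha
    rw [mul_comm, ← IsLocalization.mk'_one (M := q.primeCompl) (Localization.AtPrime q) t,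
      ← IsLocalization.mk'_mul, (hmem b).1 hb, IsLocalization.mk'_zero]

variable [IsLocalRing A]

/-- Over a noetherian local ring, a finite module of finite projective dimension is free of a
constant rank at all associated primes of the ring. -/
theorem exists_rank_at_associatedPrimes (n : ℕ) : ∀ (M : Type u) [AddCommGroup M] [Module A M]
    [Module.Finite A M], PdLE A M n → ∃ r : ℕ, ∀ q ∈ associatedPrimes A A, ∀ [q.IsPrime],
      Module.Free (Localization.AtPrime q) (Localization.AtPrime q ⊗[A] M) ∧
      Module.finrank (Localization.AtPrime q) (Localization.AtPrime q ⊗[A] M) = r := by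
  induction n with
  | zero =>
    intro M _ _ _ hM
    have := pdLE_zero_iff.1 hM
    have : Module.Free A M := Module.free_of_flat_of_isLocalRing
    exact ⟨Module.finrank A M, fun q _ _ => ⟨inferInstance, Module.finrank_baseChange⟩⟩
  | succ n ih =>
    intro M _ _ _ hM
    obtain ⟨m, g, hg⟩ := Module.Finite.exists_fin' A M
    have hex : Function.Exact (LinearMap.ker g).subtype g := LinearMap.exact_subtype_ker_map g
    obtain ⟨r, hr⟩ := ih (LinearMap.ker g)
      (PdLE.left hex (Submodule.subtype_injective _) hg (PdLE.of_projective n) hM)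
    refine ⟨m - r, fun q hq _ => ?_⟩
    obtain ⟨hfree, hrank⟩ := hr q hq
    obtain ⟨s, hs, hsm⟩ := exists_socle_of_isAssociatedPrime hq
    let Q := Localization.AtPrime q
    have h1 : Function.Exact ((LinearMap.ker g).subtype.baseChange Q) (g.baseChange Q) :=
      lTensor_exact Q hex hg
    have h2 : Function.Injective ((LinearMap.ker g).subtype.baseChange Q) :=
      Module.Flat.lTensor_preserves_injective_linearMap _ (Submodule.subtype_injective _)
    have h3 : Function.Surjective (g.baseChange Q) := LinearMap.lTensor_surjective Q hg
    have h4 : Module.Free Q (Q ⊗[A] M) := free_of_socle hs hsm _ _ h1 h2 h3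
    refine ⟨h4, ?_⟩
    have h5 := finrank_eq_add_of_free _ _ h1 h2 h3
    have h6 : Module.finrank Q (Q ⊗[A] (Fin m → A)) = m := by
      rw [Module.finrank_baseChange, Module.finrank_fin_fun]
    have h7 : Module.finrank Q (Q ⊗[A] (LinearMap.ker g)) = r := hrank
    change Module.finrank Q (Q ⊗[A] M) = m - r
    omega

/-- If `I ≠ 0` and `A ⧸ I` has finite projective dimension, then `I` contains a non-zero-divisor.
-/
theorem exists_isSMulRegular_of_pdLE {Q : Type u} [CommRing Q] [Algebra A Q] [Nontrivial Q]
    (hQ : Function.Surjective (algebraMap A Q)) {n : ℕ} (h : PdLE A Q n)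
    (hI : RingHom.ker (algebraMap A Q) ≠ ⊥) :
    ∃ x ∈ RingHom.ker (algebraMap A Q), IsSMulRegular A x := by
  by_contra! hcon
  have : Module.Finite A Q := .of_surjective (Algebra.linearMap A Q) hQ
  obtain ⟨r, hr⟩ := exists_rank_at_associatedPrimes n Q h
  set I := RingHom.ker (algebraMap A Q) with hIdef
  obtain ⟨q, hq, hIq⟩ : ∃ q ∈ associatedPrimes A A, I ≤ q := by
    obtain ⟨p0, -⟩ := associatedPrimes.nonempty A A
    refine (Ideal.subset_union_prime_finite (associatedPrimes.finite A A) p0 p0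
      fun i hi _ _ => IsAssociatedPrime.isPrime hi).1 ?_
    rw [biUnion_associatedPrimes_eq_compl_regular]
    exact fun x hx => hcon x hx
  have hr0 : r ≠ 0 := by
    have : q.IsPrime := IsAssociatedPrime.isPrime hq
    obtain ⟨h1, h2⟩ := hr q hq
    rintro rfl
    have hsub : Subsingleton (Localization.AtPrime q ⊗[A] Q) :=
      (Module.finrank_eq_zero_iff_of_free (Localization.AtPrime q) _).1 h2
    have hq2 : ((Localization.AtPrime q) ⊗[A] Q) → False := by
      intro _
      let qs : PrimeSpectrum A := ⟨q, this⟩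
      have hsupp : qs ∈ Module.support A Q := by
        rw [Module.mem_support_iff_of_finite]
        intro a ha
        refine hIq ?_
        rw [hIdef, RingHom.mem_ker, Algebra.algebraMap_eq_smul_one]
        exact Module.mem_annihilator.1 ha 1
      rw [Module.mem_support_iff] at hsupp
      exact not_subsingleton _ ((LocalizedModule.equivTensorProduct q.primeCompl Q).subsingleton)
    exact hq2 0
  refine hI (eq_bot_iff.2 fun a ha => ?_)
  by_contra ha0
  obtain ⟨p, hp, hap⟩ := exists_le_isAssociatedPrime_of_isNoetherianRing A a ha0
  have : p.IsPrime := IsAssociatedPrime.isPrime hp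
  obtain ⟨h1, h2⟩ := hr p hp
  have hpos : 0 < Module.finrank (Localization.AtPrime p) (Localization.AtPrime p ⊗[A] Q) := by
    omega
  let b := Module.Free.chooseBasis (Localization.AtPrime p) (Localization.AtPrime p ⊗[A] Q)
  have hne : Nonempty (Module.Free.ChooseBasisIndex (Localization.AtPrime p)
      (Localization.AtPrime p ⊗[A] Q)) := by
    rw [Module.finrank_eq_card_chooseBasisIndex] at hpos
    exact Fintype.card_pos_iff.1 hpos
  obtain ⟨i⟩ := hne
  have hkill : algebraMap A (Localization.AtPrime p) a • b i = 0 := by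
    generalize b i = t
    induction t with
    | zero => simp
    | add x y hx hy => rw [smul_add, hx, hy, add_zero]
    | tmul x y =>
      have : a • y = 0 := by rw [Algebra.smul_def, (RingHom.mem_ker).1 ha, zero_mul]
      rw [algebraMap_smul, ← TensorProduct.tmul_smul, this, TensorProduct.tmul_zero]
  have hz : algebraMap A (Localization.AtPrime p) a = 0 := by
    have := congrArg (fun y => b.repr y i) hkill
    rwa [map_smul, Finsupp.smul_apply, Module.Basis.repr_self, Finsupp.single_eq_same, map_zero,
      Finsupp.zero_apply, smul_eq_mul, mul_one] at this
  obtain ⟨c, hc⟩ := (IsLocalization.map_eq_zero_iff p.primeCompl _ a).1 hz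
  exact c.2 (hap (by simpa [Submodule.mem_colon_singleton] using hc))

end RegularElement

section EmbeddingDimension

variable {A : Type u} [CommRing A] [IsLocalRing A] [IsNoetherianRing A]

theorem embDim_eq_spanFinrank : embDim A = (maximalIdeal A).spanFinrank :=
  (spanFinrank_maximalIdeal_eq_finrank_cotangentSpace A).symm

theorem exists_generators_maximalIdeal :
    ∃ y : Fin (embDim A) → A, Ideal.span (Set.range y) = maximalIdeal A := by
  have hfg : (maximalIdeal A).FG := (maximalIdeal A).fg_of_isNoetherianRing
  obtain ⟨s, hs, hspan⟩ := Submodule.FG.exists_span_finset_card_eq_spanFinrank hfg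
  rw [← embDim_eq_spanFinrank] at hs
  refine ⟨fun i => (s.equivFinOfCardEq hs).symm i, ?_⟩
  rw [← hspan]
  congr 1
  ext a
  constructor
  · rintro ⟨i, rfl⟩
    exact ((s.equivFinOfCardEq hs).symm i).2
  · exact fun ha => ⟨s.equivFinOfCardEq hs ⟨a, ha⟩, by simp⟩

theorem embDim_le_of_span {n : ℕ} (y : Fin n → A)
    (h : Ideal.span (Set.range y) = maximalIdeal A) : embDim A ≤ n := by
  rw [embDim_eq_spanFinrank, ← h]
  refine (Submodule.spanFinrank_span_le_ncard_of_finite (Set.finite_range y)).trans ?_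
  rw [← Set.image_univ]
  refine (Set.ncard_image_le (Set.finite_univ)).trans ?_
  simp

theorem embDim_le_of_map_eq {A' : Type u} [CommRing A'] [IsLocalRing A'] [IsNoetherianRing A']
    (f : A →+* A') (h : (maximalIdeal A).map f = maximalIdeal A') : embDim A' ≤ embDim A := by
  obtain ⟨y, hy⟩ := exists_generators_maximalIdeal (A := A)
  refine embDim_le_of_span (f ∘ y) ?_
  rw [← h, ← hy, Ideal.map_span, Set.range_comp]

/-- Killing `x ∈ m ∖ m²` lowers the embedding dimension by one. -/
theorem embDim_eq_succ_of_ker_eq_span {A' : Type u} [CommRing A'] [IsLocalRing A']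
    [IsNoetherianRing A'] (f : A →+* A') (hf : Function.Surjective f) {x : A}
    (hx : x ∈ maximalIdeal A) (hx2 : x ∉ maximalIdeal A ^ 2)
    (hker : RingHom.ker f = Ideal.span {x}) : embDim A = embDim A' + 1 := by
  have hmap := map_maximalIdeal_of_surjective f hf
  apply le_antisymm
  · obtain ⟨y, hy⟩ := exists_generators_maximalIdeal (A := A')
    choose z hz using fun i => hf (y i)
    refine embDim_le_of_span (Fin.cons x z : Fin (embDim A' + 1) → A) ?_
    rw [Fin.range_cons, Ideal.span_insert]
    have h1 : (Ideal.span (Set.range z)).map f = maximalIdeal A' := by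
      rw [Ideal.map_span, ← Set.range_comp, ← hy]
      congr 2
      exact funext hz
    have h2 := congrArg (Ideal.comap f) (h1.trans hmap.symm)
    rw [Ideal.comap_map_of_surjective f hf, Ideal.comap_map_of_surjective f hf,
      ← RingHom.ker_eq_comap_bot, hker] at h2
    rw [sup_comm, h2]
    exact sup_eq_left.2 ((Ideal.span_singleton_le_iff_mem _).2 hx)
  · obtain ⟨y, hy⟩ := exists_generators_maximalIdeal (A := A)
    generalize embDim A = n at y hy
    have hxy := hx
    rw [← hy] at hxy
    obtain ⟨c, hc⟩ := (Submodule.mem_span_range_iff_exists_fun A).1 hxy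
    obtain ⟨i, hi⟩ : ∃ i, IsUnit (c i) := by
      by_contra! hcon
      refine hx2 ?_
      rw [← hc, pow_two]
      exact Ideal.sum_mem _ fun i _ => Ideal.mul_mem_mul ((mem_maximalIdeal _).2 (hcon i))
        (hy ▸ Ideal.subset_span ⟨i, rfl⟩)
    obtain _ | n := n
    · exact i.elim0
    refine Nat.succ_le_succ (embDim_le_of_span (fun j => f (y (i.succAbove j))) ?_)
    rw [← hmap, ← hy, Ideal.map_span, ← Set.range_comp]
    refine le_antisymm (Ideal.span_mono ?_) (Ideal.span_le.2 ?_)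
    · rintro _ ⟨j, rfl⟩
      exact ⟨_, rfl⟩
    · rintro _ ⟨j, rfl⟩
      obtain rfl | ⟨j, rfl⟩ := Fin.eq_self_or_eq_succAbove i j
      · have h0 : f x = 0 := by
          rw [← RingHom.mem_ker, hker]; exact Ideal.mem_span_singleton_self x
        rw [← hc, Fin.sum_univ_succAbove _ j, map_add, map_sum] at h0
        have h1 : f (c j) * f (y j) ∈
            Ideal.span (Set.range fun l => f (y (j.succAbove l))) := by
          rw [← map_mul]
          have := eq_neg_of_add_eq_zero_left h0
          rw [smul_eq_mul] at this
          rw [this]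
          refine neg_mem (Ideal.sum_mem _ fun l _ => ?_)
          rw [smul_eq_mul, map_mul]
          exact Ideal.mul_mem_left _ _ (Ideal.subset_span ⟨l, rfl⟩)
        exact (Ideal.unit_mul_mem_iff_mem _ (hi.map f)).1 h1
      · exact Ideal.subset_span ⟨j, rfl⟩

end EmbeddingDimension

section Nagata

open TensorProduct

theorem pdLE_one_pi_quotient {A : Type u} [CommRing A] {x : A} (hreg : IsSMulRegular A x) (r : ℕ) :
    PdLE A (Fin r → A ⧸ Ideal.span {x}) 1 := by
  let g : (Fin r → A) →ₗ[A] (Fin r → A ⧸ Ideal.span {x}) :=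
    (Submodule.mkQ (Ideal.span {x})).compLeft (Fin r)
  refine PdLE.right (f := LinearMap.lsmul A (Fin r → A) x) (g := g) ?_ ?_ ?_
    (PdLE.of_projective 0) (PdLE.of_projective 1)
  · intro y
    constructor
    · intro hy
      have : ∀ i, ∃ c, x * c = y i := fun i => by
        have h1 : Submodule.Quotient.mk (y i) = (0 : A ⧸ Ideal.span {x}) := congrFun hy i
        rw [Submodule.Quotient.mk_eq_zero, Ideal.mem_span_singleton'] at h1
        obtain ⟨c, hc⟩ := h1
        exact ⟨c, by rw [mul_comm, hc]⟩
      choose c hc using this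
      exact ⟨c, funext hc⟩
    · rintro ⟨c, rfl⟩
      funext i
      change Submodule.Quotient.mk (x * c i) = (0 : A ⧸ Ideal.span {x})
      rw [Submodule.Quotient.mk_eq_zero, Ideal.mem_span_singleton]
      exact Dvd.intro _ rfl
  · exact fun a b hab => funext fun i => hreg (congrFun hab i)
  · exact fun y => ⟨fun i => Quotient.out (y i), funext fun i => Quotient.out_eq _⟩

variable {A : Type u} [CommRing A] [IsLocalRing A]

theorem exists_minimal_cover (M : Type u) [AddCommGroup M] [Module A M] [Module.Finite A M] :
    ∃ (r : ℕ) (π : (Fin r → A) →ₗ[A] M), Function.Surjective π ∧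
      ∀ z ∈ LinearMap.ker π, ∀ i, z i ∈ maximalIdeal A := by
  let k := ResidueField A
  let w := Module.finBasis k (k ⊗[A] M)
  obtain ⟨v, hv⟩ := (TensorProduct.mk_surjective A M k Ideal.Quotient.mk_surjective).comp_left w
  have hspan := span_eq_top_of_tmul_eq_basis v w (congr_fun hv)
  refine ⟨_, Fintype.linearCombination A v, ?_, fun z hz i => ?_⟩
  · rw [← LinearMap.range_eq_top, Fintype.range_linearCombination, hspan]
  · rw [LinearMap.mem_ker, Fintype.linearCombination_apply] at hz
    have h1 : ∑ j, residue A (z j) • w j = 0 := by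
      rw [← map_zero (TensorProduct.mk A k M 1), ← hz, map_sum]
      refine Finset.sum_congr rfl fun j _ => ?_
      rw [← congr_fun hv j, map_smul]
      rfl
    have h2 := Fintype.linearIndependent_iff.1 w.linearIndependent _ h1 i
    exact (residue_eq_zero_iff _).1 h2

theorem mem_smul_top_iff_of_surjective {A' : Type u} [CommRing A'] [IsLocalRing A'] [Algebra A A']
    (hsurj : Function.Surjective (algebraMap A A')) {M : Type u} [AddCommGroup M] [Module A M]
    [Module A' M] [IsScalarTower A A' M] (y : M) :
    y ∈ maximalIdeal A' • (⊤ : Submodule A' M) ↔ y ∈ maximalIdeal A • (⊤ : Submodule A M) := by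
  rw [← map_maximalIdeal_of_surjective (algebraMap A A') hsurj,
    ← Submodule.restrictScalars_mem A, Ideal.smul_restrictScalars, Submodule.restrictScalars_top]

variable [IsNoetherianRing A] {x : A}

open Pointwise in
theorem projective_quotient_of_pdLE_one [IsLocalRing (A ⧸ Ideal.span {x})]
    (hx : x ∈ maximalIdeal A) (hx2 : x ∉ maximalIdeal A ^ 2)
    {M : Type u} [AddCommGroup M] [Module A M] [Module (A ⧸ Ideal.span {x}) M]
    [IsScalarTower A (A ⧸ Ideal.span {x}) M] [Module.Finite A M] (h : PdLE A M 1) :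
    Module.Projective (A ⧸ Ideal.span {x}) M := by
  have hsurj : Function.Surjective (algebraMap A (A ⧸ Ideal.span {x})) :=
    Ideal.Quotient.mk_surjective
  obtain ⟨r, π, hπ, hmin⟩ := exists_minimal_cover (A := A) M
  let Z := LinearMap.ker π
  have hZ : Module.Projective A Z := pdLE_zero_iff.1 (PdLE.left
    (LinearMap.exact_subtype_ker_map π) (Submodule.subtype_injective _) hπ
      (PdLE.of_projective 0) h)
  have hZf : Module.Free A Z := Module.free_of_flat_of_isLocalRing
  have hxM : ∀ y : M, x • y = 0 := fun y => by
    rw [← algebraMap_smul (A ⧸ Ideal.span {x}) x y]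
    simp
  let ψ₀ : (Fin r → A) →ₗ[A] Z :=
    (LinearMap.lsmul A (Fin r → A) x).codRestrict Z fun f => by
      change π (x • f) = 0
      rw [map_smul, hxM]
  let ψ : (Fin r → A) →ₗ[A] QuotSMulTop x Z := (Submodule.mkQ _) ∘ₗ ψ₀
  have hψ : LinearMap.ker π ≤ LinearMap.ker ψ := fun z hz => by
    have : ψ₀ z = x • (⟨z, hz⟩ : Z) := rfl
    rw [LinearMap.mem_ker, LinearMap.comp_apply, this, Submodule.mkQ_apply,
      Submodule.Quotient.mk_eq_zero]
    exact Submodule.smul_mem_pointwise_smul _ _ _ trivial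
  let φ₀ : M →ₗ[A] QuotSMulTop x Z :=
    ((LinearMap.ker π).liftQ ψ hψ) ∘ₗ (π.quotKerEquivOfSurjective hπ).symm.toLinearMap
  have hφ₀ : ∀ f, φ₀ (π f) = ψ f := fun f => by
    have : (π.quotKerEquivOfSurjective hπ).symm (π f) = Submodule.Quotient.mk f := by
      rw [LinearEquiv.symm_apply_eq]; rfl
    simp only [φ₀, LinearMap.comp_apply, LinearEquiv.coe_coe, this]
    rfl
  let φ : M →ₗ[A ⧸ Ideal.span {x}] QuotSMulTop x Z := φ₀.extendScalarsOfSurjective hsurj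
  have hfin1 : Module.Finite (A ⧸ Ideal.span {x}) M := .of_restrictScalars_finite A _ _
  have hfin2 : Module.Finite (A ⧸ Ideal.span {x}) (QuotSMulTop x Z) :=
    .of_restrictScalars_finite A _ _
  have hinj := lTensor_residueField_injective φ (fun y hy => by
    obtain ⟨f, rfl⟩ := hπ y
    rw [mem_smul_top_iff_of_surjective hsurj] at hy ⊢
    have h1 : ψ f ∈ maximalIdeal A • (⊤ : Submodule A (QuotSMulTop x Z)) := by
      rw [← hφ₀]; exact hy
    have h2 : ψ₀ f ∈ maximalIdeal A • (⊤ : Submodule A Z) := by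
      have h3 : (⊤ : Submodule A (QuotSMulTop x Z)) =
          Submodule.map (Submodule.mkQ (x • (⊤ : Submodule A Z))) ⊤ := by
        rw [Submodule.map_top, Submodule.range_mkQ]
      rw [h3, ← Submodule.map_smul''] at h1
      obtain ⟨z, hz, hzf⟩ := h1
      have h4 := (Submodule.Quotient.eq _).1 hzf
      obtain ⟨t, -, ht⟩ := (Submodule.mem_smul_pointwise_iff_exists _ _ _).1 h4
      have h5 : ψ₀ f = z - x • t := by rw [ht]; abel
      rw [h5]
      exact Submodule.sub_mem _ hz (Submodule.smul_mem_smul hx trivial)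
    have h6 : ∀ i, x * f i ∈ maximalIdeal A ^ 2 := fun i => by
      have h7 : ∀ z ∈ maximalIdeal A • (⊤ : Submodule A Z), (z : Fin r → A) i
          ∈ maximalIdeal A ^ 2 := fun z hz => by
        refine Submodule.smul_induction_on hz (fun a ha n _ => ?_) (fun a b ha hb => ?_)
        · rw [pow_two]
          exact Ideal.mul_mem_mul ha (hmin n n.2 i)
        · exact Ideal.add_mem _ ha hb
      exact h7 _ h2
    have h8 : f ∈ maximalIdeal A • (⊤ : Submodule A (Fin r → A)) := by
      refine mem_smul_top_of_forall_coord (Pi.basisFun A (Fin r)) _ _ fun i => ?_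
      rw [Pi.basisFun_repr, mem_maximalIdeal, mem_nonunits_iff]
      exact fun hu => hx2 ((Ideal.mul_unit_mem_iff_mem _ hu).1 (h6 i))
    have h9 := Submodule.mem_map_of_mem (f := π) h8
    rw [Submodule.map_smul''] at h9
    exact Submodule.smul_mono le_rfl le_top h9)
  obtain ⟨l, hl⟩ := (IsLocalRing.split_injective_iff_lTensor_residueField_injective φ).2 hinj
  exact Module.Projective.of_split φ l hl

/-- Finite projective dimension descends to the quotient by a regular element outside the square
of the maximal ideal. -/
theorem exists_pdLE_quotient [IsLocalRing (A ⧸ Ideal.span {x})]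
    (hx : x ∈ maximalIdeal A) (hx2 : x ∉ maximalIdeal A ^ 2) (hreg : IsSMulRegular A x) (n : ℕ) :
    ∀ (M : Type u) [AddCommGroup M] [Module A M] [Module (A ⧸ Ideal.span {x}) M]
    [IsScalarTower A (A ⧸ Ideal.span {x}) M] [Module.Finite A M], PdLE A M (n + 1) →
    ∃ m, PdLE (A ⧸ Ideal.span {x}) M m := by
  induction n with
  | zero =>
    intro M _ _ _ _ _ h
    exact ⟨0, pdLE_zero_iff.2 (projective_quotient_of_pdLE_one hx hx2 h)⟩
  | succ n ih =>
    intro M _ _ _ _ _ h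
    have hfin1 : Module.Finite (A ⧸ Ideal.span {x}) M := .of_restrictScalars_finite A _ _
    obtain ⟨r, π, hπ⟩ := Module.Finite.exists_fin' (A ⧸ Ideal.span {x}) M
    have hex := LinearMap.exact_subtype_ker_map π
    have hfin : Module.Finite A (Fin r → A ⧸ Ideal.span {x}) := inferInstance
    have hfin2 : Module.Finite A (LinearMap.ker π) :=
      Module.Finite.of_injective ((LinearMap.ker π).subtype.restrictScalars A)
        (Submodule.subtype_injective _)
    obtain ⟨m, hm⟩ := ih (LinearMap.ker π) (PdLE.left (Y := Fin r → A ⧸ Ideal.span {x})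
      (f := (LinearMap.ker π).subtype.restrictScalars A) (g := π.restrictScalars A) hex
      (Submodule.subtype_injective _) hπ ((pdLE_one_pi_quotient hreg r).mono (by omega)) h)
    exact ⟨m + 1, PdLE.right hex (Submodule.subtype_injective _) hπ hm (PdLE.of_projective _)⟩

end Nagata

section RegularSequenceInKernel

open RingTheory.Sequence

open Pointwise in
theorem isWeaklyRegular_cons_quotient_iff {A : Type u} [CommRing A] (x : A) (rs : List A) :
    IsWeaklyRegular A (x :: rs) ↔ IsSMulRegular A x ∧
      IsWeaklyRegular (A ⧸ Ideal.span {x}) (rs.map (algebraMap A (A ⧸ Ideal.span {x}))) := by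
  have h : x • (⊤ : Submodule A A) = Ideal.span {x} := by
    rw [← Submodule.ideal_span_singleton_smul, smul_eq_mul, Ideal.mul_top]
  rw [isWeaklyRegular_cons_iff, isWeaklyRegular_map_algebraMap_iff]
  exact and_congr_right fun _ =>
    (Submodule.quotEquivOfEq _ (Ideal.span {x}) h).isWeaklyRegular_congr rs

/-- If `Q` is a quotient of finite projective dimension of a noetherian local ring `A`, then its
kernel contains a regular sequence of length at least `edim A - edim Q`, and this inequality can
be taken to be strict unless the kernel is generated by such a sequence. -/
theorem exists_isWeaklyRegular_in_ker (e : ℕ) : ∀ (A Q : Type u) [CommRing A] [CommRing Q]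
    [IsLocalRing A] [IsNoetherianRing A] [IsLocalRing Q] [IsNoetherianRing Q] [Algebra A Q],
    embDim A = e → Function.Surjective (algebraMap A Q) → ∀ n, PdLE A Q n →
    ∃ xs : List A, IsWeaklyRegular A xs ∧ (∀ x ∈ xs, x ∈ RingHom.ker (algebraMap A Q)) ∧
      ((RingHom.ker (algebraMap A Q) = Ideal.span {x | x ∈ xs} ∧
        embDim A = xs.length + embDim Q) ∨ embDim A < xs.length + embDim Q) := by
  induction e with
  | zero =>
    intro A Q _ _ _ _ _ _ _ he hs n hn
    have hm : maximalIdeal A = ⊥ := by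
      obtain ⟨y, hy⟩ := exists_generators_maximalIdeal (A := A)
      have : IsEmpty (Fin (embDim A)) := by rw [he]; infer_instance
      rw [← hy, Set.range_eq_empty, Ideal.span_empty]
    have hmQ := embDim_le_of_map_eq (algebraMap A Q) (map_maximalIdeal_of_surjective _ hs)
    have hk : RingHom.ker (algebraMap A Q) = ⊥ := by
      rw [← le_bot_iff, ← hm]
      exact le_maximalIdeal (RingHom.ker_ne_top _)
    exact ⟨[], .nil _ _, by simp, Or.inl ⟨by simp [hk], by simp; omega⟩⟩
  | succ e ih =>
    intro A Q _ _ _ _ _ _ _ he hs n hn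
    set I := RingHom.ker (algebraMap A Q) with hI
    have hIm : I ≤ maximalIdeal A := le_maximalIdeal (RingHom.ker_ne_top _)
    have hmap := map_maximalIdeal_of_surjective (algebraMap A Q) hs
    by_cases hbot : I = ⊥
    · refine ⟨[], .nil _ _, by simp, Or.inl ⟨by simp [hbot], ?_⟩⟩
      have hbij : Function.Bijective (algebraMap A Q) :=
        ⟨(RingHom.injective_iff_ker_eq_bot _).2 hbot, hs⟩
      let φ := RingEquiv.ofBijective _ hbij
      have h1 := embDim_le_of_map_eq (algebraMap A Q) hmap
      have h2 := embDim_le_of_map_eq φ.symm.toRingHom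
        (map_maximalIdeal_of_surjective _ φ.symm.surjective)
      simpa using le_antisymm h2 h1
    obtain ⟨x₀, hx₀, hr₀⟩ := exists_isSMulRegular_of_pdLE hs hn hbot
    by_cases h2 : I ≤ maximalIdeal A ^ 2
    · refine ⟨[x₀], (isWeaklyRegular_singleton_iff _ _).2 hr₀,
        fun y hy => List.mem_singleton.1 hy ▸ hx₀, Or.inr ?_⟩
      have : embDim A ≤ embDim Q := by
        obtain ⟨y, hy⟩ := exists_generators_maximalIdeal (A := Q)
        choose z hz using fun i => hs (y i)
        refine embDim_le_of_span z ?_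
        have hzm : ∀ i, z i ∈ maximalIdeal A := fun i => by
          have : (maximalIdeal Q).comap (algebraMap A Q) ≤ maximalIdeal A :=
            le_maximalIdeal (Ideal.comap_ne_top _ (Ideal.IsPrime.ne_top inferInstance))
          refine this ?_
          rw [Ideal.mem_comap, hz, ← hy]
          exact Ideal.subset_span ⟨i, rfl⟩
        refine le_antisymm (Ideal.span_le.2 (by rintro _ ⟨i, rfl⟩; exact hzm i)) ?_
        refine Submodule.le_of_le_smul_of_le_jacobson_bot
          (I := maximalIdeal A) (Ideal.fg_of_isNoetherianRing _)
          (jacobson_eq_maximalIdeal ⊥ bot_ne_top).ge ?_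
        have h1 : (Ideal.span (Set.range z)).map (algebraMap A Q) = maximalIdeal Q := by
          rw [Ideal.map_span, ← Set.range_comp, ← hy]
          congr 2
          exact funext hz
        have h3 := congrArg (Ideal.comap (algebraMap A Q)) (h1.trans hmap.symm)
        rw [Ideal.comap_map_of_surjective _ hs, Ideal.comap_map_of_surjective _ hs,
          ← RingHom.ker_eq_comap_bot] at h3
        calc maximalIdeal A ≤ maximalIdeal A ⊔ I := le_sup_left
          _ = Ideal.span (Set.range z) ⊔ I := h3.symm
          _ ≤ _ := sup_le_sup_left (h2.trans (by rw [pow_two]; exact le_rfl)) _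
      simp only [List.length_singleton]
      omega
    obtain ⟨x, hx, hx2, hr⟩ : ∃ x ∈ I, x ∉ maximalIdeal A ^ 2 ∧ IsSMulRegular A x := by
      by_contra! hcon
      obtain ⟨J, hJ, hIJ⟩ := (Ideal.subset_union_prime_finite
        (s := insert (maximalIdeal A ^ 2) (associatedPrimes A A)) (f := id)
        ((associatedPrimes.finite A A).insert _) (maximalIdeal A ^ 2) (maximalIdeal A ^ 2)
        (fun i hi hi1 _ => IsAssociatedPrime.isPrime (hi.resolve_left hi1)) (I := I)).1 (by
          intro y hy
          rw [Set.biUnion_insert]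
          by_cases hy2 : y ∈ maximalIdeal A ^ 2
          · exact Or.inl hy2
          · refine Or.inr ?_
            have := biUnion_associatedPrimes_eq_compl_regular A A
            simp only [id]
            rw [this]
            exact hcon y hy hy2)
      rcases hJ with rfl | hJ
      · exact h2 hIJ
      · have : x₀ ∈ ({ r : A | IsSMulRegular A r }ᶜ : Set A) := by
          rw [← biUnion_associatedPrimes_eq_compl_regular A A]
          exact Set.mem_biUnion hJ (hIJ hx₀)
        exact this hr₀
    let A' := A ⧸ Ideal.span {x}
    have hxI : Ideal.span {x} ≤ I := (Ideal.span_singleton_le_iff_mem _).2 hx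
    have : Nontrivial A' := Ideal.Quotient.nontrivial_iff.2
      (fun h => RingHom.ker_ne_top (algebraMap A Q) (top_le_iff.1 (h ▸ hxI)))
    have : IsLocalRing A' := .of_surjective' (Ideal.Quotient.mk _) Ideal.Quotient.mk_surjective
    let q : A' →+* Q := Ideal.Quotient.lift (Ideal.span {x}) (algebraMap A Q) fun a ha => hxI ha
    let _ : Algebra A' Q := q.toAlgebra
    have : IsScalarTower A A' Q := .of_algebraMap_eq fun a => rfl
    have hs' : Function.Surjective (algebraMap A' Q) := fun y => by
      obtain ⟨a, rfl⟩ := hs y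
      exact ⟨Ideal.Quotient.mk _ a, rfl⟩
    have : Module.Finite A Q := .of_surjective (Algebra.linearMap A Q) hs
    obtain ⟨m, hm⟩ := exists_pdLE_quotient (hIm hx) hx2 hr n Q (hn.mono (Nat.le_succ n))
    have hemb := embDim_eq_succ_of_ker_eq_span (Ideal.Quotient.mk (Ideal.span {x}))
      Ideal.Quotient.mk_surjective (hIm hx) hx2 Ideal.mk_ker
    obtain ⟨ys, hys, hysk, hor⟩ := ih A' Q (by change embDim A = embDim A' + 1 at hemb; omega)
      hs' m hm
    obtain ⟨zs, rfl⟩ : ∃ zs : List A, zs.map (algebraMap A A') = ys :=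
      List.map_surjective_iff.2 Ideal.Quotient.mk_surjective ys
    have hkk : ∀ a, algebraMap A A' a ∈ RingHom.ker (algebraMap A' Q) ↔ a ∈ I := fun a => Iff.rfl
    refine ⟨x :: zs, (isWeaklyRegular_cons_quotient_iff x zs).2 ⟨hr, hys⟩, ?_, ?_⟩
    · intro a ha
      rcases List.mem_cons.1 ha with rfl | ha
      · exact hx
      · exact (hkk a).1 (hysk _ (List.mem_map_of_mem ha))
    · change embDim A = embDim A' + 1 at hemb
      rw [List.length_map] at hor
      rw [List.length_cons, hemb]
      refine hor.imp (fun ⟨h3, h4⟩ => ⟨?_, by omega⟩) (fun h => by omega)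
      have h5 := congrArg (Ideal.comap (algebraMap A A')) h3
      have h6 : (RingHom.ker (algebraMap A' Q)).comap (algebraMap A A') = I := Ideal.ext hkk
      have h7 : Ideal.span {y | y ∈ List.map (algebraMap A A') zs} =
          (Ideal.span {y | y ∈ zs}).map (algebraMap A A') := by
        rw [Ideal.map_span]
        congr 1
        ext y
        simp
      rw [h6, h7, Ideal.comap_map_of_surjective (algebraMap A A') Ideal.Quotient.mk_surjective,
        ← RingHom.ker_eq_comap_bot] at h5
      rw [h5]
      have h8 : RingHom.ker (algebraMap A A') = Ideal.span {x} := Ideal.mk_ker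
      have h9 : {y | y ∈ x :: zs} = {x} ∪ {y | y ∈ zs} := by ext y; simp
      rw [h8, h9, Ideal.span_union, sup_comm]

end RegularSequenceInKernel

section ExtZero

open CategoryTheory Abelian

/-- The group `Ext_R^i(X, Y)` is trivial. -/
abbrev ExtZero (R : Type u) [CommRing R] (X Y : Type u) [AddCommGroup X] [Module R X]
    [AddCommGroup Y] [Module R Y] (i : ℕ) : Prop :=
  Subsingleton (Abelian.Ext (ModuleCat.of R X) (ModuleCat.of R Y) i)

variable {R : Type u} [CommRing R] {X Y Z W : Type u} [AddCommGroup X] [Module R X]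
  [AddCommGroup Y] [Module R Y] [AddCommGroup Z] [Module R Z] [AddCommGroup W] [Module R W]

theorem subsingleton_of_forall_eq_zero {G : Type*} [AddGroup G] (h : ∀ x : G, x = 0) :
    Subsingleton G :=
  ⟨fun a b => (h a).trans (h b).symm⟩

theorem ExtZero.of_projective [Module.Projective R X] (i : ℕ) : ExtZero R X W (i + 1) := by
  have : Projective (ModuleCat.of R X) := IsProjective.iff_projective X |>.1 inferInstance
  exact subsingleton_of_forall_eq_zero fun e => Ext.eq_zero_of_projective e

theorem ExtZero.of_injective (h : Module.Injective R W) (i : ℕ) : ExtZero R X W (i + 1) := by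
  have : Injective (ModuleCat.of R W) := Module.injective_object_of_injective_module R W
  exact Ext.subsingleton_of_injective _ _ i

variable {f : X →ₗ[R] Y} {g : Y →ₗ[R] Z}

theorem ExtZero.contra_third (h : Function.Exact f g) (hf : Function.Injective f)
    (hg : Function.Surjective g) {i : ℕ} (h₁ : ExtZero R X W i) (h₂ : ExtZero R Y W (i + 1)) :
    ExtZero R Z W (i + 1) := by
  have hS := linearShortComplex_shortExact f g h hf hg
  refine subsingleton_of_forall_eq_zero fun x => ?_
  obtain ⟨y, rfl⟩ := Ext.contravariant_sequence_exact₃ hS _ x (@Subsingleton.elim _ h₂ _ _)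
    (Nat.add_comm 1 i)
  rw [@Subsingleton.elim _ h₁ y 0, Ext.comp_zero]

theorem ExtZero.contra_first (h : Function.Exact f g) (hf : Function.Injective f)
    (hg : Function.Surjective g) {i : ℕ} (h₂ : ExtZero R Y W i) (h₃ : ExtZero R Z W (i + 1)) :
    ExtZero R X W i := by
  have hS := linearShortComplex_shortExact f g h hf hg
  refine subsingleton_of_forall_eq_zero fun x => ?_
  obtain ⟨y, rfl⟩ := Ext.contravariant_sequence_exact₁ hS _ x (Nat.add_comm 1 i)
    (@Subsingleton.elim _ h₃ _ _)
  rw [@Subsingleton.elim _ h₂ y 0, Ext.comp_zero]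

theorem ExtZero.co_third (h : Function.Exact f g) (hf : Function.Injective f)
    (hg : Function.Surjective g) {i : ℕ} (h₂ : ExtZero R W Y i) (h₁ : ExtZero R W X (i + 1)) :
    ExtZero R W Z i := by
  have hS := linearShortComplex_shortExact f g h hf hg
  refine subsingleton_of_forall_eq_zero fun x => ?_
  obtain ⟨y, rfl⟩ := Ext.covariant_sequence_exact₃ _ hS x rfl (@Subsingleton.elim _ h₁ _ _)
  rw [@Subsingleton.elim _ h₂ y 0, Ext.zero_comp]

theorem ExtZero.co_first (h : Function.Exact f g) (hf : Function.Injective f)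
    (hg : Function.Surjective g) {i : ℕ} (h₃ : ExtZero R W Z i) (h₂ : ExtZero R W Y (i + 1)) :
    ExtZero R W X (i + 1) := by
  have hS := linearShortComplex_shortExact f g h hf hg
  refine subsingleton_of_forall_eq_zero fun x => ?_
  obtain ⟨y, rfl⟩ := Ext.covariant_sequence_exact₁ _ hS x (@Subsingleton.elim _ h₂ _ _) rfl
  rw [@Subsingleton.elim _ h₃ y 0, Ext.zero_comp]

theorem ExtZero.contra_one_iff (h : Function.Exact f g) (hf : Function.Injective f)
    (hg : Function.Surjective g) (h₂ : ExtZero R Y W 1) :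
    ExtZero R Z W 1 ↔ Function.Surjective (f.lcomp R W) := by
  have hS := linearShortComplex_shortExact f g h hf hg
  constructor
  · intro h₃ φ
    obtain ⟨y, hy⟩ := Ext.contravariant_sequence_exact₁ hS _ (Ext.mk₀ (ModuleCat.ofHom φ))
      (zero_add 1) (@Subsingleton.elim _ h₃ _ _)
    obtain ⟨ψ, rfl⟩ := Ext.homEquiv₀.symm.surjective y
    rw [Ext.homEquiv₀_symm_apply, Ext.mk₀_comp_mk₀] at hy
    refine ⟨ψ.hom, ?_⟩
    have := (Ext.mk₀_bijective _ _).1 hy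
    exact congrArg ModuleCat.Hom.hom this
  · refine fun hs => subsingleton_of_forall_eq_zero fun x => ?_
    obtain ⟨y, rfl⟩ := Ext.contravariant_sequence_exact₃ hS _ x (@Subsingleton.elim _ h₂ _ _)
      (Nat.add_comm 1 0)
    obtain ⟨ψ, rfl⟩ := Ext.homEquiv₀.symm.surjective y
    obtain ⟨χ, hχ⟩ := hs ψ.hom
    have : ψ = (linearShortComplex f g h).f ≫ ModuleCat.ofHom χ := by
      ext x; exact (LinearMap.congr_fun hχ x).symm
    rw [this, Ext.homEquiv₀_symm_apply, ← Ext.mk₀_comp_mk₀, ← Ext.comp_assoc _ _ _ (add_zero 1)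
      (zero_add 0) (by omega), hS.extClass_comp, Ext.zero_comp]

theorem ExtZero.co_one_iff (h : Function.Exact f g) (hf : Function.Injective f)
    (hg : Function.Surjective g) (h₂ : ExtZero R W Y 1) :
    ExtZero R W X 1 ↔ ∀ φ : W →ₗ[R] Z, ∃ ψ : W →ₗ[R] Y, g ∘ₗ ψ = φ := by
  have hS := linearShortComplex_shortExact f g h hf hg
  constructor
  · intro h₃ φ
    obtain ⟨y, hy⟩ := Ext.covariant_sequence_exact₃ _ hS (Ext.mk₀ (ModuleCat.ofHom φ))
      (zero_add 1) (@Subsingleton.elim _ h₃ _ _)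
    obtain ⟨ψ, rfl⟩ := Ext.homEquiv₀.symm.surjective y
    rw [Ext.homEquiv₀_symm_apply, Ext.mk₀_comp_mk₀] at hy
    refine ⟨ψ.hom, ?_⟩
    have := (Ext.mk₀_bijective _ _).1 hy
    exact congrArg ModuleCat.Hom.hom this
  · refine fun hs => subsingleton_of_forall_eq_zero fun x => ?_
    obtain ⟨y, rfl⟩ := Ext.covariant_sequence_exact₁ _ hS x (@Subsingleton.elim _ h₂ _ _)
      (zero_add 1)
    obtain ⟨ψ, rfl⟩ := Ext.homEquiv₀.symm.surjective y
    obtain ⟨χ, hχ⟩ := hs ψ.hom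
    have : ψ = ModuleCat.ofHom χ ≫ (linearShortComplex f g h).g := by
      ext x; exact (LinearMap.congr_fun hχ x).symm
    rw [this, Ext.homEquiv₀_symm_apply, ← Ext.mk₀_comp_mk₀, Ext.comp_assoc _ _ _ (add_zero 0)
      (zero_add 1) (by omega), hS.comp_extClass, Ext.comp_zero]

end ExtZero

section TorZero

open TensorProduct

/-- Vanishing of `Tor^R_i(X, J)` for `i ≥ 1`, expressed through the duality
`Tor^R_i(X, J)⁺ = Ext_R^i(X, J⁺)` with character modules. -/
def TorZero (R : Type u) [CommRing R] (X J : Type u) [AddCommGroup X] [Module R X]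
    [AddCommGroup J] [Module R J] (i : ℕ) : Prop :=
  ExtZero R X (CharacterModule J) i

variable {R : Type u} [CommRing R]

theorem dual_exact {X Y Z : Type u} [AddCommGroup X] [Module R X] [AddCommGroup Y] [Module R Y]
    [AddCommGroup Z] [Module R Z] {f : X →ₗ[R] Y} {g : Y →ₗ[R] Z} (h : Function.Exact f g)
    (hg : Function.Surjective g) :
    Function.Exact (CharacterModule.dual g) (CharacterModule.dual f) := by
  intro c
  constructor
  · intro hc
    have hk : g.toAddMonoidHom.ker ≤ (c : Y →+ AddCircle (1 : ℚ)).ker := fun y hy => by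
      obtain ⟨x, rfl⟩ := (h y).1 hy
      exact DFunLike.congr_fun hc x
    refine ⟨g.toAddMonoidHom.liftOfSurjective hg ⟨c, hk⟩, ?_⟩
    ext y
    exact AddMonoidHom.liftOfRightInverse_comp_apply _ _ (Function.rightInverse_surjInv hg)
      ⟨c, hk⟩ y
  · rintro ⟨d, rfl⟩
    ext x
    change d (g (f x)) = 0
    rw [h.apply_apply_eq_zero, map_zero]

theorem lTensor_injective_iff_forall_exists_dual {X K P : Type u} [AddCommGroup X] [Module R X]
    [AddCommGroup K] [Module R K] [AddCommGroup P] [Module R P] (κ : K →ₗ[R] P) :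
    Function.Injective (κ.lTensor X) ↔ ∀ φ : X →ₗ[R] CharacterModule K,
      ∃ ψ : X →ₗ[R] CharacterModule P, CharacterModule.dual κ ∘ₗ ψ = φ := by
  rw [LinearMap.lTensor_inj_iff_rTensor_inj, rTensor_injective_iff_lcomp_surjective]
  let swap (A B : Type u) [AddCommGroup A] [Module R A] [AddCommGroup B] [Module R B]
      (φ : A →ₗ[R] CharacterModule B) : B →ₗ[R] CharacterModule A :=
    { toFun := fun b =>
        { toFun := fun a => φ a b
          map_zero' := by rw [map_zero]; rfl
          map_add' := fun a a' => by rw [map_add]; rfl }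
      map_add' := fun b b' => by ext a; exact map_add (φ a) b b'
      map_smul' := fun r b => by
        ext a
        change φ a (r • b) = φ (r • a) b
        rw [φ.map_smul]; rfl }
  constructor
  · intro h φ
    obtain ⟨ψ, hψ⟩ := h (swap _ _ φ)
    refine ⟨swap _ _ ψ, ?_⟩
    ext x k
    exact DFunLike.congr_fun (LinearMap.congr_fun hψ k) x
  · intro h φ
    obtain ⟨ψ, hψ⟩ := h (swap _ _ φ)
    refine ⟨swap _ _ ψ, ?_⟩
    ext k x
    exact DFunLike.congr_fun (LinearMap.congr_fun hψ x) k

section RightVariable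

variable {X K P J : Type u} [AddCommGroup X] [Module R X] [AddCommGroup K] [Module R K]
  [AddCommGroup P] [Module R P] [AddCommGroup J] [Module R J] {κ : K →ₗ[R] P} {π : P →ₗ[R] J}

theorem TorZero.of_flat_right [Module.Flat R P] (i : ℕ) : TorZero R X P (i + 1) :=
  ExtZero.of_injective (Module.Flat.iff_characterModule_injective.1 inferInstance) i

theorem torZero_one_iff_right [Module.Flat R P] (h : Function.Exact κ π)
    (hκ : Function.Injective κ) (hπ : Function.Surjective π) :
    TorZero R X J 1 ↔ Function.Injective (κ.lTensor X) := by
  rw [lTensor_injective_iff_forall_exists_dual]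
  exact ExtZero.co_one_iff (dual_exact h hπ) (CharacterModule.dual_injective_of_surjective _ hπ)
    (CharacterModule.dual_surjective_of_injective _ hκ) (TorZero.of_flat_right 0)

theorem torZero_succ_iff_right [Module.Flat R P] (h : Function.Exact κ π)
    (hκ : Function.Injective κ) (hπ : Function.Surjective π) (i : ℕ) :
    TorZero R X J (i + 2) ↔ TorZero R X K (i + 1) :=
  ⟨fun h' => ExtZero.co_third (dual_exact h hπ)
    (CharacterModule.dual_injective_of_surjective _ hπ)
    (CharacterModule.dual_surjective_of_injective _ hκ) (TorZero.of_flat_right i) h',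
   fun h' => ExtZero.co_first (dual_exact h hπ)
    (CharacterModule.dual_injective_of_surjective _ hπ)
    (CharacterModule.dual_surjective_of_injective _ hκ) h' (TorZero.of_flat_right (i + 1))⟩

end RightVariable

theorem exists_free_presentation (J : Type u) [AddCommGroup J] [Module R J] :
    ∃ (K P : Type u) (_ : AddCommGroup K) (_ : AddCommGroup P) (_ : Module R K) (_ : Module R P)
      (κ : K →ₗ[R] P) (π : P →ₗ[R] J), Module.Free R P ∧ Function.Injective κ ∧
      Function.Exact κ π ∧ Function.Surjective π :=
  ⟨LinearMap.ker (Finsupp.linearCombination R (id : J → J)), J →₀ R, inferInstance, inferInstance,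
    inferInstance, inferInstance, Submodule.subtype _, Finsupp.linearCombination R id,
    inferInstance, Submodule.subtype_injective _, LinearMap.exact_subtype_ker_map _,
    Finsupp.linearCombination_id_surjective R J⟩

theorem TorZero.of_flat {X : Type u} [AddCommGroup X] [Module R X] [Module.Flat R X] (i : ℕ) :
    ∀ (J : Type u) [AddCommGroup J] [Module R J], TorZero R X J (i + 1) := by
  induction i with
  | zero =>
    intro J _ _
    obtain ⟨K, P, _, _, _, _, κ, π, _, hκ, hex, hπ⟩ := exists_free_presentation (R := R) J
    exact (torZero_one_iff_right hex hκ hπ).2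
      (Module.Flat.lTensor_preserves_injective_linearMap _ hκ)
  | succ i ih =>
    intro J _ _
    obtain ⟨K, P, _, _, _, _, κ, π, _, hκ, hex, hπ⟩ := exists_free_presentation (R := R) J
    exact (torZero_succ_iff_right hex hκ hπ i).2 (ih _)

section LeftVariable

variable {Z F X J : Type u} [AddCommGroup Z] [Module R Z] [AddCommGroup F] [Module R F]
  [AddCommGroup X] [Module R X] [AddCommGroup J] [Module R J] {φ : Z →ₗ[R] F} {π : F →ₗ[R] X}

theorem torZero_one_iff_left [Module.Flat R F] (h : Function.Exact φ π)
    (hφ : Function.Injective φ) (hπ : Function.Surjective π) :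
    TorZero R X J 1 ↔ Function.Injective (φ.rTensor J) := by
  rw [rTensor_injective_iff_lcomp_surjective]
  exact ExtZero.contra_one_iff h hφ hπ (TorZero.of_flat 0 J)

theorem torZero_succ_iff_left [Module.Flat R F] (h : Function.Exact φ π)
    (hφ : Function.Injective φ) (hπ : Function.Surjective π) (i : ℕ) :
    TorZero R X J (i + 2) ↔ TorZero R Z J (i + 1) :=
  ⟨fun h' => ExtZero.contra_first h hφ hπ (TorZero.of_flat i J) h',
   fun h' => ExtZero.contra_third h hφ hπ h' (TorZero.of_flat (i + 1) J)⟩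

theorem TorZero.of_exact (h : Function.Exact φ π) (hφ : Function.Injective φ)
    (hπ : Function.Surjective π) {i : ℕ} (h₁ : TorZero R Z J i) (h₂ : TorZero R F J (i + 1)) :
    TorZero R X J (i + 1) :=
  ExtZero.contra_third h hφ hπ h₁ h₂

open CategoryTheory in
theorem TorZero.congr (e : Z ≃ₗ[R] X) {i : ℕ} (h : TorZero R Z J i) : TorZero R X J i := by
  refine subsingleton_of_forall_eq_zero fun x => ?_
  have h1 := CategoryTheory.Abelian.Ext.mk₀_comp_mk₀_assoc e.symm.toModuleIso.hom
    e.toModuleIso.hom x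
  have h2 : e.symm.toModuleIso.hom ≫ e.toModuleIso.hom = 𝟙 (ModuleCat.of R X) := by
    ext y; simp
  rw [h2, CategoryTheory.Abelian.Ext.mk₀_id_comp] at h1
  rw [← h1, @Subsingleton.elim _ h ((CategoryTheory.Abelian.Ext.mk₀ e.toModuleIso.hom).comp x _) 0,
    CategoryTheory.Abelian.Ext.comp_zero]

end LeftVariable

end TorZero

section TorZeroBaseChange

open TensorProduct

section LeftBaseChange

variable {A A' : Type u} [CommRing A] [CommRing A'] [Algebra A A'] [Module.Flat A A']

theorem TorZero.baseChange_left (i : ℕ) : ∀ (X J : Type u) [AddCommGroup X] [Module A X]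
    [AddCommGroup J] [Module A J] [Module A' J] [IsScalarTower A A' J],
    TorZero A X J (i + 1) → TorZero A' (A' ⊗[A] X) J (i + 1) := by
  induction i with
  | zero =>
    intro X J _ _ _ _ _ _ h
    obtain ⟨K, P, _, _, _, _, φ, π, _, hφ, hex, hπ⟩ := exists_free_presentation (R := A) X
    rw [torZero_one_iff_left hex hφ hπ] at h
    refine (torZero_one_iff_left (φ := φ.baseChange A') (π := π.baseChange A')
      (lTensor_exact A' hex hπ)
      (Module.Flat.lTensor_preserves_injective_linearMap _ hφ) (LinearMap.lTensor_surjective _ hπ)).2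
      ?_
    let e (Y : Type u) [AddCommGroup Y] [Module A Y] : (A' ⊗[A] Y) ⊗[A'] J ≃ₗ[A'] J ⊗[A] Y :=
      TensorProduct.comm A' (A' ⊗[A] Y) J ≪≫ₗ
        AlgebraTensorModule.cancelBaseChange A A' A' J Y
    have h' : Function.Injective (φ.lTensor J) := (LinearMap.lTensor_inj_iff_rTensor_inj J φ).2 h
    have hcomm : ∀ t, e _ (((φ.baseChange A').rTensor J) t) = (φ.lTensor J) (e _ t) := fun t => by
      induction t with
      | zero => simp
      | add a b ha hb => simp only [map_add, ha, hb]
      | tmul t j =>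
        induction t with
        | zero => simp
        | add a b ha hb => simp only [add_tmul, map_add, ha, hb]
        | tmul a y => simp [e]
    intro s t hst
    refine (e _).injective (h' ?_)
    rw [← hcomm, ← hcomm, hst]
  | succ i ih =>
    intro X J _ _ _ _ _ _ h
    obtain ⟨K, P, _, _, _, _, φ, π, _, hφ, hex, hπ⟩ := exists_free_presentation (R := A) X
    rw [torZero_succ_iff_left hex hφ hπ] at h
    exact (torZero_succ_iff_left (φ := φ.baseChange A') (π := π.baseChange A')
      (lTensor_exact A' hex hπ)
      (Module.Flat.lTensor_preserves_injective_linearMap _ hφ)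
      (LinearMap.lTensor_surjective _ hπ) i).2 (ih _ _ h)

theorem TorZero.baseChange_right (i : ℕ) : ∀ (X E : Type u) [AddCommGroup E] [Module A E]
    [AddCommGroup X] [Module A X] [Module A' X] [IsScalarTower A A' X],
    TorZero A X E (i + 1) → TorZero A' X (A' ⊗[A] E) (i + 1) := by
  induction i with
  | zero =>
    intro X E _ _ _ _ _ _ h
    obtain ⟨K, P, _, _, _, _, φ, π, _, hφ, hex, hπ⟩ := exists_free_presentation (R := A) E
    rw [torZero_one_iff_right hex hφ hπ] at h
    refine (torZero_one_iff_right (κ := φ.baseChange A') (π := π.baseChange A')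
      (lTensor_exact A' hex hπ)
      (Module.Flat.lTensor_preserves_injective_linearMap _ hφ) (LinearMap.lTensor_surjective _ hπ)).2
      ?_
    let e (Y : Type u) [AddCommGroup Y] [Module A Y] : X ⊗[A'] (A' ⊗[A] Y) ≃ₗ[A'] X ⊗[A] Y :=
      AlgebraTensorModule.cancelBaseChange A A' A' X Y
    have hcomm : ∀ t, e _ (((φ.baseChange A').lTensor X) t) = (φ.lTensor X) (e _ t) := fun t => by
      induction t with
      | zero => simp
      | add a b ha hb => simp only [map_add, ha, hb]
      | tmul j t =>
        induction t with
        | zero => simp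
        | add a b ha hb => simp only [tmul_add, map_add, ha, hb]
        | tmul a y => simp [e]
    intro s t hst
    refine (e _).injective (h ?_)
    rw [← hcomm, ← hcomm, hst]
  | succ i ih =>
    intro X E _ _ _ _ _ _ h
    obtain ⟨K, P, _, _, _, _, φ, π, _, hφ, hex, hπ⟩ := exists_free_presentation (R := A) E
    rw [torZero_succ_iff_right hex hφ hπ] at h
    exact (torZero_succ_iff_right (κ := φ.baseChange A') (π := π.baseChange A')
      (lTensor_exact A' hex hπ)
      (Module.Flat.lTensor_preserves_injective_linearMap _ hφ)
      (LinearMap.lTensor_surjective _ hπ) i).2 (ih _ _ h)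

end LeftBaseChange

theorem TorZero.tensor_flat {B S : Type u} [CommRing B] [CommRing S] [Algebra B S]
    {N M : Type u} [AddCommGroup N] [AddCommGroup M] [Module B N] [Module S N]
    [IsScalarTower B S N] [Module B M] [Module S M] [IsScalarTower B S M] [Module.Flat S N]
    (i : ℕ) : ∀ (J : Type u) [AddCommGroup J] [Module B J],
    TorZero B M J (i + 1) → TorZero B (N ⊗[S] M) J (i + 1) := by
  induction i with
  | zero =>
    intro J _ _ h
    obtain ⟨K, P, _, _, _, _, φ, π, _, hφ, hex, hπ⟩ := exists_free_presentation (R := B) J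
    rw [torZero_one_iff_right hex hφ hπ] at h ⊢
    let e (Y : Type u) [AddCommGroup Y] [Module B Y] :
        (N ⊗[S] M) ⊗[B] Y ≃ₗ[S] N ⊗[S] (M ⊗[B] Y) :=
      AlgebraTensorModule.assoc B S S N M Y
    let ψ := (AlgebraTensorModule.lTensor S M φ).lTensor N
    have hψ : Function.Injective ψ := Module.Flat.lTensor_preserves_injective_linearMap _ h
    have hcomm : ∀ t, e _ ((φ.lTensor (N ⊗[S] M)) t) = ψ (e _ t) := fun t => by
      induction t with
      | zero => simp
      | add a b ha hb => simp only [map_add, ha, hb]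
      | tmul t j =>
        induction t with
        | zero => simp
        | add a b ha hb => simp only [add_tmul, map_add, ha, hb]
        | tmul a y => simp [e, ψ]
    intro s t hst
    refine (e _).injective (hψ ?_)
    rw [← hcomm, ← hcomm, hst]
  | succ i ih =>
    intro J _ _ h
    obtain ⟨K, P, _, _, _, _, φ, π, _, hφ, hex, hπ⟩ := exists_free_presentation (R := B) J
    rw [torZero_succ_iff_right hex hφ hπ] at h ⊢
    exact ih _ h

/-- Restriction of scalars along a flat map preserves injectivity. -/
theorem injective_restrictScalars_of_flat {A A' : Type u} [CommRing A] [CommRing A']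
    [Algebra A A'] [Module.Flat A A'] {J : Type u} [AddCommGroup J] [Module A J] [Module A' J]
    [IsScalarTower A A' J] (hJ : Module.Injective A' J) : Module.Injective A J where
  out X Y _ _ _ _ f hf g := by
    obtain ⟨h, hh⟩ := hJ.out (f.baseChange A')
      (Module.Flat.lTensor_preserves_injective_linearMap f hf) (AlgebraTensorModule.lift
        ((LinearMap.toSpanSingleton A' (X →ₗ[A] J) g)))
    refine ⟨h.restrictScalars A ∘ₗ TensorProduct.mk A A' Y 1, fun x => ?_⟩
    have := hh (1 ⊗ₜ x)
    simpa using this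

end TorZeroBaseChange

section FlatDimensionBounds

open TensorProduct

/-- `Tor^R_i(X, J)` vanishes for all injective modules `J` and all `i > g`. -/
def TorInjBound (R : Type u) [CommRing R] (X : Type u) [AddCommGroup X] [Module R X] (g : ℕ) :
    Prop :=
  ∀ (J : Type u) [AddCommGroup J] [Module R J], Module.Injective R J →
    ∀ i, g ≤ i → TorZero R X J (i + 1)

/-- `Tor^R_i(X, J)` vanishes for all modules `J` and all `i > d`. -/
def TorBound (R : Type u) [CommRing R] (X : Type u) [AddCommGroup X] [Module R X] (d : ℕ) :
    Prop :=
  ∀ (J : Type u) [AddCommGroup J] [Module R J], ∀ i, d ≤ i → TorZero R X J (i + 1)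

variable {R : Type u} [CommRing R]

theorem TorBound.of_fdLE (d : ℕ) : ∀ (X : Type u) [AddCommGroup X] [Module R X],
    fdLE R d X → TorBound R X d := by
  induction d with
  | zero =>
    intro X _ _ h J _ _ i _
    have : Module.Flat R X := h
    exact TorZero.of_flat i J
  | succ d ih =>
    intro X _ _ h J _ _ i hi
    obtain ⟨c, hc⟩ := h
    obtain ⟨i, rfl⟩ : ∃ j, i = j + 1 := ⟨i - 1, by omega⟩
    have := c.flat
    exact (torZero_succ_iff_left (LinearMap.exact_subtype_ker_map c.π)
      (Submodule.subtype_injective _) c.surj i).2 (ih _ hc J i (by omega))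

theorem TorInjBound.of_gorensteinFlat {X : Type u} [AddCommGroup X] [Module R X]
    (h : IsGorensteinFlat R X) : TorInjBound R X 0 := by
  obtain ⟨⟨F, d, flat, exact, exact_tensor, ⟨e⟩⟩⟩ := h
  intro J _ _ hJ i _
  refine TorZero.congr (Z := LinearMap.range (d 0)) e.symm ?_
  have hinc (n : ℤ) : Function.Exact (LinearMap.range (d (n + 1))).subtype
      (d n).rangeRestrict := fun y => by
    rw [← LinearMap.mem_ker, LinearMap.ker_rangeRestrict, LinearMap.mem_ker, exact n y]
    exact ⟨fun h => ⟨⟨y, h⟩, rfl⟩, fun ⟨x, hx⟩ => hx ▸ x.2⟩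
  suffices ∀ (i : ℕ) (n : ℤ), TorZero R (LinearMap.range (d n)) J (i + 1) from this i 0
  intro i
  induction i with
  | zero =>
    intro n
    refine (torZero_one_iff_left (hinc n) (Submodule.subtype_injective _)
      (d n).surjective_rangeRestrict).2 ?_
    rw [← LinearMap.lTensor_inj_iff_rTensor_inj, injective_iff_map_eq_zero]
    intro t ht
    obtain ⟨s, rfl⟩ := LinearMap.lTensor_surjective J (d (n + 1)).surjective_rangeRestrict t
    rw [← LinearMap.comp_apply, ← LinearMap.lTensor_comp] at ht
    obtain ⟨r, rfl⟩ := (exact_tensor J hJ (n + 1) s).1 ht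
    rw [← LinearMap.comp_apply, ← LinearMap.lTensor_comp]
    have : (d (n + 1)).rangeRestrict ∘ₗ d (n + 1 + 1) = 0 := by
      ext x
      exact (exact (n + 1)).apply_apply_eq_zero x
    rw [this, LinearMap.lTensor_zero, LinearMap.zero_apply]
  | succ i ih =>
    intro n
    exact (torZero_succ_iff_left (hinc n) (Submodule.subtype_injective _)
      (d n).surjective_rangeRestrict i).2 (ih (n + 1))

theorem TorInjBound.of_gfdLE (g : ℕ) : ∀ (X : Type u) [AddCommGroup X] [Module R X],
    gfdLE R g X → TorInjBound R X g := by
  induction g with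
  | zero => exact fun X _ _ h => TorInjBound.of_gorensteinFlat h
  | succ g ih =>
    intro X _ _ h J _ _ hJ i hi
    obtain ⟨c, hc⟩ := h
    obtain ⟨i, rfl⟩ : ∃ j, i = j + 1 := ⟨i - 1, by omega⟩
    exact TorZero.of_exact (LinearMap.exact_subtype_ker_map c.π)
      (Submodule.subtype_injective _) c.surj (ih _ hc J hJ i (by omega))
      (TorInjBound.of_gorensteinFlat c.gflat J hJ (i + 1) (Nat.zero_le _))

end FlatDimensionBounds

section LocalTor

open TensorProduct

variable {A : Type u} [CommRing A] [IsNoetherianRing A]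

theorem exists_finite_presentation (X : Type u) [AddCommGroup X] [Module A X]
    [Module.Finite A X] :
    ∃ (K P : Type u) (_ : AddCommGroup K) (_ : AddCommGroup P) (_ : Module A K) (_ : Module A P)
      (κ : K →ₗ[A] P) (π : P →ₗ[A] X), Module.Finite A K ∧ Module.Finite A P ∧ Module.Free A P ∧
      Function.Injective κ ∧ Function.Exact κ π ∧ Function.Surjective π := by
  obtain ⟨r, π, hπ⟩ := Module.Finite.exists_fin' A X
  exact ⟨LinearMap.ker π, Fin r → A, inferInstance, inferInstance,
    inferInstance, inferInstance, Submodule.subtype _, π, inferInstance, inferInstance,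
    inferInstance, Submodule.subtype_injective _, LinearMap.exact_subtype_ker_map _, hπ⟩

theorem PdLE.of_torZero [IsLocalRing A] (d : ℕ) : ∀ (X : Type u) [AddCommGroup X] [Module A X]
    [Module.Finite A X], (∀ i, d ≤ i → TorZero A X (ResidueField A) (i + 1)) → PdLE A X d := by
  induction d with
  | zero =>
    intro X _ _ _ h
    obtain ⟨K, P, _, _, _, _, κ, π, _, _, _, hκ, hex, hπ⟩ := exists_finite_presentation (A := A) X
    have h1 := (torZero_one_iff_left hex hκ hπ).1 (h 0 le_rfl)
    rw [← LinearMap.lTensor_inj_iff_rTensor_inj] at h1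
    have := Module.free_of_lTensor_residueField_injective κ π hπ hex h1
    exact PdLE.of_projective 0
  | succ d ih =>
    intro X _ _ _ h
    obtain ⟨K, P, _, _, _, _, κ, π, _, _, _, hκ, hex, hπ⟩ := exists_finite_presentation (A := A) X
    exact PdLE.right hex hκ hπ (ih K fun i hi => (torZero_succ_iff_left hex hκ hπ i).1
      (h (i + 1) (by omega))) (PdLE.of_projective _)

end LocalTor

section ExtRegular

open CategoryTheory Abelian RingTheory.Sequence

variable {A : Type u} [CommRing A]

theorem ExtZero.of_isSMulRegular {X N Z : Type u} [AddCommGroup X] [Module A X] [AddCommGroup N]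
    [Module A N] [AddCommGroup Z] [Module A Z] {x : A} (hx : x ∈ Module.annihilator A X)
    {g : N →ₗ[A] Z} (h : Function.Exact (LinearMap.lsmul A N x) g) (hreg : IsSMulRegular N x)
    (hg : Function.Surjective g) {i : ℕ} (hZ : ExtZero A X Z i) : ExtZero A X N (i + 1) := by
  have hS := linearShortComplex_shortExact _ g h hreg hg
  refine subsingleton_of_forall_eq_zero fun e => ?_
  have he : e.comp (Ext.mk₀ (linearShortComplex _ g h).f) (add_zero _) = 0 := by
    have h1 : (linearShortComplex _ g h).f = x • 𝟙 (ModuleCat.of A N) := by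
      ext y; rfl
    have h2 : x • 𝟙 (ModuleCat.of A X) = 0 := by
      ext y; exact Module.mem_annihilator.1 hx y
    rw [h1, Ext.mk₀_smul, Ext.comp_smul]
    change x • e.comp (Ext.mk₀ (𝟙 (ModuleCat.of A N))) _ = 0
    rw [Ext.comp_mk₀_id, ← Ext.mk₀_id_comp e, ← Ext.smul_comp, ← Ext.mk₀_smul, h2, Ext.mk₀_zero,
      Ext.zero_comp]
  obtain ⟨z, rfl⟩ := Ext.covariant_sequence_exact₁ _ hS e he rfl
  rw [@Subsingleton.elim _ hZ z 0, Ext.zero_comp]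

theorem extZero_zero_iff {X N : Type u} [AddCommGroup X] [Module A X] [AddCommGroup N]
    [Module A N] : ExtZero A X N 0 ↔ Subsingleton (X →ₗ[A] N) :=
  (Ext.homEquiv₀.trans ModuleCat.homEquiv).subsingleton_congr

open Pointwise in
theorem ExtZero.of_isWeaklyRegular {X : Type u} [AddCommGroup X] [Module A X] (xs : List A) :
    ∀ (N : Type u) [AddCommGroup N] [Module A N], IsWeaklyRegular N xs →
    (∀ x ∈ xs, x ∈ Module.annihilator A X) → ∀ i < xs.length, ExtZero A X N i := by
  induction xs with
  | nil => simp
  | cons x xs ih =>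
    intro N _ _ hreg hann i hi
    obtain ⟨h1, h2⟩ := (isWeaklyRegular_cons_iff N x xs).1 hreg
    have hx := hann x List.mem_cons_self
    cases i with
    | zero =>
      exact extZero_zero_iff.2 (IsSMulRegular.linearMap_subsingleton_of_mem_annihilator h1 hx)
    | succ i =>
      refine ExtZero.of_isSMulRegular hx (g := Submodule.mkQ (x • (⊤ : Submodule A N))) ?_ h1
        (Submodule.mkQ_surjective _) (ih (QuotSMulTop x N) h2
          (fun y hy => hann y (List.mem_cons_of_mem x hy)) i (by simpa using hi))
      intro y
      rw [Submodule.mkQ_apply, Submodule.Quotient.mk_eq_zero,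
        Submodule.mem_smul_pointwise_iff_exists]
      simp

theorem exists_not_extZero [IsLocalRing A] [IsNoetherianRing A] {X : Type u} [AddCommGroup X]
    [Module A X] [Nontrivial X] [Module.Finite A X] (I : Ideal A) :
    I ≠ ⊤ → ∃ i, ¬ ExtZero A X (A ⧸ I) i := by
  induction I using WellFoundedGT.induction with
  | ind I ih =>
  intro hI
  by_cases h0 : ExtZero A X (A ⧸ I) 0
  swap
  · exact ⟨0, h0⟩
  obtain ⟨x, hx, hreg⟩ := IsSMulRegular.subsingleton_linearMap_iff.1 (extZero_zero_iff.1 h0)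
  have hxm : x ∈ maximalIdeal A := by
    refine le_maximalIdeal ?_ hx
    rw [Ne, Module.annihilator_eq_top_iff]
    exact not_subsingleton X
  have hlt : I < I ⊔ Ideal.span {x} := by
    refine lt_of_le_of_ne le_sup_left fun heq => ?_
    have hxI : x ∈ I := heq ▸ (le_sup_right : Ideal.span {x} ≤ _) (Ideal.mem_span_singleton_self x)
    have h1 : x • (1 : A ⧸ I) = x • 0 := by
      rw [smul_zero, Algebra.smul_def, mul_one]
      exact Ideal.Quotient.eq_zero_iff_mem.2 hxI
    have h2 := hreg h1
    exact hI ((Ideal.eq_top_iff_one _).2 (Ideal.Quotient.eq_zero_iff_mem.1 (by simpa using h2)))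
  have hne : I ⊔ Ideal.span {x} ≠ ⊤ := ne_top_of_le_ne_top (Ideal.IsPrime.ne_top inferInstance)
    (sup_le (le_maximalIdeal hI) ((Ideal.span_singleton_le_iff_mem _).2 hxm))
  obtain ⟨i, hi⟩ := ih _ hlt hne
  by_contra! hcon
  refine hi (ExtZero.co_third (f := LinearMap.lsmul A (A ⧸ I) x)
    (g := (Submodule.factor (le_sup_left : I ≤ I ⊔ Ideal.span {x}))) ?_ hreg
    (Submodule.factor_surjective _) (hcon i) (hcon (i + 1)))
  intro y
  obtain ⟨y, rfl⟩ := Ideal.Quotient.mk_surjective y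
  change Ideal.Quotient.mk (I ⊔ Ideal.span {x}) y = 0 ↔ _
  rw [Ideal.Quotient.eq_zero_iff_mem, Submodule.mem_sup]
  constructor
  · rintro ⟨a, ha, b, hb, rfl⟩
    obtain ⟨c, rfl⟩ := Ideal.mem_span_singleton'.1 hb
    refine ⟨Ideal.Quotient.mk I c, ?_⟩
    rw [map_add, Ideal.Quotient.eq_zero_iff_mem.2 ha, zero_add, mul_comm]
    rfl
  · rintro ⟨z, hz⟩
    obtain ⟨z, rfl⟩ := Ideal.Quotient.mk_surjective z
    have hz' : Ideal.Quotient.mk I (x * z) = Ideal.Quotient.mk I y := hz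
    exact ⟨y - x * z, Ideal.Quotient.eq.1 hz'.symm, x * z,
      Ideal.mul_mem_right _ _ (Ideal.mem_span_singleton_self x), by ring⟩

/-- If `Ext_A^i(X, A)` vanishes for `i > g`, then regular sequences in the annihilator of `X` have
length at most `g`. -/
theorem length_le_of_extZero [IsLocalRing A] [IsNoetherianRing A] {X : Type u} [AddCommGroup X]
    [Module A X] [Nontrivial X] [Module.Finite A X] {g : ℕ}
    (h : ∀ i, g ≤ i → ExtZero A X A (i + 1)) {xs : List A} (hreg : IsWeaklyRegular A xs)
    (hann : ∀ x ∈ xs, x ∈ Module.annihilator A X) : xs.length ≤ g := by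
  obtain ⟨i, hi⟩ := exists_not_extZero (X := X) (⊥ : Ideal A) bot_ne_top
  by_contra! hlt
  have key : ∀ j, ExtZero A X A j := fun j => by
    by_cases hj : j < xs.length
    · exact ExtZero.of_isWeaklyRegular xs A hreg hann j hj
    · obtain ⟨j, rfl⟩ : ∃ l, j = l + 1 := ⟨j - 1, by omega⟩
      exact h j (by omega)
  refine hi (ExtZero.co_third (X := (⊥ : Ideal A)) (f := (⊥ : Ideal A).subtype)
    (g := (⊥ : Ideal A).mkQ) (LinearMap.exact_subtype_mkQ _) (Submodule.subtype_injective _)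
    (Submodule.mkQ_surjective _) (key i) ?_)
  exact ExtZero.of_injective ⟨fun _ _ _ _ _ _ _ _ _ => ⟨0, fun _ => Subsingleton.elim _ _⟩⟩ i

end ExtRegular

section DualSurjective

open TensorProduct

variable {A : Type u} [CommRing A]

/-- Evaluation of a functional on the left factor of a tensor product. -/
noncomputable def evalLeft {Z N : Type u} [AddCommGroup Z] [Module A Z] [AddCommGroup N]
    [Module A N] (c : Module.Dual A Z) : Z ⊗[A] N →ₗ[A] N :=
  (TensorProduct.lid A N).toLinearMap ∘ₗ c.rTensor N

@[simp]
theorem evalLeft_tmul {Z N : Type u} [AddCommGroup Z] [Module A Z] [AddCommGroup N]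
    [Module A N] (c : Module.Dual A Z) (z : Z) (n : N) : evalLeft c (z ⊗ₜ[A] n) = c z • n := by
  simp [evalLeft]

theorem eq_zero_of_forall_evalLeft {F N ι : Type u} [AddCommGroup F] [Module A F] [AddCommGroup N]
    [Module A N] [Fintype ι] (b : Module.Basis ι A F) (t : F ⊗[A] N)
    (h : ∀ j, evalLeft (b.coord j) t = 0) : t = 0 := by
  have key : t = ∑ j, b j ⊗ₜ[A] evalLeft (b.coord j) t := by
    clear h
    induction t with
    | zero => simp
    | add x y hx hy =>
      conv_lhs => rw [hx, hy]
      simp [TensorProduct.tmul_add, Finset.sum_add_distrib]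
    | tmul f n =>
      simp only [evalLeft_tmul, ← TensorProduct.smul_tmul, ← TensorProduct.sum_tmul,
        Module.Basis.coord_apply, b.sum_repr]
  rw [key]
  simp [h]

theorem exists_ne_zero_of_socle [IsLocalRing A] {N X : Type u} [AddCommGroup N] [Module A N]
    [AddCommGroup X] [Module A X] [Module.Finite A X] [Nontrivial X] {e : N} (he : e ≠ 0)
    (hme : ∀ a ∈ maximalIdeal A, a • e = 0) : ∃ l : X →ₗ[A] N, l ≠ 0 := by
  obtain ⟨x, hv⟩ : ∃ x : X, (1 : ResidueField A) ⊗ₜ[A] x ≠ 0 := by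
    by_contra! h
    have : Subsingleton (ResidueField A ⊗[A] X) := subsingleton_of_forall_eq_zero fun t => by
      induction t with
      | zero => rfl
      | add x y hx hy => rw [hx, hy, add_zero]
      | tmul r x => rw [← mul_one r, ← smul_eq_mul, ← TensorProduct.smul_tmul', h, smul_zero]
    exact not_subsingleton X (IsLocalRing.subsingleton_tensorProduct.1 this)
  obtain ⟨c, hc⟩ : ∃ c : Module.Dual (ResidueField A) (ResidueField A ⊗[A] X),
      c (1 ⊗ₜ x) ≠ 0 := by
    by_contra! h
    exact hv ((Module.forall_dual_apply_eq_zero_iff _ _).1 h)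
  let j : ResidueField A →ₗ[A] N := (maximalIdeal A).liftQ (LinearMap.toSpanSingleton A N e)
    fun a ha => by simpa using hme a ha
  refine ⟨j ∘ₗ c.restrictScalars A ∘ₗ TensorProduct.mk A _ X 1, fun h0 => ?_⟩
  have h1 : j (c (1 ⊗ₜ x)) = 0 := LinearMap.congr_fun h0 x
  obtain ⟨a, ha⟩ := Submodule.Quotient.mk_surjective _ (c (1 ⊗ₜ x))
  rw [← ha] at h1 hc
  have h2 : a • e = 0 := h1
  have hau : IsUnit a := by
    by_contra hu
    exact hc ((Submodule.Quotient.mk_eq_zero _).2 ((mem_maximalIdeal a).2 hu))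
  exact he ((hau.smul_eq_zero).1 h2)

theorem lcomp_surjective_of_rTensor_injective [IsLocalRing A] [IsNoetherianRing A]
    {N Z F : Type u} [AddCommGroup N] [Module A N] [AddCommGroup Z] [Module A Z]
    [AddCommGroup F] [Module A F] [Module.Finite A Z] [Module.Finite A F] [Module.Free A F]
    (hN : Module.Injective A N) {e : N} (he : e ≠ 0) (hme : ∀ a ∈ maximalIdeal A, a • e = 0)
    (φ : Z →ₗ[A] F) (hφ : Function.Injective (φ.rTensor N)) :
    Function.Surjective (φ.lcomp A A) := by
  rw [← LinearMap.range_eq_top]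
  by_contra hne
  have : Nontrivial ((Z →ₗ[A] A) ⧸ LinearMap.range (φ.lcomp A A)) :=
    Submodule.Quotient.nontrivial_iff.2 hne
  obtain ⟨l, hl⟩ := exists_ne_zero_of_socle (X := (Z →ₗ[A] A) ⧸ LinearMap.range (φ.lcomp A A)) he hme
  obtain ⟨n, p, hp⟩ := Module.Finite.exists_fin' A Z
  let l' := l ∘ₗ (LinearMap.range (φ.lcomp A A)).mkQ
  obtain ⟨L, hL⟩ := hN.out (p.lcomp A A) (fun c d hcd => by
    ext z
    obtain ⟨y, rfl⟩ := hp z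
    exact LinearMap.congr_fun hcd y) l'
  let b := Pi.basisFun A (Fin n)
  let ζ : Z ⊗[A] N := ∑ i, p (b i) ⊗ₜ[A] L (b.coord i)
  have hζ (c : Z →ₗ[A] A) : evalLeft c ζ = l' c := by
    rw [← hL, map_sum]
    simp only [evalLeft_tmul, ← map_smul, ← map_sum]
    congr 1
    refine b.ext fun j => ?_
    simp [Finsupp.single_apply]
  have h0 : φ.rTensor N ζ = 0 := by
    refine eq_zero_of_forall_evalLeft ((Module.Free.chooseBasis A F)) _ fun j => ?_
    have : evalLeft ((Module.Free.chooseBasis A F).coord j) (φ.rTensor N ζ) =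
        evalLeft (φ.lcomp A A ((Module.Free.chooseBasis A F).coord j)) ζ := by
      simp [ζ]
    rw [this, hζ]
    simp only [l', LinearMap.comp_apply, Submodule.mkQ_apply]
    rw [(Submodule.Quotient.mk_eq_zero _).2 (LinearMap.mem_range_self _ _), map_zero]
  have h1 : ζ = 0 := hφ (by rw [h0, map_zero])
  refine hl (LinearMap.ext fun c => ?_)
  obtain ⟨c, rfl⟩ := Submodule.mkQ_surjective _ c
  exact (hζ c).symm.trans (by rw [h1, map_zero]; rfl)

theorem ExtZero.of_torZero [IsLocalRing A] [IsNoetherianRing A] {N : Type u} [AddCommGroup N]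
    [Module A N] (hN : Module.Injective A N) {e : N} (he : e ≠ 0)
    (hme : ∀ a ∈ maximalIdeal A, a • e = 0) (i : ℕ) : ∀ (X : Type u) [AddCommGroup X] [Module A X]
    [Module.Finite A X], TorZero A X N (i + 1) → ExtZero A X A (i + 1) := by
  induction i with
  | zero =>
    intro X _ _ _ h
    obtain ⟨K, P, _, _, _, _, κ, π, _, _, _, hκ, hex, hπ⟩ := exists_finite_presentation (A := A) X
    rw [zero_add, torZero_one_iff_left hex hκ hπ] at h
    rw [zero_add, ExtZero.contra_one_iff hex hκ hπ (ExtZero.of_projective 0)]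
    exact lcomp_surjective_of_rTensor_injective hN he hme κ h
  | succ i ih =>
    intro X _ _ _ h
    obtain ⟨K, P, _, _, _, _, κ, π, _, _, _, hκ, hex, hπ⟩ := exists_finite_presentation (A := A) X
    exact ExtZero.contra_third hex hκ hπ (ih K ((torZero_succ_iff_left hex hκ hπ i).1 h))
      (ExtZero.of_projective _)

end DualSurjective

section TorsionInjective

open TensorProduct CategoryTheory Abelian

theorem ExtZero.contra_second {R X Y Z W : Type u} [CommRing R] [AddCommGroup X] [Module R X]
    [AddCommGroup Y] [Module R Y] [AddCommGroup Z] [Module R Z] [AddCommGroup W] [Module R W]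
    {f : X →ₗ[R] Y} {g : Y →ₗ[R] Z} (h : Function.Exact f g) (hf : Function.Injective f)
    (hg : Function.Surjective g) {i : ℕ} (h₁ : ExtZero R X W i) (h₃ : ExtZero R Z W i) :
    ExtZero R Y W i := by
  have hS := linearShortComplex_shortExact f g h hf hg
  refine subsingleton_of_forall_eq_zero fun x => ?_
  obtain ⟨y, rfl⟩ := Ext.contravariant_sequence_exact₂ hS _ x (@Subsingleton.elim _ h₁ _ _)
  rw [@Subsingleton.elim _ h₃ y 0, Ext.comp_zero]

variable {A : Type u} [CommRing A] [IsLocalRing A]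

/-- Every homomorphism from the maximal ideal to `N` extends to the ring. -/
def ExtendsFromMax (A : Type u) [CommRing A] [IsLocalRing A] (N : Type u) [AddCommGroup N]
    [Module A N] : Prop :=
  ∀ g : maximalIdeal A →ₗ[A] N, ∃ x : N, ∀ a : maximalIdeal A, g a = (a : A) • x

theorem ExtendsFromMax.extZero {N : Type u} [AddCommGroup N] [Module A N]
    (h : ExtendsFromMax A N) : ExtZero A (A ⧸ maximalIdeal A) N 1 := by
  have hex : Function.Exact (maximalIdeal A).subtype (maximalIdeal A).mkQ :=
    LinearMap.exact_subtype_mkQ _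
  rw [ExtZero.contra_one_iff hex (Submodule.subtype_injective _) (Submodule.mkQ_surjective _)
    (ExtZero.of_projective 0)]
  intro g
  obtain ⟨x, hx⟩ := h g
  exact ⟨LinearMap.toSpanSingleton A N x, LinearMap.ext fun a => (hx a).symm⟩

theorem ExtendsFromMax.extZero_of_pow [IsNoetherianRing A] {N : Type u} [AddCommGroup N]
    [Module A N] (h : ExtendsFromMax A N) (t : ℕ) (X : Type u) [AddCommGroup X] [Module A X]
    [hX : Module.Finite A X] (ht : maximalIdeal A ^ t ≤ Module.annihilator A X) :
    ExtZero A X N 1 := by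
  revert ht
  induction hX using IsNoetherianRing.induction_on_isQuotientEquivQuotientPrime A with
  | subsingleton X =>
    intro _
    exact ExtZero.of_projective 0
  | quotient X p e =>
    intro ht
    have hp : p.1 = maximalIdeal A := by
      refine le_antisymm (le_maximalIdeal p.2.ne_top) (p.2.le_of_pow_le (n := t) (ht.trans ?_))
      rw [e.annihilator_eq, Ideal.annihilator_quotient]
    have h1 := h.extZero
    rw [← hp] at h1
    exact ExtZero.contra_second (f := (0 : PUnit.{u + 1} →ₗ[A] X)) (g := e.toLinearMap)
      (fun x => by simpa using eq_comm) (fun _ _ _ => rfl) e.surjective (ExtZero.of_projective 0) h1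
  | exact X Y Z f g hf hg hex h₁ h₃ =>
    intro ht
    exact ExtZero.contra_second hex hf hg (h₁ (ht.trans (f.annihilator_le_of_injective hf)))
      (h₃ (ht.trans (g.annihilator_le_of_surjective hg)))

theorem ExtendsFromMax.injective [IsNoetherianRing A] {N : Type u} [AddCommGroup N]
    [Module A N] (h : ExtendsFromMax A N)
    (htor : ∀ x : N, ∃ s, ∀ a ∈ maximalIdeal A ^ s, a • x = 0) : Module.Injective A N := by
  refine Module.Baer.injective fun I g => ?_
  obtain ⟨s, hs⟩ : ∃ s, ∀ a ∈ maximalIdeal A ^ s, ∀ y : I, a • g y = 0 := by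
    obtain ⟨S, hS⟩ := (inferInstance : Module.Finite A I).fg_top
    choose s hs using fun x => htor (g x)
    refine ⟨S.sup s, fun a ha y => ?_⟩
    have hy : y ∈ Submodule.span A (S : Set I) := by rw [hS]; trivial
    induction hy using Submodule.span_induction with
    | mem y hy => exact hs y a (Ideal.pow_le_pow_right (Finset.le_sup hy) ha)
    | zero => simp
    | add y z _ _ hy hz => rw [map_add, smul_add, hy, hz, add_zero]
    | smul b y _ hy => rw [map_smul, smul_comm, hy, smul_zero]
  obtain ⟨k, hk⟩ := (maximalIdeal A).exists_pow_inf_eq_pow_smul (M := A) I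
  let t := s + k
  let ρ : I →ₗ[A] A ⧸ maximalIdeal A ^ t := (maximalIdeal A ^ t).mkQ ∘ₗ I.subtype
  have hker : LinearMap.ker ρ ≤ LinearMap.ker g := by
    intro y hy
    have hy1 : (y : A) ∈ maximalIdeal A ^ t := (Submodule.Quotient.mk_eq_zero _).1 hy
    have hy2 : (y : A) ∈ maximalIdeal A ^ s • I := by
      have : (y : A) ∈ maximalIdeal A ^ t • (⊤ : Ideal A) ⊓ I := ⟨by simpa using hy1, y.2⟩
      rw [hk t (by omega), show t - k = s by omega] at this
      exact Submodule.smul_mono le_rfl inf_le_right this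
    have hy3 : ∀ z ∈ maximalIdeal A ^ s • I, ∀ hz : z ∈ I, g ⟨z, hz⟩ = 0 := by
      intro z hz
      induction hz using Submodule.smul_induction_on' with
      | smul a ha n hn =>
        intro _
        exact (g.map_smul a ⟨n, hn⟩).trans (hs a ha ⟨n, hn⟩)
      | add x hx y hy h1 h2 =>
        intro _
        have hx' := Submodule.smul_le_right hx
        have hy' := Submodule.smul_le_right hy
        exact (g.map_add ⟨x, hx'⟩ ⟨y, hy'⟩).trans (by rw [h1, h2, add_zero])
    exact hy3 _ hy2 y.2
  let f : (I ⧸ LinearMap.ker ρ) →ₗ[A] A ⧸ maximalIdeal A ^ t := (LinearMap.ker ρ).liftQ ρ le_rfl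
  have hf : Function.Injective f := LinearMap.ker_eq_bot.1 (Submodule.ker_liftQ_eq_bot' _ _ rfl)
  have h1 : ExtZero A (A ⧸ maximalIdeal A ^ t) N 1 :=
    h.extZero_of_pow t _ (by rw [Ideal.annihilator_quotient])
  have h2 : ExtZero A ((A ⧸ maximalIdeal A ^ t) ⧸ LinearMap.range f) N 1 := by
    refine h.extZero_of_pow t _ (le_trans ?_
      ((LinearMap.range f).mkQ.annihilator_le_of_surjective (Submodule.mkQ_surjective _)))
    rw [Ideal.annihilator_quotient]
  obtain ⟨G, hG⟩ := (ExtZero.contra_one_iff (LinearMap.exact_map_mkQ_range f) hf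
    (Submodule.mkQ_surjective _) h1).1 h2 ((LinearMap.ker ρ).liftQ g hker)
  refine ⟨G ∘ₗ (maximalIdeal A ^ t).mkQ, fun x hx => ?_⟩
  exact LinearMap.congr_fun hG (Submodule.Quotient.mk ⟨x, hx⟩)

/-- The part of the character module of a local ring that is torsion with respect to the maximal
ideal. -/
def torsionCharacter (A : Type u) [CommRing A] [IsLocalRing A] :
    Submodule A (CharacterModule A) where
  carrier := {c | ∃ s, ∀ a ∈ maximalIdeal A ^ s, a • c = 0}
  add_mem' := by
    rintro c d ⟨s, hs⟩ ⟨t, ht⟩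
    refine ⟨max s t, fun a ha => ?_⟩
    rw [smul_add, hs a (Ideal.pow_le_pow_right (le_max_left _ _) ha),
      ht a (Ideal.pow_le_pow_right (le_max_right _ _) ha), add_zero]
  zero_mem' := ⟨0, fun a _ => smul_zero a⟩
  smul_mem' := by
    rintro b c ⟨s, hs⟩
    exact ⟨s, fun a ha => by rw [smul_comm, hs a ha, smul_zero]⟩

theorem torsionCharacter_torsion (x : torsionCharacter A) :
    ∃ s, ∀ a ∈ maximalIdeal A ^ s, a • x = 0 := by
  obtain ⟨c, s, hs⟩ := x
  exact ⟨s, fun a ha => Subtype.ext (hs a ha)⟩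

theorem extendsFromMax_torsionCharacter [IsNoetherianRing A] :
    ExtendsFromMax A (torsionCharacter A) := by
  intro g
  have hinj : Module.Injective A (CharacterModule A) :=
    Module.Flat.iff_characterModule_injective.1 inferInstance
  obtain ⟨G, hG⟩ := hinj.out (maximalIdeal A).subtype (Submodule.subtype_injective _)
    ((torsionCharacter A).subtype ∘ₗ g)
  have hG' (a : maximalIdeal A) : (a : A) • G 1 = (g a : CharacterModule A) := by
    rw [← map_smul, smul_eq_mul, mul_one]
    exact hG a
  obtain ⟨S, hS⟩ := (inferInstance : Module.Finite A (maximalIdeal A)).fg_top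
  choose s hs using fun x : maximalIdeal A => torsionCharacter_torsion (g x)
  have key (a : A) (ha : a ∈ maximalIdeal A ^ (S.sup s)) (y : maximalIdeal A) :
      a • g y = 0 := by
    have hy : y ∈ Submodule.span A (S : Set (maximalIdeal A)) := by rw [hS]; trivial
    induction hy using Submodule.span_induction with
    | mem y hy => exact hs y a (Ideal.pow_le_pow_right (Finset.le_sup hy) ha)
    | zero => simp
    | add y z _ _ hy hz => rw [map_add, smul_add, hy, hz, add_zero]
    | smul b y _ hy => rw [map_smul, smul_comm, hy, smul_zero]
  have hmem : G 1 ∈ torsionCharacter A := by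
    refine ⟨S.sup s + 1, fun a ha => ?_⟩
    rw [pow_succ] at ha
    induction ha using Submodule.mul_induction_on' with
    | mem_mul_mem a ha b hb =>
      rw [mul_smul, hG' ⟨b, hb⟩]
      exact congrArg Subtype.val (key a ha ⟨b, hb⟩)
    | add a _ b _ h1 h2 => rw [add_smul, h1, h2, add_zero]
  exact ⟨⟨G 1, hmem⟩, fun a => Subtype.ext (hG' a).symm⟩

theorem exists_socle_torsionCharacter :
    ∃ e : torsionCharacter A, e ≠ 0 ∧ ∀ a ∈ maximalIdeal A, a • e = 0 := by
  obtain ⟨c, hc⟩ := CharacterModule.exists_character_apply_ne_zero_of_ne_zero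
    (one_ne_zero (α := ResidueField A))
  let q : A →ₗ[A] ResidueField A := Algebra.linearMap A (ResidueField A)
  have hd (a : A) (ha : a ∈ maximalIdeal A) : a • CharacterModule.dual q c = 0 := by
    ext b
    change c (q (a • b)) = 0
    have : q (a • b) = 0 := by
      rw [map_smul, Algebra.smul_def]
      have : algebraMap A (ResidueField A) a = 0 := Ideal.Quotient.eq_zero_iff_mem.2 ha
      rw [this, zero_mul]
    rw [this, map_zero]
  refine ⟨⟨CharacterModule.dual q c, 1, fun a ha => hd a (by simpa using ha)⟩, fun h0 => hc ?_,
    fun a ha => Subtype.ext (hd a ha)⟩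
  have := DFunLike.congr_fun (congrArg Subtype.val h0) (1 : A)
  change c (q 1) = 0 at this
  simpa [q] using this

variable {A' : Type u} [CommRing A'] [IsLocalRing A'] [Algebra A A']

theorem ExtendsFromMax.baseChange [IsNoetherianRing A] [Module.Flat A A']
    (hm : (maximalIdeal A).map (algebraMap A A') = maximalIdeal A') {E : Type u} [AddCommGroup E]
    [Module A E] (h : ExtendsFromMax A E) : ExtendsFromMax A' (A' ⊗[A] E) := by
  intro g
  obtain ⟨n, p, hp⟩ := Module.Finite.exists_fin' A (maximalIdeal A)
  obtain ⟨q, r, hr⟩ := Module.Finite.exists_fin' A (LinearMap.ker p)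
  let a (i : Fin n) : maximalIdeal A := p (Pi.single i 1)
  let ρ (j : Fin q) (i : Fin n) : A := (r (Pi.single j 1) : Fin n → A) i
  have hpa (c : Fin n → A) : p c = ∑ i, c i • a i := by
    conv_lhs => rw [pi_eq_sum_univ' c]
    simp [a]
  have hρ (j : Fin q) : ∑ i, ρ j i • a i = 0 := (hpa _).symm.trans (r (Pi.single j 1)).2
  let δ₁ : E →ₗ[A] (Fin n → E) := LinearMap.pi fun i => (a i : A) • LinearMap.id
  let δ₂ : (Fin n → E) →ₗ[A] (Fin q → E) :=
    LinearMap.pi fun j => ∑ i, ρ j i • LinearMap.proj i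
  have hex : Function.Exact δ₁ δ₂ := by
    intro y
    constructor
    · intro hy
      have hy' (j : Fin q) : ∑ i, ρ j i • y i = 0 := by
        simpa [δ₂] using congrFun hy j
      let Y : (Fin n → A) →ₗ[A] E := Fintype.linearCombination A y
      have hY : LinearMap.ker p ≤ LinearMap.ker Y := by
        intro c hc
        obtain ⟨d, hd⟩ := hr ⟨c, hc⟩
        have hz : Y ∘ₗ (LinearMap.ker p).subtype ∘ₗ r = 0 := by
          refine (Pi.basisFun A (Fin q)).ext fun j => ?_
          simpa [Y, Fintype.linearCombination_apply] using hy' j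
        have := LinearMap.congr_fun hz d
        rw [LinearMap.comp_apply, LinearMap.comp_apply, hd] at this
        exact this
      let e := p.quotKerEquivOfSurjective hp
      obtain ⟨x, hx⟩ := h ((LinearMap.ker p).liftQ Y hY ∘ₗ e.symm.toLinearMap)
      refine ⟨x, funext fun i => ?_⟩
      have := hx (a i)
      have he : e.symm (a i) = Submodule.Quotient.mk (Pi.single i 1) := by
        rw [LinearEquiv.symm_apply_eq]
        rfl
      rw [LinearMap.comp_apply, LinearEquiv.coe_coe, he, Submodule.liftQ_apply] at this
      simpa [δ₁, Y, Fintype.linearCombination_apply_single] using this.symm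
    · rintro ⟨x, rfl⟩
      ext j
      have := congrArg (Subtype.val) (hρ j)
      simp only [Submodule.coe_sum, Submodule.coe_smul, smul_eq_mul, Submodule.coe_zero] at this
      simp [δ₁, δ₂, smul_smul, ← Finset.sum_smul, this]
  let a' (i : Fin n) : maximalIdeal A' :=
    ⟨algebraMap A A' (a i), hm ▸ Ideal.mem_map_of_mem _ (a i).2⟩
  let t : A' ⊗[A] (Fin n → E) := ∑ i, (LinearMap.single A (fun _ => E) i).lTensor A' (g (a' i))
  have ht : δ₂.lTensor A' t = 0 := by
    have h1 (i : Fin n) : δ₂ ∘ₗ LinearMap.single A (fun _ => E) i =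
        ∑ j, ρ j i • LinearMap.single A (fun _ => E) j := by
      refine LinearMap.ext fun x => funext fun j => ?_
      simp [δ₂, Pi.single_apply, Finset.sum_apply]
    have h2 : δ₂.lTensor A' t = ∑ j, (LinearMap.single A (fun _ => E) j).lTensor A'
        (∑ i, ρ j i • g (a' i)) := by
      simp only [t, map_sum, ← LinearMap.comp_apply, ← LinearMap.lTensor_comp, h1]
      rw [Finset.sum_comm]
      refine Finset.sum_congr rfl fun i _ => ?_
      have : (∑ j, ρ j i • LinearMap.single A (fun _ => E) j).lTensor A' =
          ∑ j, ρ j i • (LinearMap.single A (fun _ => E) j).lTensor A' := by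
        ext; simp [TensorProduct.tmul_sum]
      rw [this]
      simp
    rw [h2]
    refine Finset.sum_eq_zero fun j _ => ?_
    have : ∑ i, ρ j i • g (a' i) = g (∑ i, ρ j i • a' i) := by
      rw [map_sum]
      refine Finset.sum_congr rfl fun i _ => ?_
      rw [← algebraMap_smul A' (ρ j i) (g (a' i)), ← map_smul, algebraMap_smul]
    rw [this]
    have h3 : ∑ i, ρ j i • a' i = 0 := by
      refine Subtype.ext ?_
      have := congrArg (fun z : maximalIdeal A => algebraMap A A' z) (hρ j)
      simpa [a', Algebra.smul_def] using this
    rw [h3, map_zero, map_zero]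
  obtain ⟨x, hx⟩ := (Module.Flat.lTensor_exact A' hex t).1 ht
  have hgx (i : Fin n) : g (a' i) = (a' i : A') • x := by
    have h1 := congrArg ((LinearMap.proj (R := A) (φ := fun _ => E) i).lTensor A') hx
    have h2 : (LinearMap.proj (R := A) (φ := fun _ => E) i).lTensor A' t = g (a' i) := by
      simp only [t, map_sum]
      rw [Finset.sum_eq_single i]
      · rw [← LinearMap.comp_apply, ← LinearMap.lTensor_comp, LinearMap.proj_comp_single_same,
          LinearMap.lTensor_id, LinearMap.id_apply]
      · intro k _ hk
        rw [← LinearMap.comp_apply, ← LinearMap.lTensor_comp, LinearMap.proj_comp_single_ne _ _ _ _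
          hk.symm, LinearMap.lTensor_zero, LinearMap.zero_apply]
      · simp
    rw [h2, ← LinearMap.comp_apply, ← LinearMap.lTensor_comp] at h1
    rw [← h1]
    have h3 : LinearMap.proj (R := A) (φ := fun _ => E) i ∘ₗ δ₁ = (a i : A) • LinearMap.id := by
      ext x; rfl
    rw [h3, LinearMap.lTensor_smul, LinearMap.lTensor_id, LinearMap.smul_apply,
      LinearMap.id_apply]
    exact (algebraMap_smul A' (a i : A) x).symm
  refine ⟨x, ?_⟩
  have hgen : maximalIdeal A' = Ideal.span (Set.range fun i => (a' i : A')) := by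
    have h1 : maximalIdeal A = Ideal.span (Set.range fun i => (a i : A)) := by
      refine le_antisymm (fun z hz => ?_) (Ideal.span_le.2 ?_)
      · obtain ⟨c, hc⟩ := hp ⟨z, hz⟩
        rw [hpa] at hc
        have hc' := congrArg Subtype.val hc
        simp only [Submodule.coe_sum, Submodule.coe_smul, smul_eq_mul] at hc'
        rw [← hc']
        exact Ideal.sum_mem _ fun i _ => Ideal.mul_mem_left _ _ (Ideal.subset_span ⟨i, rfl⟩)
      · rintro _ ⟨i, rfl⟩
        exact (a i).2
    have h2 := congrArg (Ideal.map (algebraMap A A')) h1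
    rw [Ideal.map_span, ← Set.range_comp] at h2
    exact hm.symm.trans h2
  have key : ∀ z ∈ Submodule.span A' (Set.range fun i => (a' i : A')),
      ∀ hz : z ∈ maximalIdeal A', g ⟨z, hz⟩ = z • x := by
    intro z hz'
    induction hz' using Submodule.span_induction with
    | mem z hz => obtain ⟨i, rfl⟩ := hz; exact fun _ => hgx i
    | zero => exact fun _ => g.map_zero.trans (zero_smul _ _).symm
    | add y z hy hz h1 h2 =>
      intro _
      have hy' : y ∈ maximalIdeal A' := hgen ▸ hy
      have hz' : z ∈ maximalIdeal A' := hgen ▸ hz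
      exact (g.map_add ⟨y, hy'⟩ ⟨z, hz'⟩).trans (by rw [h1, h2, add_smul])
    | smul b z hz h1 =>
      intro _
      have hz' : z ∈ maximalIdeal A' := hgen ▸ hz
      exact (g.map_smul b ⟨z, hz'⟩).trans (by rw [h1, smul_assoc])
  exact fun z => key z (hgen.le z.2) z.2

theorem torsion_baseChange (hm : (maximalIdeal A).map (algebraMap A A') = maximalIdeal A')
    {E : Type u} [AddCommGroup E] [Module A E]
    (h : ∀ x : E, ∃ s, ∀ a ∈ maximalIdeal A ^ s, a • x = 0) (y : A' ⊗[A] E) :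
    ∃ s, ∀ a ∈ maximalIdeal A' ^ s, a • y = 0 := by
  induction y with
  | zero => exact ⟨0, fun a _ => smul_zero a⟩
  | add y z hy hz =>
    obtain ⟨s, hs⟩ := hy
    obtain ⟨t, ht⟩ := hz
    refine ⟨max s t, fun a ha => ?_⟩
    rw [smul_add, hs a (Ideal.pow_le_pow_right (le_max_left _ _) ha),
      ht a (Ideal.pow_le_pow_right (le_max_right _ _) ha), add_zero]
  | tmul b x =>
    obtain ⟨s, hs⟩ := h x
    refine ⟨s, fun a ha => ?_⟩
    rw [← hm, ← Ideal.map_pow] at ha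
    induction ha using Submodule.span_induction with
    | mem z hz =>
      obtain ⟨c, hc, rfl⟩ := hz
      rw [algebraMap_smul, ← TensorProduct.tmul_smul, hs c hc, TensorProduct.tmul_zero]
    | zero => rw [zero_smul]
    | add y z _ _ h1 h2 => rw [add_smul, h1, h2, add_zero]
    | smul c z _ h1 => rw [smul_assoc, h1, smul_zero]

theorem exists_injective_baseChange [IsNoetherianRing A] [IsNoetherianRing A'] [Module.Flat A A']
    (hm : (maximalIdeal A).map (algebraMap A A') = maximalIdeal A') :
    ∃ (E : Type u) (_ : AddCommGroup E) (_ : Module A E), Module.Injective A E ∧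
      Module.Injective A' (A' ⊗[A] E) ∧
      ∃ e : A' ⊗[A] E, e ≠ 0 ∧ ∀ a ∈ maximalIdeal A', a • e = 0 := by
  have hE : ExtendsFromMax A (torsionCharacter A) := extendsFromMax_torsionCharacter
  refine ⟨torsionCharacter A, inferInstance, inferInstance, hE.injective torsionCharacter_torsion,
    (hE.baseChange hm).injective (torsion_baseChange hm torsionCharacter_torsion), ?_⟩
  obtain ⟨e, he, hme⟩ := exists_socle_torsionCharacter (A := A)
  have hloc : IsLocalHom (algebraMap A A') :=
    ((local_hom_TFAE (algebraMap A A')).out 0 2).2 hm.le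
  have : Module.FaithfullyFlat A A' := Module.FaithfullyFlat.of_flat_of_isLocalHom
  refine ⟨1 ⊗ₜ e, fun h0 => he
    (Module.FaithfullyFlat.tensorProduct_mk_injective (A := A) (B := A') _ ?_), fun a ha => ?_⟩
  · rw [map_zero]; exact h0
  · rw [← hm] at ha
    induction ha using Submodule.span_induction with
    | mem z hz =>
      obtain ⟨c, hc, rfl⟩ := hz
      rw [algebraMap_smul, ← TensorProduct.tmul_smul, hme c hc, TensorProduct.tmul_zero]
    | zero => rw [zero_smul]
    | add y z _ _ h1 h2 => rw [add_smul, h1, h2, add_zero]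
    | smul c z _ h1 => rw [smul_assoc, h1, smul_zero]

end TorsionInjective

section CompleteNoetherian

open Polynomial

variable {C : Type u} [CommRing C] (I : Ideal C)

theorem isNoetherianRing_rees_quotient (hI : I.FG) [IsNoetherianRing (C ⧸ I)] :
    IsNoetherianRing (reesAlgebra I ⧸ I.map (algebraMap C (reesAlgebra I))) := by
  have : Algebra.FiniteType C (reesAlgebra I) :=
    (Subalgebra.fg_iff_finiteType _).1 (reesAlgebra.fg hI)
  have : Algebra.FiniteType C (reesAlgebra I ⧸ I.map (algebraMap C (reesAlgebra I))) :=
    inferInstance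
  have : Algebra.FiniteType (C ⧸ I) (reesAlgebra I ⧸ I.map (algebraMap C (reesAlgebra I))) :=
    Algebra.FiniteType.of_restrictScalars_finiteType C _ _
  exact Algebra.FiniteType.isNoetherianRing (C ⧸ I)
    (reesAlgebra I ⧸ I.map (algebraMap C (reesAlgebra I)))

theorem coeff_mem_of_mem_map_rees {z : reesAlgebra I}
    (hz : z ∈ I.map (algebraMap C (reesAlgebra I))) (s : ℕ) :
    (z : C[X]).coeff s ∈ I ^ (s + 1) := by
  induction hz using Submodule.span_induction generalizing s with
  | mem z hz =>
    obtain ⟨a, ha, rfl⟩ := hz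
    have : ((algebraMap C (reesAlgebra I) a : reesAlgebra I) : C[X]) = Polynomial.C a := rfl
    rw [this, coeff_C]
    split_ifs with h
    · subst h; simpa using ha
    · exact zero_mem _
  | zero => simp
  | add y z _ _ h1 h2 => simpa using add_mem (h1 s) (h2 s)
  | smul b z _ h1 =>
    have : ((b • z : reesAlgebra I) : C[X]) = (b : C[X]) * z := rfl
    rw [this, coeff_mul]
    refine Ideal.sum_mem _ fun x hx => ?_
    rw [Finset.HasAntidiagonal.mem_antidiagonal] at hx
    rw [← hx, add_assoc, pow_add]
    exact Ideal.mul_mem_mul (b.2 _) (h1 _)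

theorem exists_leading_generators (hI : I.FG) [IsNoetherianRing (C ⧸ I)] (Q : Ideal C) :
    ∃ (ι : Type u) (_ : Fintype ι) (q : ι → C) (d : ι → ℕ), (∀ i, q i ∈ Q) ∧
      ∀ s, ∀ z ∈ Q, z ∈ I ^ s →
      ∃ r : ι → C, (∀ i, r i ∈ I ^ (s - d i)) ∧ z - ∑ i, r i * q i ∈ I ^ (s + 1) := by
  have := isNoetherianRing_rees_quotient I hI
  let 𝔞 := I.map (algebraMap C (reesAlgebra I))
  let Qs : Ideal (reesAlgebra I) := (Q.map Polynomial.C).comap (reesAlgebra I).val.toRingHom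
  have hQs (p : reesAlgebra I) : p ∈ Qs ↔ ∀ s, (p : C[X]).coeff s ∈ Q := Ideal.mem_map_C_iff
  obtain ⟨T, hT, hspan⟩ := (Submodule.fg_span_iff_fg_span_finset_subset
    (Ideal.Quotient.mk 𝔞 '' Qs)).1 (IsNoetherian.noetherian (Qs.map (Ideal.Quotient.mk 𝔞)))
  have hT' : ∀ x ∈ T, ∃ p ∈ Qs, Ideal.Quotient.mk 𝔞 p = x := fun x hx => hT hx
  choose! g hg using hT'
  let N := T.sup (fun p => ((g p : reesAlgebra I) : C[X]).natDegree + 1)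
  refine ⟨T × Fin N, inferInstance, fun x => ((g x.1 : reesAlgebra I) : C[X]).coeff x.2,
    fun x => x.2, fun x => (hQs _).1 (hg x.1 x.1.2).1 _, fun s z hz hzs => ?_⟩
  let p : reesAlgebra I := ⟨monomial s z, reesAlgebra.monomial_mem.2 hzs⟩
  have hp : p ∈ Qs := (hQs _).2 fun t => by
    rw [coeff_monomial]
    split_ifs
    exacts [hz, zero_mem _]
  have hpT : Ideal.Quotient.mk 𝔞 p ∈ Submodule.span (reesAlgebra I ⧸ 𝔞) (T : Set (reesAlgebra I ⧸ 𝔞)) := by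
    rw [← hspan]
    exact Submodule.subset_span ⟨p, hp, rfl⟩
  obtain ⟨b, hb, hbp⟩ := Submodule.mem_span_finset.1 hpT
  choose c hc using Ideal.Quotient.mk_surjective (I := 𝔞)
  have hmem : p - ∑ x ∈ T, c (b x) * g x ∈ 𝔞 := by
    rw [← Ideal.Quotient.eq_zero_iff_mem, map_sub, ← hbp, map_sum, sub_eq_zero]
    refine Finset.sum_congr rfl fun x hx => ?_
    rw [map_mul, hc, (hg x hx).2, smul_eq_mul]
  have hcoeff := coeff_mem_of_mem_map_rees I hmem s
  refine ⟨fun x => if (x.2 : ℕ) ≤ s then ((c (b x.1) : reesAlgebra I) : C[X]).coeff (s - x.2) else 0,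
    fun x => ?_, ?_⟩
  · dsimp only
    split_ifs
    exacts [(c (b x.1)).2 _, zero_mem _]
  · convert hcoeff using 1
    have h1 : (p : C[X]).coeff s = z := by simp [p]
    have h2 : ((p - ∑ x ∈ T, c (b x) * g x : reesAlgebra I) : C[X]) =
        p - ∑ x ∈ T, (c (b x) : C[X]) * (g x : C[X]) := by
      simp
    rw [h2, coeff_sub, h1, finsetSum_coeff]
    congr 1
    rw [Fintype.sum_prod_type, ← Finset.sum_coe_sort T]
    refine Finset.sum_congr rfl fun x _ => ?_
    rw [mul_comm, coeff_mul, Finset.Nat.sum_antidiagonal_eq_sum_range_succ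
      (fun i j => ((g x : reesAlgebra I) : C[X]).coeff i * ((c (b x) : reesAlgebra I) : C[X]).coeff j)]
    have hN (j : ℕ) (hj : N ≤ j) : ((g x : reesAlgebra I) : C[X]).coeff j = 0 := by
      refine coeff_eq_zero_of_natDegree_lt (lt_of_lt_of_le (Nat.lt_succ_self _) (le_trans ?_ hj))
      exact Finset.le_sup (f := fun p => ((g p : reesAlgebra I) : C[X]).natDegree + 1) x.2
    let F (j : ℕ) : C := (if j ≤ s then ((c (b x) : reesAlgebra I) : C[X]).coeff (s - j) else 0) *
      ((g x : reesAlgebra I) : C[X]).coeff j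
    calc ∑ j : Fin N, F j = ∑ j ∈ Finset.range N, F j := Fin.sum_univ_eq_sum_range F N
      _ = ∑ j ∈ Finset.range (max N (s + 1)), F j := by
        refine Finset.sum_subset (Finset.range_mono (le_max_left _ _)) fun j _ hj => ?_
        simp only [F]
        rw [hN j (by simpa using hj), mul_zero]
      _ = ∑ j ∈ Finset.range (s + 1), F j := by
        refine (Finset.sum_subset (Finset.range_mono (le_max_right _ _)) fun j _ hj => ?_).symm
        have : ¬ j ≤ s := by simp at hj; omega
        simp only [F, if_neg this, zero_mul]
      _ = _ := by
        refine Finset.sum_congr rfl fun j hj => ?_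
        have : j ≤ s := by simp at hj; omega
        simp only [F, if_pos this, mul_comm]

theorem exists_sum_of_isPrecomplete [IsPrecomplete I C] (r : ℕ → C) (d : ℕ)
    (hr : ∀ s, r s ∈ I ^ (s - d)) :
    ∃ L : C, ∀ s, L - ∑ j ∈ Finset.range (s + d), r j ∈ I ^ s := by
  obtain ⟨L, hL⟩ := IsPrecomplete.prec (I := I) (M := C) inferInstance
    (f := fun s => ∑ j ∈ Finset.range (s + d), r j) (fun {m n} hmn => by
      rw [SModEq.sub_mem, smul_eq_mul, Ideal.mul_top, ← neg_sub, neg_mem_iff,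
        ← Finset.sum_range_add_sum_Ico _ (show m + d ≤ n + d by omega), add_sub_cancel_left]
      refine Ideal.sum_mem _ fun j hj => Ideal.pow_le_pow_right ?_ (hr j)
      rw [Finset.mem_Ico] at hj
      omega)
  refine ⟨L, fun s => ?_⟩
  have := hL s
  rwa [SModEq.sub_mem, smul_eq_mul, Ideal.mul_top, ← neg_sub, neg_mem_iff] at this

theorem isNoetherianRing_of_isAdicComplete (hI : I.FG) [IsNoetherianRing (C ⧸ I)]
    [IsAdicComplete I C] : IsNoetherianRing C := by
  refine (isNoetherianRing_iff_ideal_fg C).2 fun Q => ?_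
  obtain ⟨ι, _, q, d, hq, hstep⟩ := exists_leading_generators I hI Q
  choose! r hr hrem using hstep
  refine (Submodule.fg_def (N := Q)).2 ⟨Set.range q, Set.finite_range q, le_antisymm
    (Submodule.span_le.2 (by rintro _ ⟨i, rfl⟩; exact hq i)) fun z hz => ?_⟩
  let step (s : ℕ) (y : C) : C := y - ∑ i, r s y i * q i
  let y (s : ℕ) : C := Nat.rec z (fun s y => step s y) s
  have hy (s : ℕ) : y s ∈ Q ∧ y s ∈ I ^ s := by
    induction s with
    | zero => exact ⟨hz, by simp⟩
    | succ s ih =>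
      exact ⟨Q.sub_mem ih.1 (Ideal.sum_mem _ fun i _ => Q.mul_mem_left _ (hq i)),
        hrem s _ ih.1 ih.2⟩
  have hsum (s : ℕ) : z - ∑ i, (∑ j ∈ Finset.range s, r j (y j) i) * q i = y s := by
    induction s with
    | zero => simp [y]
    | succ s ih =>
      simp only [Finset.sum_range_succ, add_mul, Finset.sum_add_distrib]
      rw [← sub_sub, ih]
  choose L hL using fun i => exists_sum_of_isPrecomplete I (fun s => r s (y s) i) (d i)
    fun s => hr s _ (hy s).1 (hy s).2 i
  have hzL : z = ∑ i, L i * q i := by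
    rw [← sub_eq_zero]
    refine IsHausdorff.haus (I := I) (M := C) inferInstance _ fun s => ?_
    rw [SModEq.zero, smul_eq_mul, Ideal.mul_top]
    let D := Finset.univ.sup d
    have h1 : z - ∑ i, L i * q i = y (s + D) -
        ∑ i, (L i - ∑ j ∈ Finset.range (s + D), r j (y j) i) * q i := by
      rw [← hsum]
      simp only [sub_mul, Finset.sum_sub_distrib]
      ring
    rw [h1]
    refine sub_mem (Ideal.pow_le_pow_right (by omega) (hy _).2)
      (Ideal.sum_mem _ fun i _ => Ideal.mul_mem_right _ _ ?_)
    have hd : d i ≤ D := Finset.le_sup (Finset.mem_univ i)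
    have h2 := hL i (s + D - d i)
    rw [show s + D - d i + d i = s + D by omega] at h2
    exact Ideal.pow_le_pow_right (by omega) h2
  rw [hzL]
  exact Submodule.sum_mem _ fun i _ => Submodule.smul_mem _ _ (Submodule.subset_span ⟨i, rfl⟩)

end CompleteNoetherian

section Triangular

open MvPolynomial

variable {k K : Type u} [Field k] [Field K] [Algebra k K] {ι : Type u} [LinearOrder ι] (x : ι → K)

theorem supported_Iic_le_range (α : ι) :
    supported k (Set.Iic α) ≤
      ((Polynomial.aeval (R := supported k (Set.Iio α)) (X α : MvPolynomial ι k)).restrictScalars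
        k).range := by
  rw [supported_eq_adjoin_X]
  refine Algebra.adjoin_le ?_
  rintro _ ⟨β, hβ, rfl⟩
  rcases lt_or_eq_of_le (show β ≤ α from hβ) with h | rfl
  · exact ⟨Polynomial.C ⟨X β, X_mem_supported.2 h⟩, by
      simp⟩
  · exact ⟨Polynomial.X, by simp⟩

theorem aeval_X_mem_supported_Iic (α : ι) (q : Polynomial (supported k (Set.Iio α))) :
    Polynomial.aeval (X α : MvPolynomial ι k) q ∈ supported k (Set.Iic α) := by
  rw [Polynomial.aeval_eq_sum_range]
  refine sum_mem fun j _ => ?_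
  rw [Algebra.smul_def]
  refine mul_mem (supported_mono (Set.Iio_subset_Iic_self) (q.coeff j).2) (pow_mem ?_ _)
  exact X_mem_supported.2 (Set.mem_Iic.2 le_rfl)

theorem exists_monic_lift_minpoly [Algebra.IsAlgebraic k K] (α : ι) :
    ∃ φ : Polynomial (supported k (Set.Iio α)), φ.Monic ∧
      aeval x (Polynomial.aeval (X α : MvPolynomial ι k) φ) = 0 ∧
      ∀ r : Polynomial (supported k (Set.Iio α)), r.degree < φ.degree →
        aeval x (Polynomial.aeval (X α : MvPolynomial ι k) r) = 0 →
        ∀ j, aeval x (r.coeff j : MvPolynomial ι k) = 0 := by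
  let E : IntermediateField k K := IntermediateField.adjoin k (x '' Set.Iio α)
  have hE : E.toSubalgebra = (supported k (Set.Iio α)).map (aeval x) := by
    rw [IntermediateField.adjoin_toSubalgebra, supported_eq_adjoin_X,
      AlgHom.map_adjoin, ← Set.image_comp]
    congr 2
    ext β
    simp
  have hmem (p : supported k (Set.Iio α)) : aeval x (p : MvPolynomial ι k) ∈ E := by
    change _ ∈ E.toSubalgebra
    rw [hE]
    exact ⟨p, p.2, rfl⟩
  let ψ : supported k (Set.Iio α) →+* E :=
    ((aeval x).comp (supported k (Set.Iio α)).val).toRingHom.codRestrict E hmem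
  have hψ : Function.Surjective ψ := fun e => by
    have : (e : K) ∈ E.toSubalgebra := e.2
    rw [hE] at this
    obtain ⟨p, hp, hpe⟩ := this
    exact ⟨⟨p, hp⟩, Subtype.ext hpe⟩
  have hev (q : Polynomial (supported k (Set.Iio α))) :
      aeval x (Polynomial.aeval (X α : MvPolynomial ι k) q) =
        Polynomial.aeval (x α) (q.map ψ) := by
    rw [Polynomial.aeval_def, Polynomial.aeval_def, Polynomial.eval₂_map]
    rw [← AlgHom.coe_toRingHom, Polynomial.hom_eval₂]
    simp only [AlgHom.coe_toRingHom, aeval_X]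
    rfl
  have hαint : IsIntegral E (x α) := Algebra.IsIntegral.isIntegral (R := E) (x α)
  obtain ⟨φ, hφ, hdeg, hmon⟩ := Polynomial.lifts_and_natDegree_eq_and_monic
    (f := ψ) (p := minpoly E (x α))
    ((Polynomial.mem_lifts _).2 (Polynomial.map_surjective ψ hψ _)) (minpoly.monic hαint)
  refine ⟨φ, hmon, ?_, fun r hr h0 j => ?_⟩
  · rw [hev, hφ, minpoly.aeval]
  · rw [hev] at h0
    have hz : r.map ψ = 0 := by
      by_contra hne
      have h1 := minpoly.degree_le_of_ne_zero E (x α) hne h0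
      have h2 : φ.degree = (minpoly E (x α)).degree := by
        rw [Polynomial.degree_eq_natDegree hmon.ne_zero,
          Polynomial.degree_eq_natDegree (minpoly.ne_zero hαint), hdeg]
      rw [← h2] at h1
      exact absurd (lt_of_le_of_lt (h1.trans Polynomial.degree_map_le) hr) (lt_irrefl _)
    have := congrArg (fun p => ((p.coeff j : E) : K)) hz
    simp only [Polynomial.coeff_map, Polynomial.coeff_zero] at this
    exact this

theorem exists_mem_supported_Iic (p : MvPolynomial ι k) (h : aeval x p = 0) :
    p = 0 ∨ ∃ β ∈ p.vars, p ∈ supported k (Set.Iic β) := by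
  rcases p.vars.eq_empty_or_nonempty with h0 | h0
  · left
    rw [vars_eq_empty_iff_eq_C] at h0
    rw [h0] at h ⊢
    simpa using h
  · exact Or.inr ⟨p.vars.max' h0, Finset.max'_mem _ _, mem_supported.2 fun b hb =>
      Finset.le_max' _ _ hb⟩

theorem mem_span_of_aeval_eq_zero [WellFoundedLT ι] {φ : ∀ α, Polynomial (supported k (Set.Iio α))}
    (hmon : ∀ α, (φ α).Monic)
    (hzero : ∀ α, aeval x (Polynomial.aeval (X α : MvPolynomial ι k) (φ α)) = 0)
    (hmin : ∀ α, ∀ r : Polynomial (supported k (Set.Iio α)), r.degree < (φ α).degree →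
        aeval x (Polynomial.aeval (X α : MvPolynomial ι k) r) = 0 →
        ∀ j, aeval x (r.coeff j : MvPolynomial ι k) = 0)
    (p : MvPolynomial ι k) (hp : aeval x p = 0) :
    p ∈ Ideal.span (Set.range fun α => Polynomial.aeval (X α : MvPolynomial ι k) (φ α)) := by
  have key (α : ι) : ∀ p ∈ supported k (Set.Iic α), aeval x p = 0 →
      p ∈ Ideal.span (Set.range fun α => Polynomial.aeval (X α : MvPolynomial ι k) (φ α)) := by
    induction α using WellFoundedLT.induction with
    | ind α ih =>
      intro p hp hp0
      obtain ⟨q, rfl⟩ := supported_Iic_le_range α hp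
      change aeval x (Polynomial.aeval (X α : MvPolynomial ι k) q) = 0 at hp0
      change Polynomial.aeval (X α : MvPolynomial ι k) q ∈ _
      have hdiv := Polynomial.modByMonic_add_div q (φ α)
      have hr0 : aeval x (Polynomial.aeval (X α : MvPolynomial ι k) (q %ₘ φ α)) = 0 := by
        rw [← hdiv] at hp0
        simpa [hzero α] using hp0
      rw [← hdiv, map_add, map_mul]
      refine add_mem ?_ (Ideal.mul_mem_right _ _ (Ideal.subset_span ⟨α, rfl⟩))
      rw [Polynomial.aeval_eq_sum_range]
      refine sum_mem fun j _ => ?_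
      rw [Algebra.smul_def]
      refine Ideal.mul_mem_right _ _ ?_
      have hc := hmin α _ (Polynomial.degree_modByMonic_lt q (hmon α)) hr0 j
      rcases exists_mem_supported_Iic x _ hc with h | ⟨β, hβ, hβs⟩
      · change ((q %ₘ φ α).coeff j : MvPolynomial ι k) ∈ _
        rw [h]
        exact zero_mem _
      · exact ih β (mem_supported.1 ((q %ₘ φ α).coeff j).2 hβ) _ hβs hc
  rcases exists_mem_supported_Iic x p hp with rfl | ⟨β, -, hβs⟩
  · exact zero_mem _
  · exact key β p hβs hp

end Triangular

section Triangular

open MvPolynomial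

variable {k : Type u} [Field k] {ι : Type u} [LinearOrder ι]

/-- Regard the variable `X α` as a polynomial variable over all the other ones. -/
noncomputable def isolateVar (α : ι) :
    MvPolynomial ι k →ₐ[k] Polynomial (MvPolynomial ι k) :=
  aeval fun b => if b = α then Polynomial.X else Polynomial.C (X b)

theorem isolateVar_of_mem_supported {α : ι} {p : MvPolynomial ι k}
    (hp : p ∈ supported k (Set.Iio α)) : isolateVar α p = Polynomial.C p := by
  have : supported k (Set.Iio α) ≤
      AlgHom.equalizer (isolateVar α) (Polynomial.CAlgHom (A := MvPolynomial ι k)) := by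
    rw [supported_eq_adjoin_X]
    refine Algebra.adjoin_le ?_
    rintro _ ⟨β, hβ, rfl⟩
    rw [SetLike.mem_coe, AlgHom.mem_equalizer]
    simp [isolateVar, ne_of_lt (show β < α from hβ)]
  exact this hp

theorem isolateVar_aeval (α : ι) (q : Polynomial (supported k (Set.Iio α))) :
    isolateVar α (Polynomial.aeval (X α : MvPolynomial ι k) q) =
      q.map (algebraMap (supported k (Set.Iio α)) (MvPolynomial ι k)) := by
  induction q using Polynomial.induction_on' with
  | add p q hp hq => simp only [map_add, hp, hq, Polynomial.map_add]
  | monomial n c =>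
    rw [Polynomial.aeval_monomial, map_mul, map_pow, Polynomial.map_monomial,
      ← Polynomial.C_mul_X_pow_eq_monomial]
    congr 1
    · exact isolateVar_of_mem_supported c.2
    · simp [isolateVar]

theorem aeval_isolateVar (α : ι) (g : MvPolynomial ι k) :
    Polynomial.aeval (X α : MvPolynomial ι k) (isolateVar α g) = g := by
  have : ((Polynomial.aeval (X α : MvPolynomial ι k)).restrictScalars k).comp (isolateVar α) =
      AlgHom.id k _ := by
    ext b
    by_cases h : b = α <;> simp [isolateVar, h]
  exact DFunLike.congr_fun this g

theorem mem_of_mul_mem_of_monic {A : Type u} [CommRing A] (I : Ideal A) {p q : Polynomial A}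
    (hq : q.Monic) (h : p * q ∈ I.map (Polynomial.C : A →+* _)) (j : ℕ) : p.coeff j ∈ I := by
  have hker (p : Polynomial A) :
      p ∈ I.map (Polynomial.C : A →+* _) ↔ p.map (Ideal.Quotient.mk I) = 0 := by
    simp only [Ideal.mem_map_C_iff, Polynomial.ext_iff, Polynomial.coeff_map,
      Polynomial.coeff_zero, Ideal.Quotient.eq_zero_iff_mem]
  rw [hker, Polynomial.map_mul] at h
  exact Ideal.mem_map_C_iff.1 ((hker p).2 ((hq.map _).mul_left_eq_zero_iff.1 h)) j

theorem mem_span_of_mul_mem_span {φ : ∀ α, Polynomial (supported k (Set.Iio α))}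
    (hmon : ∀ α, (φ α).Monic) (α : ι) (s : Set ι) (hs : s ⊆ Set.Iio α) (g : MvPolynomial ι k)
    (hg : g * Polynomial.aeval (X α : MvPolynomial ι k) (φ α) ∈
      Ideal.span ((fun α => Polynomial.aeval (X α : MvPolynomial ι k) (φ α)) '' s)) :
    g ∈ Ideal.span ((fun α => Polynomial.aeval (X α : MvPolynomial ι k) (φ α)) '' s) := by
  have hIC : (Ideal.span ((fun α => Polynomial.aeval (X α : MvPolynomial ι k) (φ α)) '' s)).map
      (isolateVar α).toRingHom ≤
      (Ideal.span ((fun α => Polynomial.aeval (X α : MvPolynomial ι k) (φ α)) '' s)).map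
        (Polynomial.C : MvPolynomial ι k →+* _) := by
    rw [Ideal.map_span, Ideal.span_le]
    rintro _ ⟨_, ⟨β, hβ, rfl⟩, rfl⟩
    have := isolateVar_of_mem_supported (supported_mono
      (fun b hb => lt_of_le_of_lt hb (hs hβ)) (aeval_X_mem_supported_Iic β (φ β)))
    refine (congrArg (· ∈ _) this).mpr ?_
    exact Ideal.mem_map_of_mem _ (Ideal.subset_span ⟨β, hβ, rfl⟩)
  have h1 := hIC (Ideal.mem_map_of_mem (isolateVar α).toRingHom hg)
  rw [map_mul] at h1
  have h2 : ((isolateVar α).toRingHom (Polynomial.aeval (X α : MvPolynomial ι k) (φ α))).Monic := by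
    refine (congrArg Polynomial.Monic (isolateVar_aeval α (φ α))).mpr ((hmon α).map _)
  have h3 := mem_of_mul_mem_of_monic _ h2 h1
  rw [← aeval_isolateVar α g, Polynomial.aeval_eq_sum_range]
  refine sum_mem fun j _ => ?_
  rw [smul_eq_mul]
  exact Ideal.mul_mem_right _ _ (h3 j)

/-- The kernel of a map from a polynomial ring to an algebraic field extension is generated by a
family, each member of which is a nonzerodivisor modulo the smaller ones. -/
theorem exists_triangular_generators [WellFoundedLT ι] {K : Type u} [Field K] [Algebra k K]
    [Algebra.IsAlgebraic k K] (x : ι → K) :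
    ∃ f : ι → MvPolynomial ι k, RingHom.ker (aeval x : MvPolynomial ι k →ₐ[k] K) =
      Ideal.span (Set.range f) ∧ ∀ α (s : Set ι), s ⊆ Set.Iio α → ∀ g,
        g * f α ∈ Ideal.span (f '' s) → g ∈ Ideal.span (f '' s) := by
  choose φ hmon hzero hmin using exists_monic_lift_minpoly (k := k) x
  refine ⟨fun α => Polynomial.aeval (X α : MvPolynomial ι k) (φ α), le_antisymm
    (fun p hp => mem_span_of_aeval_eq_zero x hmon hzero hmin p hp) ?_,
    fun α s hs g hg => mem_span_of_mul_mem_span hmon α s hs g hg⟩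
  rw [Ideal.span_le]
  rintro _ ⟨α, rfl⟩
  exact hzero α

theorem inf_ker_le_of_triangular {P P₀ : Type u} [CommRing P] [CommRing P₀] (π : P →+* P₀)
    (hπ : Function.Surjective π) (F : ι → P)
    (hF : ∀ α (s : Set ι), s ⊆ Set.Iio α → ∀ g, g * π (F α) ∈ Ideal.span ((π ∘ F) '' s) →
      g ∈ Ideal.span ((π ∘ F) '' s)) :
    Ideal.span (Set.range F) ⊓ RingHom.ker π ≤ RingHom.ker π * Ideal.span (Set.range F) := by
  classical
  have key (s : Finset ι) : ∀ z ∈ Ideal.span (F '' s), π z = 0 →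
      z ∈ RingHom.ker π * Ideal.span (Set.range F) := by
    induction s using Finset.induction_on_max with
    | empty =>
      intro z hz _
      have : z = 0 := by simpa using hz
      rw [this]
      exact zero_mem _
    | insert α s hs ih =>
      intro z hz hz0
      rw [Finset.coe_insert, Set.image_insert_eq, Ideal.mem_span_insert] at hz
      obtain ⟨g, w, hw, rfl⟩ := hz
      have hmap : (Ideal.span (F '' s)).map π = Ideal.span ((π ∘ F) '' s) := by
        rw [Ideal.map_span, Set.image_comp]
      have hw' : π w ∈ Ideal.span ((π ∘ F) '' s) := hmap ▸ Ideal.mem_map_of_mem π hw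
      have hg : π g ∈ Ideal.span ((π ∘ F) '' s) := by
        refine hF α s (fun b hb => hs b hb) _ ?_
        rw [map_add, map_mul] at hz0
        rw [eq_neg_of_add_eq_zero_left hz0]
        exact neg_mem hw'
      rw [← hmap, Ideal.mem_map_iff_of_surjective π hπ] at hg
      obtain ⟨c, hc, hcg⟩ := hg
      have hgc : π (g - c) = 0 := by rw [map_sub, hcg, sub_self]
      have hsplit : g * F α + w = (g - c) * F α + (c * F α + w) := by ring
      have h1 : (g - c) * F α ∈ RingHom.ker π * Ideal.span (Set.range F) :=
        Ideal.mul_mem_mul hgc (Ideal.subset_span ⟨α, rfl⟩)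
      rw [hsplit]
      refine add_mem h1 (ih _ (add_mem (Ideal.mul_mem_right _ _ hc) hw) ?_)
      rw [hsplit, map_add, map_mul, hgc, zero_mul, zero_add] at hz0
      exact hz0
  rintro z ⟨hz, hz0⟩
  obtain ⟨t, ht, hzt⟩ := Submodule.mem_span_finite_of_mem_span hz
  rw [← Set.image_univ, Finset.subset_set_image_iff] at ht
  obtain ⟨s, -, rfl⟩ := ht
  exact key s z (by simpa using hzt) hz0

end Triangular

section FlatLimit

open TensorProduct CategoryTheory Abelian

theorem ExtZero.co_second {R X Y Z W : Type u} [CommRing R] [AddCommGroup X] [Module R X]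
    [AddCommGroup Y] [Module R Y] [AddCommGroup Z] [Module R Z] [AddCommGroup W] [Module R W]
    {f : X →ₗ[R] Y} {g : Y →ₗ[R] Z} (h : Function.Exact f g) (hf : Function.Injective f)
    (hg : Function.Surjective g) {i : ℕ} (h₁ : ExtZero R W X i) (h₃ : ExtZero R W Z i) :
    ExtZero R W Y i := by
  have hS := linearShortComplex_shortExact f g h hf hg
  refine subsingleton_of_forall_eq_zero fun x => ?_
  obtain ⟨y, rfl⟩ := Ext.covariant_sequence_exact₂ _ hS x (@Subsingleton.elim _ h₃ _ _)
  rw [@Subsingleton.elim _ h₁ y 0, Ext.zero_comp]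

theorem TorZero.right_second {R X Y Z W : Type u} [CommRing R] [AddCommGroup X] [Module R X]
    [AddCommGroup Y] [Module R Y] [AddCommGroup Z] [Module R Z] [AddCommGroup W] [Module R W]
    {f : X →ₗ[R] Y} {g : Y →ₗ[R] Z} (h : Function.Exact f g) (hf : Function.Injective f)
    (hg : Function.Surjective g) {i : ℕ} (h₁ : TorZero R W X i) (h₃ : TorZero R W Z i) :
    TorZero R W Y i :=
  ExtZero.co_second (dual_exact h hg) (CharacterModule.dual_injective_of_surjective g hg)
    (CharacterModule.dual_surjective_of_injective f hf) h₃ h₁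

variable {A : Type u} [CommRing A] [IsLocalRing A]

theorem TorZero.of_pow [IsNoetherianRing A] {D : Type u} [AddCommGroup D] [Module A D]
    (h : TorZero A D (A ⧸ maximalIdeal A) 1) (t : ℕ) (X : Type u) [AddCommGroup X] [Module A X]
    [hX : Module.Finite A X] (ht : maximalIdeal A ^ t ≤ Module.annihilator A X) :
    TorZero A D X 1 := by
  revert ht
  induction hX using IsNoetherianRing.induction_on_isQuotientEquivQuotientPrime A with
  | subsingleton X =>
    intro _
    exact TorZero.of_flat_right 0
  | quotient X p e =>
    intro ht
    have hp : p.1 = maximalIdeal A := by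
      refine le_antisymm (le_maximalIdeal p.2.ne_top) (p.2.le_of_pow_le (n := t) (ht.trans ?_))
      rw [e.annihilator_eq, Ideal.annihilator_quotient]
    have h1 := h
    rw [← hp] at h1
    exact TorZero.right_second (f := (0 : PUnit.{u + 1} →ₗ[A] X)) (g := e.toLinearMap)
      (fun x => by simpa using eq_comm) (fun _ _ _ => rfl) e.surjective (TorZero.of_flat_right 0) h1
  | exact X Y Z f g hf hg hex h₁ h₃ =>
    intro ht
    exact TorZero.right_second hex hf hg (h₁ (ht.trans (f.annihilator_le_of_injective hf)))
      (h₃ (ht.trans (g.annihilator_le_of_surjective hg)))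

theorem lTensor_injective_of_pow [IsNoetherianRing A] {D : Type u} [AddCommGroup D] [Module A D]
    (h : TorZero A D (A ⧸ maximalIdeal A) 1) (t : ℕ) {X Y : Type u} [AddCommGroup X] [Module A X]
    [AddCommGroup Y] [Module A Y] [Module.Finite A Y]
    (ht : maximalIdeal A ^ t ≤ Module.annihilator A Y) (f : X →ₗ[A] Y)
    (hf : Function.Injective f) : Function.Injective (f.lTensor D) := by
  have hg := Submodule.mkQ_surjective (LinearMap.range f)
  rw [lTensor_injective_iff_forall_exists_dual]
  exact (ExtZero.co_one_iff (dual_exact (LinearMap.exact_map_mkQ_range f) hg)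
    (CharacterModule.dual_injective_of_surjective _ hg)
    (CharacterModule.dual_surjective_of_injective f hf) (h.of_pow t Y ht)).1
    (h.of_pow t _ (ht.trans (LinearMap.annihilator_le_of_surjective _ hg)))

theorem tensor_eq_zero_of_mem_smul {A D X : Type u} [CommRing A] [AddCommGroup D] [Module A D]
    [AddCommGroup X] [Module A X] {𝔞 : Ideal A} (ht : 𝔞 ≤ Module.annihilator A X) {d : D}
    (hd : d ∈ 𝔞 • (⊤ : Submodule A D)) (x : X) : d ⊗ₜ[A] x = 0 := by
  refine Submodule.smul_induction_on hd (fun a ha d _ => ?_) fun y z hy hz => ?_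
  · rw [smul_tmul, Module.mem_annihilator.1 (ht ha), tmul_zero]
  · rw [add_tmul, hy, hz, add_zero]

variable {D B' : Type u} [AddCommGroup D] [Module A D] [AddCommGroup B'] [Module A B']
  (u : D →ₗ[A] B')

theorem rTensor_surjective_of_pow {t : ℕ}
    (hu : ∀ b : B', ∃ d, b - u d ∈ maximalIdeal A ^ t • (⊤ : Submodule A B'))
    {X : Type u} [AddCommGroup X] [Module A X] (ht : maximalIdeal A ^ t ≤ Module.annihilator A X) :
    Function.Surjective (u.rTensor X) := by
  intro z
  induction z using TensorProduct.induction_on with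
  | zero => exact ⟨0, map_zero _⟩
  | tmul b x =>
    obtain ⟨d, hd⟩ := hu b
    refine ⟨d ⊗ₜ x, ?_⟩
    rw [LinearMap.rTensor_tmul, eq_comm, ← sub_eq_zero, ← sub_tmul]
    exact tensor_eq_zero_of_mem_smul ht hd x
  | add y z hy hz =>
    obtain ⟨y, rfl⟩ := hy
    obtain ⟨z, rfl⟩ := hz
    exact ⟨y + z, map_add _ _ _⟩

theorem rTensor_injective_of_pow {t : ℕ}
    (v : B' →ₗ[A] D ⧸ (maximalIdeal A ^ t • (⊤ : Submodule A D)))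
    (hv : ∀ d, v (u d) = Submodule.Quotient.mk d)
    {X : Type u} [AddCommGroup X] [Module A X] (ht : maximalIdeal A ^ t ≤ Module.annihilator A X) :
    Function.Injective (u.rTensor X) := by
  rw [← LinearMap.ker_eq_bot, eq_bot_iff]
  intro z hz
  let N := maximalIdeal A ^ t • (⊤ : Submodule A D)
  have h1 : N.mkQ.rTensor X z = 0 := by
    have : N.mkQ = v ∘ₗ u := LinearMap.ext fun d => (hv d).symm
    rw [this, LinearMap.rTensor_comp, LinearMap.comp_apply, LinearMap.mem_ker.1 hz, map_zero]
  obtain ⟨w, rfl⟩ := (rTensor_exact X (LinearMap.exact_subtype_mkQ N)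
    (Submodule.mkQ_surjective _) z).1 h1
  clear hz h1
  induction w using TensorProduct.induction_on with
  | zero => simp
  | tmul d x => simp [tensor_eq_zero_of_mem_smul ht d.2 x]
  | add y z hy hz => rw [map_add]; exact add_mem hy hz

theorem lTensor_injective_of_complete [IsNoetherianRing A]
    (h : TorZero A D (A ⧸ maximalIdeal A) 1) {t : ℕ}
    (hu : ∀ b : B', ∃ d, b - u d ∈ maximalIdeal A ^ t • (⊤ : Submodule A B'))
    (v : B' →ₗ[A] D ⧸ (maximalIdeal A ^ t • (⊤ : Submodule A D)))
    (hv : ∀ d, v (u d) = Submodule.Quotient.mk d)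
    {X Y : Type u} [AddCommGroup X] [Module A X]
    [AddCommGroup Y] [Module A Y] [Module.Finite A Y]
    (ht : maximalIdeal A ^ t ≤ Module.annihilator A Y) (f : X →ₗ[A] Y)
    (hf : Function.Injective f) : Function.Injective (f.lTensor B') := by
  rw [← LinearMap.ker_eq_bot, eq_bot_iff]
  intro z hz
  obtain ⟨d, rfl⟩ := rTensor_surjective_of_pow u hu
    (ht.trans (f.annihilator_le_of_injective hf)) z
  have h1 : u.rTensor Y (f.lTensor D d) = 0 := by
    rw [← LinearMap.comp_apply, LinearMap.rTensor_comp_lTensor, ← LinearMap.lTensor_comp_rTensor]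
    exact hz
  have h2 : f.lTensor D d = 0 := rTensor_injective_of_pow u v hv ht (by rw [h1, map_zero])
  have h3 : d = 0 := lTensor_injective_of_pow h t ht f hf (by rw [h2, map_zero])
  simp [h3]

/-- A separated completion of a module without `Tor` against the residue field is flat. -/
theorem flat_of_complete [IsNoetherianRing A] {D C : Type u} [AddCommGroup D] [Module A D] [CommRing C] [Algebra A C]
    [IsLocalRing C] [IsNoetherianRing C] (u : D →ₗ[A] C)
    (h : TorZero A D (A ⧸ maximalIdeal A) 1)
    (hm : (maximalIdeal A).map (algebraMap A C) ≤ maximalIdeal C)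
    (hu : ∀ t, ∀ b : C, ∃ d, b - u d ∈ maximalIdeal A ^ t • (⊤ : Submodule A C))
    (v : ∀ t, C →ₗ[A] D ⧸ (maximalIdeal A ^ t • (⊤ : Submodule A D)))
    (hv : ∀ t d, v t (u d) = Submodule.Quotient.mk d) : Module.Flat A C := by
  rw [Module.Flat.iff_lTensor_injective']
  intro I
  rw [← LinearMap.ker_eq_bot, eq_bot_iff]
  intro z hz
  rw [Submodule.mem_bot]
  have hK := Ideal.iInf_pow_smul_eq_bot_of_isLocalRing (M := C ⊗[A] I) (maximalIdeal C)
    (Ideal.IsPrime.ne_top inferInstance)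
  rw [← Submodule.mem_bot C, ← hK, Submodule.mem_iInf]
  intro s
  obtain ⟨k, hk⟩ := (maximalIdeal A).exists_pow_inf_eq_pow_smul (M := A) I
  let t := s + k
  let ρ : I →ₗ[A] A ⧸ maximalIdeal A ^ t := (maximalIdeal A ^ t).mkQ ∘ₗ I.subtype
  have hρ : LinearMap.ker ρ ≤ maximalIdeal A ^ s • (⊤ : Submodule A I) := by
    intro y hy
    have hy1 : (y : A) ∈ maximalIdeal A ^ t := (Submodule.Quotient.mk_eq_zero _).1 hy
    have hy2 : (y : A) ∈ maximalIdeal A ^ s • I := by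
      have : (y : A) ∈ maximalIdeal A ^ t • (⊤ : Ideal A) ⊓ I := ⟨by simpa using hy1, y.2⟩
      rw [hk t (by omega), show t - k = s by omega] at this
      exact Submodule.smul_mono le_rfl inf_le_right this
    rwa [Submodule.mem_smul_top_iff]
  let f : (I ⧸ LinearMap.ker ρ) →ₗ[A] A ⧸ maximalIdeal A ^ t := (LinearMap.ker ρ).liftQ ρ le_rfl
  have hf : Function.Injective f := LinearMap.ker_eq_bot.1 (Submodule.ker_liftQ_eq_bot' _ _ rfl)
  have hinj := lTensor_injective_of_complete u h (hu t) (v t) (hv t)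
    (by rw [Ideal.annihilator_quotient]) f hf
  have hz' : (LinearMap.ker ρ).mkQ.lTensor C z = 0 := by
    refine hinj ?_
    rw [map_zero, ← LinearMap.comp_apply, ← LinearMap.lTensor_comp,
      show f ∘ₗ (LinearMap.ker ρ).mkQ = (maximalIdeal A ^ t).mkQ ∘ₗ I.subtype from
        LinearMap.ext fun _ => rfl, LinearMap.lTensor_comp, LinearMap.comp_apply,
      LinearMap.mem_ker.1 hz, map_zero]
  obtain ⟨w, rfl⟩ := (lTensor_exact C (LinearMap.exact_subtype_mkQ (LinearMap.ker ρ))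
    (Submodule.mkQ_surjective _) z).1 hz'
  clear hz hz'
  induction w using TensorProduct.induction_on with
  | zero => rw [map_zero]; exact zero_mem _
  | add y z hy hz => rw [map_add]; exact add_mem hy hz
  | tmul c y =>
    rw [LinearMap.lTensor_tmul]
    have hy := hρ y.2
    change c ⊗ₜ[A] (y : I) ∈ _
    refine Submodule.smul_induction_on hy (fun a ha y _ => ?_) fun y z hy hz => ?_
    · rw [tmul_smul, ← algebraMap_smul C a]
      refine Submodule.smul_mem_smul ?_ trivial
      refine Ideal.pow_right_mono hm s ?_
      rw [← Ideal.map_pow]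
      exact Ideal.mem_map_of_mem _ ha
    · rw [tmul_add]; exact add_mem hy hz

end FlatLimit

section CompleteCover

open TensorProduct

theorem exists_algHom_of_adicCompletion {B D A : Type u} [CommRing B] [CommRing D] [CommRing A]
    [Algebra B D] [Algebra B A] (I : Ideal D) (n : Ideal A) [IsAdicComplete n A] (ψ : D →ₐ[B] A)
    (hI : I ≤ n.comap ψ) :
    ∃ h : AdicCompletion I D →ₐ[B] A, ∀ d, h (algebraMap D _ d) = ψ d := by
  have hpow (t : ℕ) : I ^ t ≤ (n ^ t).comap (ψ : D →+* A) :=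
    (Ideal.pow_right_mono hI t).trans (Ideal.le_comap_pow _ t)
  let f (t : ℕ) : AdicCompletion I D →+* A ⧸ n ^ t :=
    (Ideal.quotientMap (n ^ t) (ψ : D →+* A) (hpow t)).comp (AdicCompletion.evalₐ I t).toRingHom
  have hf : ∀ {s t : ℕ} (hle : s ≤ t), (Ideal.Quotient.factorPow n hle).comp (f t) = f s := by
    intro s t hle
    ext x
    obtain ⟨x, rfl⟩ := AdicCompletion.mk_surjective I D x
    simp only [f, RingHom.comp_apply, AlgHom.toRingHom_eq_coe, RingHom.coe_coe,
      AdicCompletion.evalₐ_mk, Ideal.quotientMap_mk]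
    have e := AdicCompletion.Ideal.mk_eq_mk I hle x
    rw [Ideal.Quotient.eq] at e
    refine Ideal.Quotient.eq.2 ?_
    have := hpow s e
    rwa [Ideal.mem_comap, map_sub] at this
  have hof (d : D) : IsAdicComplete.liftRingHom n f hf (algebraMap D _ d) = ψ d := by
    rw [← sub_eq_zero]
    refine IsHausdorff.haus (I := n) (M := A) inferInstance _ fun t => ?_
    rw [SModEq.zero, smul_eq_mul, Ideal.mul_top, ← Ideal.Quotient.eq_zero_iff_mem, map_sub,
      IsAdicComplete.mk_liftRingHom, sub_eq_zero]
    simp only [f, RingHom.comp_apply, AlgHom.toRingHom_eq_coe, RingHom.coe_coe, AlgHom.commutes]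
    rfl
  refine ⟨{ IsAdicComplete.liftRingHom n f hf with commutes' := fun b => ?_ }, hof⟩
  have : algebraMap B (AdicCompletion I D) b = algebraMap D _ (algebraMap B D b) := rfl
  exact (congrArg (IsAdicComplete.liftRingHom n f hf) this).trans ((hof _).trans (ψ.commutes b))

/-- A flat complete local cover obtained by completing a cover without `Tor`. -/
theorem exists_flat_complete_cover {B D A : Type u} [CommRing B] [IsLocalRing B]
    [IsNoetherianRing B] [CommRing D] [Algebra B D] (hT : TorZero B D (B ⧸ maximalIdeal B) 1)
    (hmax : ((maximalIdeal B).map (algebraMap B D)).IsMaximal) [CommRing A] [Algebra B A]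
    (n : Ideal A) [IsAdicComplete n A] (hn : (maximalIdeal B).map (algebraMap B A) ≤ n)
    (ψ : D →ₐ[B] A) (hψ : Function.Surjective ψ) :
    ∃ (C : Type u) (_ : CommRing C) (_ : IsLocalRing C) (_ : Algebra B C),
      IsNoetherianRing C ∧ IsAdicComplete (maximalIdeal C) C ∧ Module.Flat B C ∧
      (maximalIdeal B).map (algebraMap B C) = maximalIdeal C ∧
      ∃ h : C →ₐ[B] A, Function.Surjective h := by
  let I := (maximalIdeal B).map (algebraMap B D)
  have fg : I.FG := (maximalIdeal B).fg_of_isNoetherianRing.map _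
  let C := AdicCompletion I D
  have tower : IsScalarTower B D C := IsScalarTower.of_algebraMap_eq fun _ => rfl
  have hCmax : (I.map (algebraMap D C)).IsMaximal := AdicCompletion.isMaximal_map_of_le I I le_rfl fg
  have hcomp : IsAdicComplete (I.map (algebraMap D C)) C := AdicCompletion.isAdicComplete_self I fg
  have hloc : IsLocalRing C := isLocalRing_of_isAdicComplete_maximal (I.map (algebraMap D C))
  have hCm : I.map (algebraMap D C) = maximalIdeal C := IsLocalRing.eq_maximalIdeal hCmax
  have hBC : (maximalIdeal B).map (algebraMap B C) = maximalIdeal C := by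
    rw [← hCm, IsScalarTower.algebraMap_eq B D C, ← Ideal.map_map]
  have hnoeth : IsNoetherianRing C := by
    let _ : Field (C ⧸ I.map (algebraMap D C)) := Ideal.Quotient.field _
    exact isNoetherianRing_of_isAdicComplete (I.map (algebraMap D C)) (fg.map _)
  let u : D →ₗ[B] C := (IsScalarTower.toAlgHom B D C).toLinearMap
  have hpow (t : ℕ) : maximalIdeal B ^ t • (⊤ : Submodule B D) = (I ^ t).restrictScalars B := by
    rw [Ideal.smul_top_eq_map, Ideal.map_pow]
  have hpow' (t : ℕ) (c : C) : c ∈ maximalIdeal B ^ t • (⊤ : Submodule B C) ↔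
      c ∈ I ^ t • (⊤ : Submodule D C) := by
    rw [Ideal.smul_top_eq_map, Ideal.smul_top_eq_map, Ideal.map_pow, Ideal.map_pow,
      IsScalarTower.algebraMap_eq B D C, ← Ideal.map_map]
    rfl
  let v (t : ℕ) : C →ₗ[B] D ⧸ (maximalIdeal B ^ t • (⊤ : Submodule B D)) :=
    (Submodule.quotEquivOfEq _ _ (hpow t)).symm.toLinearMap ∘ₗ
      (Submodule.Quotient.restrictScalarsEquiv B (I ^ t)).symm.toLinearMap ∘ₗ
        ((AdicCompletion.evalₐ I t).toLinearMap.restrictScalars B)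
  have hflat : Module.Flat B C := by
    refine flat_of_complete u hT hBC.le (fun t c => ?_) v fun t d => ?_
    · obtain ⟨d, hd⟩ := Submodule.mkQ_surjective _ (AdicCompletion.eval I D t c)
      refine ⟨d, (hpow' t _).2 ?_⟩
      rw [AdicCompletion.pow_smul_top_eq_ker_eval fg, LinearMap.mem_ker, map_sub,
        ← hd, sub_eq_zero]
      rfl
    · simp only [v, LinearMap.comp_apply, LinearEquiv.coe_coe]
      rw [LinearEquiv.symm_apply_eq, LinearEquiv.symm_apply_eq]
      exact AdicCompletion.evalₐ_of I t d
  obtain ⟨h, hh⟩ := exists_algHom_of_adicCompletion I n ψ (by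
    refine Ideal.map_le_iff_le_comap.2 fun b hb => ?_
    rw [Ideal.mem_comap, Ideal.mem_comap, ψ.commutes]
    exact hn (Ideal.mem_map_of_mem _ hb))
  refine ⟨C, inferInstance, hloc, inferInstance, hnoeth, hCm ▸ hcomp, hflat, hBC, h, fun a => ?_⟩
  obtain ⟨d, rfl⟩ := hψ a
  exact ⟨_, hh d⟩

end CompleteCover

section CohenLift

open TensorProduct

theorem torZero_one_quotient {B P : Type u} [CommRing B] [IsLocalRing B] [CommRing P]
    [Algebra B P] [Module.Flat B P] (J : Ideal P)
    (hJ : J ⊓ (maximalIdeal B).map (algebraMap B P) ≤ (maximalIdeal B).map (algebraMap B P) * J) :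
    TorZero B (P ⧸ J) (B ⧸ maximalIdeal B) 1 := by
  have hex : Function.Exact (J.restrictScalars B).subtype
      (Ideal.Quotient.mkₐ B J).toLinearMap := by
    intro x
    simp [Ideal.Quotient.eq_zero_iff_mem]
  rw [torZero_one_iff_left hex (J.restrictScalars B).injective_subtype
    (Ideal.Quotient.mkₐ_surjective B J), injective_iff_map_eq_zero]
  intro z hz
  obtain ⟨j, rfl⟩ : ∃ j : J.restrictScalars B,
      j ⊗ₜ[B] (Ideal.Quotient.mk (maximalIdeal B) 1) = z := by
    clear hz
    induction z with
    | zero => exact ⟨0, TensorProduct.zero_tmul _ _⟩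
    | tmul x y =>
      obtain ⟨b, rfl⟩ := Ideal.Quotient.mk_surjective y
      refine ⟨b • x, ?_⟩
      rw [TensorProduct.smul_tmul]
      congr 1
      exact (mul_one b ▸ map_mul (Ideal.Quotient.mk (maximalIdeal B)) b 1).symm
    | add y z hy hz =>
      obtain ⟨y, rfl⟩ := hy
      obtain ⟨z, rfl⟩ := hz
      exact ⟨y + z, TensorProduct.add_tmul _ _ _⟩
  have hj : (j : P) ∈ (maximalIdeal B).map (algebraMap B P) := by
    have h := congrArg (TensorProduct.tensorQuotEquivQuotSMul P (maximalIdeal B)) hz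
    rw [LinearMap.rTensor_tmul, TensorProduct.tensorQuotEquivQuotSMul_tmul_mk, map_zero,
      Submodule.Quotient.mk_eq_zero, one_smul, Ideal.smul_top_eq_map] at h
    exact h
  have hj' := hJ ⟨j.2, hj⟩
  have h2 : j ∈ maximalIdeal B • (⊤ : Submodule B (J.restrictScalars B)) := by
    rw [Submodule.mem_smul_top_iff]
    rw [← smul_eq_mul] at hj'
    rw [← Submodule.restrictScalars_mem B, Ideal.smul_restrictScalars] at hj'
    exact hj'
  exact tensor_eq_zero_of_mem_smul (by rw [Ideal.annihilator_quotient]) h2 _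

theorem aeval_map_residue {B A ι : Type u} [CommRing B] [IsLocalRing B] [CommRing A]
    [IsLocalRing A] [Algebra B A] [IsLocalHom (algebraMap B A)] (a : ι → A)
    (p : MvPolynomial ι B) :
    MvPolynomial.aeval (fun i => residue A (a i)) (MvPolynomial.map (residue B) p) =
      residue A (MvPolynomial.aeval a p) := by
  induction p using MvPolynomial.induction_on with
  | C b => simp
  | add p q hp hq => simp only [map_add, hp, hq]
  | mul_X p i hp => rw [map_mul, map_mul, map_mul, map_mul, hp]; simp

theorem exists_triangular_lift {B₁ A : Type u} [CommRing B₁] [IsLocalRing B₁] [CommRing A]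
    [IsLocalRing A] [Algebra B₁ A] [IsLocalHom (algebraMap B₁ A)]
    (hm : (maximalIdeal B₁).map (algebraMap B₁ A) = maximalIdeal A)
    [Algebra.IsAlgebraic (ResidueField B₁) (ResidueField A)] :
    ∃ J : Ideal (MvPolynomial A B₁),
      J ⊓ (maximalIdeal B₁).map MvPolynomial.C ≤ (maximalIdeal B₁).map MvPolynomial.C * J ∧
      (∀ p ∈ J, MvPolynomial.aeval (id : A → A) p = 0) ∧
      (maximalIdeal A).comap (MvPolynomial.aeval (R := B₁) (id : A → A)).toRingHom ≤
        (maximalIdeal B₁).map MvPolynomial.C ⊔ J := by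
  obtain ⟨_, _⟩ := exists_wellFoundedLT A
  obtain ⟨f, hker, hf⟩ := exists_triangular_generators (k := ResidueField B₁) (residue A)
  let π : MvPolynomial A B₁ →+* MvPolynomial A (ResidueField B₁) :=
    MvPolynomial.map (residue B₁)
  have hπ : Function.Surjective π := MvPolynomial.map_surjective _ residue_surjective
  have hπker : RingHom.ker π = (maximalIdeal B₁).map MvPolynomial.C := by
    rw [MvPolynomial.ker_map, ker_residue]
  have hcomm (p : MvPolynomial A B₁) :
      MvPolynomial.aeval (residue A) (π p) = residue A (MvPolynomial.aeval (id : A → A) p) :=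
    aeval_map_residue _ p
  have hlift (α : A) : ∃ F : MvPolynomial A B₁, π F = f α ∧
      MvPolynomial.aeval (id : A → A) F = 0 := by
    obtain ⟨F, hF⟩ := hπ (f α)
    have h1 : MvPolynomial.aeval (id : A → A) F ∈ maximalIdeal A := by
      rw [← residue_eq_zero_iff, ← hcomm, hF, ← RingHom.mem_ker, hker]
      exact Ideal.subset_span ⟨α, rfl⟩
    have h2 : (maximalIdeal A) = ((maximalIdeal B₁).map MvPolynomial.C).map
        (MvPolynomial.aeval (R := B₁) (id : A → A)).toRingHom := by
      rw [Ideal.map_map, ← hm]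
      congr 1
      ext b
      simp
    rw [h2] at h1
    obtain ⟨q, hq, hqF⟩ := (Ideal.mem_map_iff_of_surjective
      (MvPolynomial.aeval (R := B₁) (id : A → A)).toRingHom
      fun a => ⟨MvPolynomial.X a, by simp⟩).1 h1
    rw [← hπker, RingHom.mem_ker] at hq
    exact ⟨F - q, by rw [map_sub, hF, hq, sub_zero], by
      rw [map_sub]; exact sub_eq_zero.2 hqF.symm⟩
  choose F hF hF0 using hlift
  have hFf : π ∘ F = f := funext hF
  refine ⟨Ideal.span (Set.range F), ?_, ?_, ?_⟩
  · rw [← hπker]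
    exact inf_ker_le_of_triangular π hπ F (by simpa only [hFf, hF] using hf)
  · intro p hp
    have : Ideal.span (Set.range F) ≤
        RingHom.ker (MvPolynomial.aeval (R := B₁) (id : A → A)) := by
      rw [Ideal.span_le]
      rintro _ ⟨α, rfl⟩
      exact hF0 α
    exact this hp
  · intro p hp
    have h1 : π p ∈ (Ideal.span (Set.range F)).map π := by
      rw [Ideal.map_span, ← Set.range_comp, hFf, ← hker, RingHom.mem_ker]
      rw [hcomm, residue_eq_zero_iff]
      exact hp
    obtain ⟨q, hq, hqp⟩ := (Ideal.mem_map_iff_of_surjective π hπ).1 h1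
    have h2 : p - q ∈ (maximalIdeal B₁).map MvPolynomial.C := by
      rw [← hπker, RingHom.mem_ker, map_sub, hqp, sub_self]
    rw [← sub_add_cancel p q]
    exact add_mem (Ideal.mem_sup_left h2) (Ideal.mem_sup_right hq)

theorem exists_cover_of_algebraic {B B₁ A : Type u} [CommRing B] [IsLocalRing B]
    [IsNoetherianRing B] [CommRing B₁] [IsLocalRing B₁] [Algebra B B₁] [Module.Flat B B₁]
    (hm₁ : (maximalIdeal B).map (algebraMap B B₁) = maximalIdeal B₁)
    [CommRing A] [IsLocalRing A] [IsAdicComplete (maximalIdeal A) A]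
    [Algebra B A] [Algebra B₁ A] [IsScalarTower B B₁ A] [IsLocalHom (algebraMap B₁ A)]
    (hm : (maximalIdeal B).map (algebraMap B A) = maximalIdeal A)
    [Algebra.IsAlgebraic (ResidueField B₁) (ResidueField A)] :
    ∃ (C : Type u) (_ : CommRing C) (_ : IsLocalRing C) (_ : Algebra B C), IsNoetherianRing C ∧
      IsAdicComplete (maximalIdeal C) C ∧ Module.Flat B C ∧
      (maximalIdeal B).map (algebraMap B C) = maximalIdeal C ∧
      ∃ h : C →ₐ[B] A, Function.Surjective h := by
  have hmA : (maximalIdeal B₁).map (algebraMap B₁ A) = maximalIdeal A := by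
    rw [← hm₁, Ideal.map_map, ← IsScalarTower.algebraMap_eq, hm]
  obtain ⟨J, hJ, hJ0, hcomap⟩ := exists_triangular_lift hmA
  have hmP : (maximalIdeal B).map (algebraMap B (MvPolynomial A B₁)) =
      (maximalIdeal B₁).map MvPolynomial.C := by
    rw [← hm₁, Ideal.map_map]
    rfl
  have : Module.Flat B (MvPolynomial A B₁) := Module.Flat.trans B B₁ (MvPolynomial A B₁)
  rw [← hmP] at hJ hcomap
  let Φ : MvPolynomial A B₁ →ₐ[B] A := (MvPolynomial.aeval (id : A → A)).restrictScalars B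
  have hΦ : Function.Surjective Φ := fun a => ⟨MvPolynomial.X a, by simp [Φ]⟩
  let ψ : MvPolynomial A B₁ ⧸ J →ₐ[B] A := Ideal.Quotient.liftₐ J Φ hJ0
  have hψ : Function.Surjective ψ := fun a => by
    obtain ⟨p, rfl⟩ := hΦ a
    exact ⟨Ideal.Quotient.mk J p, rfl⟩
  have hmax : (maximalIdeal B).map (algebraMap B (MvPolynomial A B₁ ⧸ J)) =
      (maximalIdeal A).comap ψ := by
    apply le_antisymm
    · rw [Ideal.map_le_iff_le_comap]
      intro b hb
      rw [Ideal.mem_comap, Ideal.mem_comap, ψ.commutes, ← hm]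
      exact Ideal.mem_map_of_mem _ hb
    · intro x hx
      obtain ⟨p, rfl⟩ := Ideal.Quotient.mk_surjective x
      have h1 := Ideal.mem_map_of_mem (Ideal.Quotient.mk J) (hcomap (x := p) hx)
      rw [Ideal.map_sup, Ideal.map_quotient_self, sup_bot_eq, Ideal.map_map] at h1
      exact h1
  have : ((maximalIdeal A).comap ψ).IsMaximal :=
    Ideal.comap_isMaximal_of_surjective ψ hψ
  exact exists_flat_complete_cover (torZero_one_quotient J hJ) (hmax ▸ this) (maximalIdeal A)
    hm.le ψ hψ

end CohenLift

section CohenCover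

theorem isAlgebraic_of_isTranscendenceBasis {k k₁ K ι : Type u} [Field k] [Field k₁] [Field K]
    [Algebra k k₁] [Algebra k K] [Algebra k₁ K] [IsScalarTower k k₁ K] {x : ι → K}
    (hx : IsTranscendenceBasis k x) (h : ∀ i, ∃ c, algebraMap k₁ K c = x i) :
    Algebra.IsAlgebraic k₁ K := by
  have halg := hx.isAlgebraic
  have hle : Algebra.adjoin k (Set.range x) ≤ (IsScalarTower.toAlgHom k k₁ K).range := by
    rw [Algebra.adjoin_le_iff]
    rintro _ ⟨i, rfl⟩
    exact h i
  constructor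
  intro z
  obtain ⟨p, hp, hpz⟩ := halg.isAlgebraic z
  have hlift : p.map (algebraMap _ K) ∈ Polynomial.lifts (algebraMap k₁ K) := by
    rw [Polynomial.lifts_iff_coeff_lifts]
    intro n
    rw [Polynomial.coeff_map]
    exact hle (p.coeff n).2
  obtain ⟨q, hq⟩ := (Polynomial.mem_lifts _).1 hlift
  refine ⟨q, ?_, ?_⟩
  · rintro rfl
    rw [Polynomial.map_zero, eq_comm, Polynomial.map_eq_zero_iff Subtype.val_injective] at hq
    exact hp hq
  · rw [← Polynomial.eval_map_algebraMap, hq, Polynomial.eval_map_algebraMap, hpz]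

theorem exists_cohen_cover {B A : Type u} [CommRing B] [IsLocalRing B]
    [IsNoetherianRing B] [CommRing A] [IsLocalRing A] [IsAdicComplete (maximalIdeal A) A]
    [Algebra B A] (hm : (maximalIdeal B).map (algebraMap B A) = maximalIdeal A) :
    ∃ (C : Type u) (_ : CommRing C) (_ : IsLocalRing C) (_ : Algebra B C), IsNoetherianRing C ∧
      IsAdicComplete (maximalIdeal C) C ∧ Module.Flat B C ∧
      (maximalIdeal B).map (algebraMap B C) = maximalIdeal C ∧
      ∃ h : C →ₐ[B] A, Function.Surjective h := by
  have hloc : IsLocalHom (algebraMap B A) :=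
    ((local_hom_TFAE (algebraMap B A)).out 2 0).1 hm.le
  obtain ⟨ι, x, hx⟩ := exists_isTranscendenceBasis' (ResidueField B) (ResidueField A)
  choose a ha using fun i => residue_surjective (x i)
  let P := MvPolynomial ι B
  let π : P →+* MvPolynomial ι (ResidueField B) := MvPolynomial.map (residue B)
  let Q : Ideal P := RingHom.ker π
  have hQ : Q.IsPrime := RingHom.ker_isPrime π
  have hQm : Q = (maximalIdeal B).map (algebraMap B P) := by
    change RingHom.ker (MvPolynomial.map (residue B)) = _
    rw [MvPolynomial.ker_map, ker_residue]
    rfl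
  let Φ : P →ₐ[B] A := MvPolynomial.aeval a
  have hcomm (p : P) : MvPolynomial.aeval x (π p) = residue A (Φ p) := by
    rw [← funext ha]
    exact aeval_map_residue a p
  have hunit (p : P) (hp : p ∉ Q) : IsUnit (Φ p) := by
    rw [← notMem_maximalIdeal, ← residue_eq_zero_iff, ← hcomm]
    intro h
    exact hp ((injective_iff_map_eq_zero _).1 hx.1 _ h)
  let B₁ := Localization.AtPrime Q
  let Ψ : B₁ →ₐ[B] A := IsLocalization.liftAlgHom (M := Q.primeCompl) (f := Φ)
    fun y => hunit y y.2
  have hΨ (p : P) : Ψ (algebraMap P B₁ p) = Φ p := IsLocalization.lift_eq _ _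
  let _ : Algebra B₁ A := Ψ.toRingHom.toAlgebra
  have : IsScalarTower B B₁ A := .of_algebraMap_eq' Ψ.comp_algebraMap.symm
  have hm₁ : (maximalIdeal B).map (algebraMap B B₁) = maximalIdeal B₁ := by
    rw [← IsLocalization.AtPrime.map_eq_maximalIdeal Q B₁,
      IsScalarTower.algebraMap_eq B P B₁, ← Ideal.map_map, ← hQm]
  have : IsLocalHom (algebraMap B₁ A) := by
    refine ((local_hom_TFAE (algebraMap B₁ A)).out 2 0).1 ?_
    rw [← hm₁, Ideal.map_map, ← IsScalarTower.algebraMap_eq, hm]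
  have : IsLocalHom (algebraMap B B₁) :=
    ((local_hom_TFAE (algebraMap B B₁)).out 2 0).1 hm₁.le
  have : Module.Flat B B₁ := Module.Flat.trans B P B₁
  have : Algebra.IsAlgebraic (ResidueField B₁) (ResidueField A) := by
    refine isAlgebraic_of_isTranscendenceBasis hx fun i =>
      ⟨residue B₁ (algebraMap P B₁ (MvPolynomial.X i)), ?_⟩
    rw [ResidueField.algebraMap_residue, ← ha i]
    congr 1
    exact (hΨ _).trans (MvPolynomial.aeval_X _ _)
  exact exists_cover_of_algebraic hm₁ hm

end CohenCover

section FlatDescent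

open TensorProduct RingTheory.Sequence

theorem TorZero.congr_right {R W X Y : Type u} [CommRing R] [AddCommGroup X] [Module R X]
    [AddCommGroup Y] [Module R Y] [AddCommGroup W] [Module R W] (e : X ≃ₗ[R] Y) (i : ℕ)
    (h : TorZero R W X (i + 1)) : TorZero R W Y (i + 1) :=
  TorZero.right_second (Z := PUnit) (f := e.toLinearMap) (g := 0)
    (fun y => by simp) e.injective
    (fun z => ⟨0, Subsingleton.elim _ _⟩) h (TorZero.of_flat_right i)

variable {B C : Type u} [CommRing B] [IsLocalRing B] [IsNoetherianRing B]
  [CommRing C] [IsLocalRing C] [IsNoetherianRing C] [Algebra B C] [Module.Flat B C]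

theorem embDim_le_of_flat (hm : (maximalIdeal B).map (algebraMap B C) = maximalIdeal C) :
    embDim B ≤ embDim C := by
  have : IsLocalHom (algebraMap B C) := ((local_hom_TFAE (algebraMap B C)).out 2 0).1 hm.le
  have : Module.FaithfullyFlat B C := Module.FaithfullyFlat.of_flat_of_isLocalHom
  obtain ⟨y, hy⟩ := exists_generators_maximalIdeal (A := B)
  have hyC : Ideal.span (Set.range fun i => algebraMap B C (y i)) = maximalIdeal C := by
    rw [← hm, ← hy, Ideal.map_span, ← Set.range_comp]
    rfl
  let z (i : Fin (embDim B)) : maximalIdeal C :=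
    ⟨algebraMap B C (y i), hyC ▸ Ideal.subset_span ⟨i, rfl⟩⟩
  have hspan {κ : Type} (a : κ → Fin (embDim B)) :
      Submodule.span C (Set.range (z ∘ a)) = ⊤ ↔
        Ideal.span (Set.range fun i => algebraMap B C (y (a i))) = maximalIdeal C := by
    rw [← (Submodule.map_injective_of_injective (maximalIdeal C).injective_subtype).eq_iff,
      Submodule.map_span, ← Set.range_comp, Submodule.map_top, Submodule.range_subtype]
    rfl
  have htop := CotangentSpace.span_image_eq_top_iff.2 ((hspan id).2 hyC)
  rw [← Set.range_comp] at htop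
  obtain ⟨κ, a, ha, hsp, hli⟩ := exists_linearIndependent' (ResidueField C)
    ((maximalIdeal C).toCotangent ∘ z)
  have hsp' := hsp.trans htop
  have : Fintype κ := Fintype.ofInjective a ha
  have hcard : embDim C = Fintype.card κ :=
    Module.finrank_eq_card_basis (Module.Basis.mk hli hsp'.ge)
  rw [Function.comp_assoc, Set.range_comp] at hsp'
  have h1 := (hspan a).1 (CotangentSpace.span_image_eq_top_iff.1 hsp')
  rw [hcard]
  refine embDim_le_of_span (fun i => y (a ((Fintype.equivFin κ).symm i))) ?_
  rw [← Ideal.comap_map_eq_self_of_faithfullyFlat (B := C) (Ideal.span _), Ideal.map_span,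
    ← Set.range_comp]
  have h2 : Set.range (algebraMap B C ∘ fun i => y (a ((Fintype.equivFin κ).symm i))) =
      Set.range fun i => algebraMap B C (y (a i)) :=
    (Fintype.equivFin κ).symm.surjective.range_comp fun i => algebraMap B C (y (a i))
  rw [h2, h1]
  exact maximalIdeal_comap (algebraMap B C)

theorem ringKrullDim_eq_of_flat (hm : (maximalIdeal B).map (algebraMap B C) = maximalIdeal C) :
    ringKrullDim C = ringKrullDim B := by
  have : IsLocalHom (algebraMap B C) := ((local_hom_TFAE (algebraMap B C)).out 2 0).1 hm.le
  rw [← maximalIdeal_height_eq_ringKrullDim, ← maximalIdeal_height_eq_ringKrullDim,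
    Ideal.height_eq_height_add_of_liesOver_of_hasGoingDown (maximalIdeal B) (maximalIdeal C)]
  have : Nontrivial (C ⧸ (maximalIdeal B).map (algebraMap B C)) :=
    Ideal.Quotient.nontrivial_iff.2 (hm ▸ Ideal.IsPrime.ne_top')
  have h0 : (maximalIdeal C).map (Ideal.Quotient.mk ((maximalIdeal B).map (algebraMap B C))) =
      ⊥ := by
    rw [Ideal.map_eq_bot_iff_le_ker, Ideal.mk_ker, hm]
  rw [h0, Ideal.height_bot, add_zero]

/-- The regular sequence in the kernel of a surjective cover, with length bounded by the vanishing
of `Tor` against injective modules. -/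
theorem exists_isWeaklyRegular_of_cover
    (hm : (maximalIdeal B).map (algebraMap B C) = maximalIdeal C)
    {A : Type u} [CommRing A] [IsLocalRing A] [IsNoetherianRing A] [Algebra B A] [Algebra C A]
    [IsScalarTower B C A] (hs : Function.Surjective (algebraMap C A))
    {X : Type u} [AddCommGroup X] [Module A X] [Module B X] [IsScalarTower B A X]
    [Module.Finite A X] [Nontrivial X] {g d : ℕ} (hX : TorInjBound B X g) (hA : TorBound B A d) :
    ∃ xs : List C, IsWeaklyRegular C xs ∧ (∀ x ∈ xs, x ∈ RingHom.ker (algebraMap C A)) ∧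
      xs.length ≤ g ∧ ((RingHom.ker (algebraMap C A) = Ideal.span {x | x ∈ xs} ∧
        embDim C = xs.length + embDim A) ∨ embDim C < xs.length + embDim A) := by
  have hfin : Module.Finite C A := Module.Finite.of_surjective (Algebra.linearMap C A) hs
  have hpd : PdLE C A d := by
    refine PdLE.of_torZero d A fun i hi => ?_
    have h1 := TorZero.baseChange_right (A' := C) i A (B ⧸ maximalIdeal B)
      (hA (B ⧸ maximalIdeal B) i hi)
    exact TorZero.congr_right
      ((Algebra.TensorProduct.quotIdealMapEquivTensorQuot C
        (maximalIdeal B)).toLinearEquiv.symm.trans (Submodule.quotEquivOfEq _ _ hm)) i h1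
  obtain ⟨xs, hreg, hker, hxs⟩ := exists_isWeaklyRegular_in_ker _ C A rfl hs d hpd
  refine ⟨xs, hreg, hker, ?_, hxs⟩
  let _ : Module C X := Module.compHom X (algebraMap C A)
  have : IsScalarTower C A X := ⟨fun c a x => by
    rw [Algebra.smul_def, mul_smul]; rfl⟩
  have : IsScalarTower B C X := ⟨fun b c x => by
    change algebraMap C A (b • c) • x = b • (algebraMap C A c • x)
    rw [Algebra.smul_def b c, map_mul, ← IsScalarTower.algebraMap_apply, ← Algebra.smul_def,
      smul_assoc]⟩
  have : Module.Finite C X := Module.Finite.trans A X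
  obtain ⟨E, _, _, hE, hE', e, he, hme⟩ := exists_injective_baseChange hm
  refine length_le_of_extZero (X := X) (fun i hi => ?_) hreg fun x hx => ?_
  · exact ExtZero.of_torZero hE' he hme i X (TorZero.baseChange_right i X E (hX E hE i hi))
  · rw [Module.mem_annihilator]
    intro y
    change algebraMap C A x • y = 0
    rw [(RingHom.mem_ker).1 (hker x hx), zero_smul]

end FlatDescent

section UnramifiedCase

open TensorProduct RingTheory.Sequence

instance isNoetherianRing_adicCompletion_maximalIdeal {S : Type u} [CommRing S] [IsLocalRing S]
    [IsNoetherianRing S] : IsNoetherianRing (AdicCompletion (maximalIdeal S) S) := by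
  have hfg : (maximalIdeal (AdicCompletion (maximalIdeal S) S)).FG := by
    rw [AdicCompletion.maximalIdeal_eq_map]
    exact (maximalIdeal S).fg_of_isNoetherianRing.map _
  have : IsNoetherianRing
      (AdicCompletion (maximalIdeal S) S ⧸ maximalIdeal (AdicCompletion (maximalIdeal S) S)) :=
    inferInstanceAs (IsNoetherianRing (ResidueField (AdicCompletion (maximalIdeal S) S)))
  exact isNoetherianRing_of_isAdicComplete _ hfg

theorem isRegularLocal_of_field {k : Type u} [CommRing k] (hk : IsField k) : IsRegularLocal k := by
  let _ := hk.toField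
  refine ⟨inferInstance, inferInstance, [], ⟨IsWeaklyRegular.nil k k, ?_⟩, ?_⟩
  · simp
  · rw [(isField_iff_maximalIdeal_eq).1 hk]
    simp

variable {B S : Type u} [CommRing B] [IsLocalRing B] [CommRing S] [IsLocalRing S] [Algebra B S]

theorem isCIMap_of_cover {C : Type u} [CommRing C] [IsLocalRing C] [IsNoetherianRing C]
    [IsAdicComplete (maximalIdeal C) C] [Algebra B C] [Module.Flat B C]
    (hmC : (maximalIdeal B).map (algebraMap B C) = maximalIdeal C)
    (h : C →ₐ[B] AdicCompletion (maximalIdeal S) S) (hs : Function.Surjective h) {rs : List C}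
    (hreg : IsRegular C rs) (hker : RingHom.ker h = Ideal.span {x | x ∈ rs}) :
    IsCIMap (algebraMap B S) := by
  refine ⟨C, inferInstance, algebraMap B C, h.toRingHom, ⟨inferInstance, inferInstance, ?_, ?_,
    ((local_hom_TFAE (algebraMap B C)).out 2 0).1 hmC.le, ?_, ?_, hs⟩, rs, hreg, hker⟩
  · rw [IsLocalRing.jacobson_eq_maximalIdeal ⊥ bot_ne_top]
    infer_instance
  · rw [AlgHom.toRingHom_eq_coe, AlgHom.comp_algebraMap]
    rfl
  · rw [RingHom.flat_algebraMap_iff]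
    infer_instance
  · rw [hmC]
    exact isRegularLocal_of_field (Ideal.Quotient.maximal_ideal_iff_isField_quotient _ |>.1
      inferInstance)

theorem embDim_le_and_isExceptionalCIMap_of_map_eq [IsNoetherianRing B] [IsNoetherianRing S]
    (hm : (maximalIdeal B).map (algebraMap B S) = maximalIdeal S)
    {M : Type u} [AddCommGroup M] [Module S M] [Module B M] [IsScalarTower B S M]
    [Module.Finite S M] [Nontrivial M] {g d : ℕ} (hM : TorInjBound B M g) (hS : TorBound B S d) :
    embDim B ≤ g + embDim S ∧
      (g + embDim S = embDim B → IsExceptionalCIMap (algebraMap B S)) := by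
  let A := AdicCompletion (maximalIdeal S) S
  have hmS : (maximalIdeal S).map (algebraMap S A) = maximalIdeal A :=
    AdicCompletion.maximalIdeal_eq_map.symm
  have hmA : (maximalIdeal B).map (algebraMap B A) = maximalIdeal A := by
    rw [IsScalarTower.algebraMap_eq B S A, ← Ideal.map_map, hm, hmS]
  have : Module.Flat S A := AdicCompletion.flat_of_isNoetherian _
  have : Module.FaithfullyFlat S A := Module.FaithfullyFlat.of_flat_of_isLocalHom
  obtain ⟨C, _, _, _, _, hcompl, _, hmC, h, hs⟩ := exists_cohen_cover hmA
  let _ : Algebra C A := h.toRingHom.toAlgebra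
  have : IsScalarTower B C A := .of_algebraMap_eq' h.comp_algebraMap.symm
  have hX : TorInjBound B (A ⊗[S] M) g := fun J _ _ hJ i hi =>
    TorZero.tensor_flat i J (hM J hJ i hi)
  have hA : TorBound B A d := fun J _ _ i hi =>
    TorZero.congr ((AlgebraTensorModule.rid S A A).restrictScalars B)
      (TorZero.tensor_flat (M := S) i J (hS J i hi))
  have : Nontrivial (A ⊗[S] M) := Module.FaithfullyFlat.lTensor_nontrivial _ _ _
  obtain ⟨xs, hreg, hker, hlen, hxs⟩ := exists_isWeaklyRegular_of_cover hmC hs hX hA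
  have hBC := embDim_le_of_flat hmC
  have hSA : embDim A ≤ embDim S := embDim_le_of_map_eq (algebraMap S A) hmS
  refine ⟨by omega, fun heq => ?_⟩
  obtain ⟨hspan, hCA⟩ := hxs.resolve_right (by omega)
  have hreg' : IsRegular C xs := .of_isWeaklyRegular_of_mem_maximalIdeal _
    (fun x hx => le_maximalIdeal (RingHom.ker_ne_top _) (hker x hx)) hreg
  refine ⟨isCIMap_of_cover hmC h hs hreg' hspan, ?_⟩
  have hdim := ringKrullDim_add_length_eq_ringKrullDim_of_isRegular xs hreg'
  have he : ringKrullDim (C ⧸ Ideal.ofList xs) = ringKrullDim A :=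
    ringKrullDim_eq_of_ringEquiv ((Ideal.quotEquivOfEq hspan.symm).trans
      (RingHom.quotientKerEquivOfSurjective hs))
  rw [he, ringKrullDim_eq_of_flat hmC, ringKrullDim_eq_of_flat hmS] at hdim
  have h1 : embDim B = embDim S + xs.length := by omega
  rw [← hdim, h1]
  push_cast
  rw [add_assoc, add_comm (xs.length : WithBot ℕ∞)]

end UnramifiedCase

section PolynomialTor

open TensorProduct Polynomial

variable (R M : Type u) [CommRing R] [AddCommGroup M] [Module R M]

/-- The `n`-th coefficient `R[X] ⊗ M → M`. -/
noncomputable def tensorCoeff (n : ℕ) : R[X] ⊗[R] M →ₗ[R] M :=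
  (TensorProduct.lid R M).toLinearMap ∘ₗ (Polynomial.lcoeff R n).rTensor M

variable {R M}

@[simp]
theorem tensorCoeff_tmul (n : ℕ) (p : R[X]) (m : M) :
    tensorCoeff R M n (p ⊗ₜ m) = p.coeff n • m := by
  simp [tensorCoeff]

theorem exists_eq_sum_tensorCoeff (t : R[X] ⊗[R] M) : ∃ N, ∀ n, N ≤ n →
    tensorCoeff R M n t = 0 ∧
      t = ∑ i ∈ Finset.range n, (X ^ i : R[X]) ⊗ₜ[R] tensorCoeff R M i t := by
  induction t with
  | zero => exact ⟨0, fun n _ => by simp⟩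
  | tmul p m =>
    refine ⟨p.natDegree + 1, fun n hn => ⟨?_, ?_⟩⟩
    · rw [tensorCoeff_tmul, coeff_eq_zero_of_natDegree_lt (by omega), zero_smul]
    · conv_lhs => rw [p.as_sum_range' n (by omega), TensorProduct.sum_tmul]
      refine Finset.sum_congr rfl fun i _ => ?_
      rw [tensorCoeff_tmul, ← TensorProduct.smul_tmul, smul_X_eq_monomial]
  | add s t hs ht =>
    obtain ⟨a, ha⟩ := hs
    obtain ⟨b, hb⟩ := ht
    refine ⟨max a b, fun n hn => ?_⟩
    obtain ⟨h1, h2⟩ := ha n (le_of_max_le_left hn)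
    obtain ⟨h3, h4⟩ := hb n (le_of_max_le_right hn)
    refine ⟨by rw [map_add, h1, h3, add_zero], ?_⟩
    conv_lhs => rw [h2, h4, ← Finset.sum_add_distrib]
    simp only [map_add, TensorProduct.tmul_add]

variable [Module R[X] M] [IsScalarTower R R[X] M]

variable (R M) in
/-- The difference of the two actions of the variable on `R[X] ⊗ M`. -/
noncomputable def tensorXSub : R[X] ⊗[R] M →ₗ[R[X]] R[X] ⊗[R] M :=
  LinearMap.lsmul R[X] _ X - ((LinearMap.lsmul R[X] M X).restrictScalars R).baseChange R[X]

theorem tensorXSub_tmul (p : R[X]) (m : M) :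
    tensorXSub R M (p ⊗ₜ m) = (X * p) ⊗ₜ m - p ⊗ₜ ((X : R[X]) • m) := rfl

theorem tensorXSub_injective : Function.Injective (tensorXSub R M) := by
  rw [injective_iff_map_eq_zero]
  intro t ht
  have hstep (n : ℕ) : tensorCoeff R M n t = (X : R[X]) • tensorCoeff R M (n + 1) t := by
    rw [← sub_eq_zero, ← map_zero (tensorCoeff R M (n + 1)), ← ht]
    clear ht
    induction t with
    | zero => simp
    | tmul p m =>
      rw [tensorXSub_tmul, map_sub]
      simp only [tensorCoeff_tmul, coeff_X_mul]
      rw [smul_comm]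
    | add s t hs ht => rw [map_add, map_add, map_add, map_add, ← hs, ← ht, smul_add]; abel
  have hpow (n k : ℕ) : tensorCoeff R M n t = (X ^ k : R[X]) • tensorCoeff R M (n + k) t := by
    induction k with
    | zero => simp
    | succ k ih => rw [ih, hstep (n + k), pow_succ, mul_smul, add_assoc]
  obtain ⟨N, hN⟩ := exists_eq_sum_tensorCoeff t
  have hzero (n : ℕ) : tensorCoeff R M n t = 0 := by
    rw [hpow n N, (hN (n + N) (by omega)).1, smul_zero]
  rw [(hN N le_rfl).2]
  simp [hzero]

theorem tensorXSub_exact : Function.Exact (tensorXSub R M)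
    ((LinearMap.id : M →ₗ[R] M).liftBaseChange R[X]) := by
  have key (t : R[X] ⊗[R] M) :
      t - 1 ⊗ₜ ((LinearMap.id : M →ₗ[R] M).liftBaseChange R[X] t) ∈
        LinearMap.range (tensorXSub R M) := by
    induction t with
    | zero => simp
    | add s t hs ht =>
      rw [map_add, TensorProduct.tmul_add, add_sub_add_comm]
      exact add_mem hs ht
    | tmul p m =>
      rw [LinearMap.liftBaseChange_tmul, LinearMap.id_apply]
      induction p using Polynomial.induction_on generalizing m with
      | C r =>
        have : (C r : R[X]) • m = r • m := by
          rw [← algebraMap_eq, algebraMap_smul]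
        rw [this, ← TensorProduct.smul_tmul, smul_eq_C_mul, mul_one, sub_self]
        exact zero_mem _
      | add p q hp hq =>
        rw [TensorProduct.add_tmul, add_smul, TensorProduct.tmul_add, add_sub_add_comm]
        exact add_mem (hp m) (hq m)
      | monomial n r ih =>
        have h1 := add_mem (ih ((X : R[X]) • m))
          (LinearMap.mem_range_self (tensorXSub R M) ((C r * X ^ n) ⊗ₜ m))
        rw [tensorXSub_tmul, sub_add_sub_comm] at h1
        convert! h1 using 1
        rw [← mul_smul]
        have : (X : R[X]) * (C r * X ^ n) = C r * X ^ (n + 1) := by ring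
        rw [this, mul_assoc, ← pow_succ]
        abel
  intro t
  constructor
  · intro h
    have := key t
    rwa [h, TensorProduct.tmul_zero, sub_zero] at this
  · rintro ⟨s, rfl⟩
    induction s with
    | zero => simp
    | add s t hs ht => rw [map_add, map_add, hs, ht, add_zero]
    | tmul p m =>
      rw [tensorXSub_tmul, map_sub]
      simp only [LinearMap.liftBaseChange_tmul, LinearMap.id_apply]
      rw [mul_comm, mul_smul, sub_self]

theorem TorZero.of_polynomial {J : Type u} [AddCommGroup J] [Module R J] [Module R[X] J]
    [IsScalarTower R R[X] J] (i : ℕ) (h₁ : TorZero R M J (i + 1)) (h₂ : TorZero R M J (i + 2)) :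
    TorZero R[X] M J (i + 2) :=
  TorZero.of_exact tensorXSub_exact tensorXSub_injective
    (fun m => ⟨1 ⊗ₜ m, by simp⟩) (TorZero.baseChange_left i M J h₁)
    (TorZero.baseChange_left (i + 1) M J h₂)

theorem TorZero.of_localization_polynomial (q : Submonoid R[X]) (R₁ : Type u) [CommRing R₁]
    [Algebra R[X] R₁] [IsLocalization q R₁] [Module R₁ M] [IsScalarTower R[X] R₁ M]
    {J : Type u} [AddCommGroup J] [Module R J] [Module R[X] J] [Module R₁ J]
    [IsScalarTower R R[X] J] [IsScalarTower R[X] R₁ J] (i : ℕ)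
    (h₁ : TorZero R M J (i + 1)) (h₂ : TorZero R M J (i + 2)) : TorZero R₁ M J (i + 2) := by
  have : Module.Flat R[X] R₁ := IsLocalization.flat R₁ q
  exact TorZero.congr (IsLocalization.moduleLid q R₁ M)
    (TorZero.baseChange_left (i + 1) M J (TorZero.of_polynomial i h₁ h₂))

end PolynomialTor

section AdjoinVariable

open Polynomial

variable (R : Type u) [CommRing R] [IsLocalRing R]

/-- The maximal ideal `(m, X)` of `R[X]`. -/
noncomputable def originIdeal : Ideal R[X] := (maximalIdeal R).comap constantCoeff

instance originIdeal_isPrime : (originIdeal R).IsPrime :=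
  Ideal.IsPrime.comap _

variable {R}

theorem mem_originIdeal {p : R[X]} : p ∈ originIdeal R ↔ p.coeff 0 ∈ maximalIdeal R := Iff.rfl

variable (R) in
theorem originIdeal_eq : originIdeal R = (maximalIdeal R).map C ⊔ Ideal.span {X} := by
  refine le_antisymm (fun p hp => ?_) (sup_le ?_ ?_)
  · rw [← p.divX_mul_X_add, add_comm]
    exact Submodule.add_mem_sup (Ideal.mem_map_of_mem _ hp)
      (Ideal.mul_mem_left _ _ (Ideal.mem_span_singleton_self _))
  · rw [Ideal.map_le_iff_le_comap]
    intro r hr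
    simpa [mem_originIdeal] using hr
  · rw [Ideal.span_singleton_le_iff_mem, mem_originIdeal]
    simp

variable (R) in
/-- The localization `R[X]_{(m, X)}`. -/
abbrev PolyLoc := Localization.AtPrime (originIdeal R)

namespace PolyLoc

instance [IsNoetherianRing R] : IsNoetherianRing (PolyLoc R) :=
  IsLocalization.isNoetherianRing (originIdeal R).primeCompl _ inferInstance

instance : Module.Flat R (PolyLoc R) :=
  have : Module.Flat R[X] (PolyLoc R) := IsLocalization.flat _ (originIdeal R).primeCompl
  Module.Flat.trans R R[X] (PolyLoc R)

variable (R) in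
/-- The variable of `R[X]_{(m, X)}`. -/
noncomputable def var : PolyLoc R := algebraMap R[X] (PolyLoc R) X

variable (R) in
theorem maximalIdeal_eq : maximalIdeal (PolyLoc R) =
    (maximalIdeal R).map (algebraMap R (PolyLoc R)) ⊔ Ideal.span {var R} := by
  rw [← IsLocalization.AtPrime.map_eq_maximalIdeal (originIdeal R) (PolyLoc R)]
  refine (congrArg (Ideal.map _) (originIdeal_eq R)).trans ?_
  rw [Ideal.map_sup, Ideal.map_map, Ideal.map_span, Set.image_singleton,
    IsScalarTower.algebraMap_eq R R[X] (PolyLoc R)]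
  rfl

variable (R) in
theorem var_mem : var R ∈ maximalIdeal (PolyLoc R) :=
  maximalIdeal_eq R ▸ Submodule.mem_sup_right (Ideal.mem_span_singleton_self _)

instance : IsLocalHom (algebraMap R (PolyLoc R)) :=
  ((local_hom_TFAE _).out 2 0).1 (maximalIdeal_eq R ▸ le_sup_left)

variable {S : Type u} [CommRing S] [IsLocalRing S]

/-- A local homomorphism `R → S` extended to `R[X]_{(m, X)}` by sending the variable to an element
of the maximal ideal. -/
noncomputable def lift [Algebra R S] [IsLocalHom (algebraMap R S)] (y : maximalIdeal S) :
    PolyLoc R →ₐ[R] S :=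
  IsLocalization.liftAlgHom (M := (originIdeal R).primeCompl) (f := aeval (y : S)) <| by
    rintro ⟨p, hp⟩
    rw [← notMem_maximalIdeal, ← residue_eq_zero_iff]
    have h : residue S (aeval (y : S) p) = residue S (algebraMap R S (p.coeff 0)) := by
      conv_lhs => rw [← p.divX_mul_X_add]
      simp [(residue_eq_zero_iff _).2 y.2]
    rw [h, residue_eq_zero_iff, notMem_maximalIdeal]
    exact (notMem_maximalIdeal.1 hp).map (algebraMap R S)

@[simp]
theorem lift_algebraMap [Algebra R S] [IsLocalHom (algebraMap R S)] (y : maximalIdeal S)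
    (p : R[X]) : lift y (algebraMap R[X] (PolyLoc R) p) = aeval (y : S) p :=
  IsLocalization.lift_eq _ _

theorem lift_var [Algebra R S] [IsLocalHom (algebraMap R S)] (y : maximalIdeal S) :
    lift (R := R) y (var R) = y := by
  rw [var, lift_algebraMap, aeval_X]

theorem isSMulRegular_var : IsSMulRegular (PolyLoc R) (var R) := by
  have : Module.Flat R[X] (PolyLoc R) := IsLocalization.flat _ (originIdeal R).primeCompl
  have h : IsSMulRegular R[X] (X : R[X]) := monic_X.isRegular.left
  exact h.of_flat (S := PolyLoc R)

theorem isSMulRegular_var_quotient : IsSMulRegular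
    (PolyLoc R ⧸ (maximalIdeal R).map (algebraMap R (PolyLoc R))) (var R) := by
  refine isSMulRegular_iff_right_eq_zero_of_smul.2 fun t ht => ?_
  obtain ⟨t, rfl⟩ := Ideal.Quotient.mk_surjective t
  obtain ⟨p, s, rfl⟩ := IsLocalization.exists_mk'_eq (originIdeal R).primeCompl t
  have hmap : (maximalIdeal R).map (algebraMap R (PolyLoc R)) =
      ((maximalIdeal R).map C).map (algebraMap R[X] (PolyLoc R)) := by
    rw [Ideal.map_map, IsScalarTower.algebraMap_eq R R[X] (PolyLoc R)]
    rfl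
  replace ht : var R * IsLocalization.mk' (PolyLoc R) p s ∈
    (maximalIdeal R).map (algebraMap R (PolyLoc R)) := Ideal.Quotient.eq_zero_iff_mem.1 ht
  rw [Ideal.Quotient.eq_zero_iff_mem]
  rw [hmap, var, IsLocalization.mul_mk'_eq_mk'_of_mul,
    IsLocalization.mk'_mem_map_algebraMap_iff] at ht
  rw [hmap, IsLocalization.mk'_mem_map_algebraMap_iff]
  obtain ⟨v, hv, h⟩ := ht
  refine ⟨v, hv, ?_⟩
  rw [Ideal.mem_map_C_iff] at h ⊢
  intro n
  rw [← coeff_X_mul, mul_left_comm]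
  exact h (n + 1)

/-- Evaluation of the variable at zero. -/
noncomputable def evalZero : PolyLoc R →ₐ[R] R := lift (0 : maximalIdeal R)

theorem evalZero_surjective : Function.Surjective (evalZero (R := R)) := fun r =>
  ⟨algebraMap R _ r, by simp⟩

theorem ker_evalZero : RingHom.ker (evalZero (R := R)) = Ideal.span {var R} := by
  refine le_antisymm (fun t ht => ?_) ?_
  · obtain ⟨p, s, rfl⟩ := IsLocalization.exists_mk'_eq (originIdeal R).primeCompl t
    have hp : p.coeff 0 = 0 := by
      rw [RingHom.mem_ker] at ht
      have h := congrArg (evalZero (R := R))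
        (IsLocalization.mk'_spec (PolyLoc R) p s)
      rw [map_mul, ht, zero_mul, evalZero, lift_algebraMap] at h
      simpa [coeff_zero_eq_aeval_zero] using h.symm
    obtain ⟨r, rfl⟩ := X_dvd_iff.2 hp
    rw [IsLocalization.mk'_eq_mul_mk'_one, map_mul, mul_assoc]
    exact Ideal.mul_mem_right _ _ (Ideal.mem_span_singleton_self _)
  · rw [Ideal.span_singleton_le_iff_mem, RingHom.mem_ker, evalZero, lift_var]
    rfl

theorem var_notMem : var R ∉ maximalIdeal (PolyLoc R) ^ 2 := by
  rw [← IsLocalization.AtPrime.map_eq_maximalIdeal (originIdeal R) (PolyLoc R), ← Ideal.map_pow,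
    var, IsLocalization.algebraMap_mem_map_algebraMap_iff (originIdeal R).primeCompl]
  rintro ⟨v, hv, h⟩
  have key : ∀ p ∈ originIdeal R ^ 2, p.coeff 1 ∈ maximalIdeal R := by
    intro p hp
    rw [pow_two] at hp
    refine Submodule.mul_induction_on hp (fun a ha b hb => ?_) fun a b ha hb => ?_
    · rw [mul_coeff_one]
      exact add_mem (Ideal.mul_mem_right _ _ ha) (Ideal.mul_mem_left _ _ hb)
    · rw [coeff_add]
      exact add_mem ha hb
  have := key _ h
  rw [coeff_mul_X] at this
  exact hv this

theorem embDim_eq [IsNoetherianRing R] : embDim (PolyLoc R) = embDim R + 1 :=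
  embDim_eq_succ_of_ker_eq_span (evalZero (R := R)).toRingHom evalZero_surjective (var_mem R)
    var_notMem ker_evalZero

theorem ringKrullDim_eq [IsNoetherianRing R] : ringKrullDim (PolyLoc R) = ringKrullDim R + 1 := by
  rw [← ringKrullDim_quotient_span_singleton_succ_eq_ringKrullDim_of_mem_jacobson (x := var R)
    isSMulRegular_var]
  · rw [← ker_evalZero, ringKrullDim_eq_of_ringEquiv
      (RingHom.quotientKerEquivOfSurjective (f := (evalZero (R := R)).toRingHom)
        evalZero_surjective)]
  · rw [ringJacobson_eq_maximalIdeal]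
    exact var_mem R

section Tor

variable {M : Type u} [AddCommGroup M] [Module R M] [Module (PolyLoc R) M]
  [IsScalarTower R (PolyLoc R) M]

theorem torZero {J : Type u} [AddCommGroup J] [Module R J] [Module (PolyLoc R) J]
    [IsScalarTower R (PolyLoc R) J] (i : ℕ) (h₁ : TorZero R M J (i + 1))
    (h₂ : TorZero R M J (i + 2)) : TorZero (PolyLoc R) M J (i + 2) := by
  let _ : Module R[X] M := Module.compHom M (algebraMap R[X] (PolyLoc R))
  let _ : Module R[X] J := Module.compHom J (algebraMap R[X] (PolyLoc R))
  have (N : Type u) [AddCommGroup N] [Module R N] [Module (PolyLoc R) N]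
      [IsScalarTower R (PolyLoc R) N] :
      letI : Module R[X] N := Module.compHom N (algebraMap R[X] (PolyLoc R))
      IsScalarTower R[X] (PolyLoc R) N ∧ IsScalarTower R R[X] N := by
    let _ : Module R[X] N := Module.compHom N (algebraMap R[X] (PolyLoc R))
    have h : ∀ (p : R[X]) (n : N), p • n = algebraMap R[X] (PolyLoc R) p • n := fun _ _ => rfl
    refine ⟨⟨fun p t n => ?_⟩, ⟨fun r p n => ?_⟩⟩
    · rw [h, Algebra.smul_def, mul_smul]
    · rw [h, h, ← IsScalarTower.algebraMap_smul (PolyLoc R) r (_ : N), Algebra.smul_def, map_mul,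
        mul_smul, IsScalarTower.algebraMap_apply R R[X] (PolyLoc R)]
  obtain ⟨_, _⟩ := this M
  obtain ⟨_, _⟩ := this J
  exact TorZero.of_localization_polynomial (originIdeal R).primeCompl (PolyLoc R) i h₁ h₂

theorem torBound {d : ℕ} (h : TorBound R M d) : TorBound (PolyLoc R) M (d + 1) := by
  intro J _ _ i hi
  obtain ⟨j, rfl⟩ : ∃ j, i = j + 1 := ⟨i - 1, by omega⟩
  let _ : Module R J := Module.compHom J (algebraMap R (PolyLoc R))
  have : IsScalarTower R (PolyLoc R) J := .of_compHom _ _ _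
  exact torZero j (h J j (by omega)) (h J (j + 1) (by omega))

theorem torInjBound {g : ℕ} (h : TorInjBound R M g) : TorInjBound (PolyLoc R) M (g + 1) := by
  intro J _ _ hJ i hi
  obtain ⟨j, rfl⟩ : ∃ j, i = j + 1 := ⟨i - 1, by omega⟩
  let _ : Module R J := Module.compHom J (algebraMap R (PolyLoc R))
  have : IsScalarTower R (PolyLoc R) J := .of_compHom _ _ _
  have hJ' : Module.Injective R J := injective_restrictScalars_of_flat hJ
  exact torZero j (h J hJ' j (by omega)) (h J hJ' (j + 1) (by omega))

end Tor

end PolyLoc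

end AdjoinVariable

section Descent

open RingTheory.Sequence TensorProduct

theorem IsRegularLocal.of_surjective {D T : Type u} [CommRing D] [IsNoetherianRing D]
    [IsLocalRing D] [CommRing T] (hT : IsRegularLocal T) (F : D →+* T)
    (hF : Function.Surjective F) {x : D} (hreg : IsSMulRegular D x)
    (hker : RingHom.ker F = Ideal.span {x}) : IsRegularLocal D := by
  obtain ⟨_, _, rs, hrs, hspan⟩ := hT
  have : IsLocalHom F := IsLocalHom.of_surjective F hF
  obtain ⟨l, rfl⟩ := List.map_surjective_iff.2 hF rs
  have hset : {y | y ∈ l.map F} = F '' {y | y ∈ l} := by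
    ext y
    simp
  have hcomap : (maximalIdeal T).comap F = maximalIdeal D := ((local_hom_TFAE F).out 0 4).1 this
  have hgen : Ideal.span {y | y ∈ x :: l} = maximalIdeal D := by
    rw [← hcomap, ← hspan, hset, ← Ideal.map_span, Ideal.comap_map_of_surjective F hF,
      ← RingHom.ker_eq_comap_bot, hker, ← Ideal.span_union]
    congr 1
    ext y
    simp
  refine ⟨inferInstance, inferInstance, x :: l, ?_, hgen⟩
  refine IsRegular.of_isWeaklyRegular_of_mem_maximalIdeal _ (fun y hy => ?_) ?_
  · rw [← hgen]
    exact Ideal.subset_span hy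
  rw [isWeaklyRegular_cons_quotient_iff]
  refine ⟨hreg, ?_⟩
  let e : (D ⧸ Ideal.span {x}) ≃+* T :=
    (Ideal.quotEquivOfEq hker.symm).trans (RingHom.quotientKerEquivOfSurjective hF)
  have he : ∀ d, e (algebraMap D (D ⧸ Ideal.span {x}) d) = F d := fun _ => rfl
  refine (AddEquiv.isWeaklyRegular_congr (e := e.toAddEquiv) ?_).2 hrs.1
  rw [List.forall₂_map_left_iff, List.forall₂_map_right_iff, List.forall₂_same]
  intro d _ t
  exact (map_mul e _ _).trans (congrArg (· * e t) (he d))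

theorem isSMulRegular_quotient_map_of_flat {A A' : Type u} [CommRing A] [CommRing A'] [Algebra A A']
    [Module.Flat A A'] {I : Ideal A} {x : A} (hx : IsSMulRegular (A ⧸ I) x) :
    IsSMulRegular (A' ⧸ I.map (algebraMap A A'))
      (Ideal.Quotient.mk (I.map (algebraMap A A')) (algebraMap A A' x)) := by
  have h := ((tensorQuotEquivQuotSMul A' I).isSMulRegular_congr x).1 (hx.lTensor A')
  refine isSMulRegular_iff_right_eq_zero_of_smul.2 fun t ht => ?_
  obtain ⟨t, rfl⟩ := Ideal.Quotient.mk_surjective t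
  rw [smul_eq_mul, ← map_mul, Ideal.Quotient.eq_zero_iff_mem, ← Algebra.smul_def] at ht
  rw [Ideal.Quotient.eq_zero_iff_mem]
  have hmem : ∀ a : A', a ∈ (I • ⊤ : Submodule A A') ↔ a ∈ I.map (algebraMap A A') := fun a => by
    rw [Ideal.smul_top_eq_map, Submodule.restrictScalars_mem]
  rw [← hmem, ← Submodule.Quotient.mk_eq_zero] at ht ⊢
  exact isSMulRegular_iff_right_eq_zero_of_smul.1 h _ ht

variable {R S : Type u} [CommRing R] [IsLocalRing R] [CommRing S] [IsLocalRing S]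

theorem IsCIMap.of_polyLoc {f : PolyLoc R →+* S} (hf : IsCIMap f) :
    IsCIMap (f.comp (algebraMap R (PolyLoc R))) := by
  obtain ⟨R', _, g, h, ⟨_, _, hcompl, hcomm, _, hflat, hreg, hs⟩, hrs⟩ := hf
  refine ⟨R', inferInstance, g.comp (algebraMap R (PolyLoc R)), h, ⟨inferInstance, inferInstance,
    hcompl, ?_, inferInstance, ?_, ?_, hs⟩, hrs⟩
  · rw [← RingHom.comp_assoc, hcomm, RingHom.comp_assoc]
  · exact RingHom.Flat.comp ((RingHom.flat_algebraMap_iff).2 inferInstance) hflat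
  let _ : Algebra (PolyLoc R) R' := g.toAlgebra
  have : Module.Flat (PolyLoc R) R' := hflat
  let I := (maximalIdeal R).map (algebraMap R (PolyLoc R))
  have hI : I ≤ maximalIdeal (PolyLoc R) := PolyLoc.maximalIdeal_eq R ▸ le_sup_left
  have hmg : (maximalIdeal (PolyLoc R)).map g ≤ maximalIdeal R' :=
    ((local_hom_TFAE g).out 0 2).1 ‹IsLocalHom g›
  have hle : I.map g ≤ (maximalIdeal (PolyLoc R)).map g := Ideal.map_mono hI
  rw [← Ideal.map_map]
  have : Nontrivial (R' ⧸ I.map g) := Ideal.Quotient.nontrivial_iff.2 fun htop =>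
    (maximalIdeal.isMaximal R').ne_top (top_le_iff.1 (htop ▸ hle.trans hmg))
  have : IsLocalRing (R' ⧸ I.map g) :=
    .of_surjective' (Ideal.Quotient.mk (I.map g)) Ideal.Quotient.mk_surjective
  refine hreg.of_surjective (Ideal.Quotient.factor hle) (Ideal.Quotient.factor_surjective hle)
    (x := Ideal.Quotient.mk _ (g (PolyLoc.var R)))
    (isSMulRegular_quotient_map_of_flat PolyLoc.isSMulRegular_var_quotient) ?_
  rw [Ideal.Quotient.factor_ker, PolyLoc.maximalIdeal_eq, Ideal.map_sup, Ideal.map_sup,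
    Ideal.map_quotient_self, bot_sup_eq, Ideal.map_span, Ideal.map_span, Set.image_singleton,
    Set.image_singleton]

theorem IsExceptionalCIMap.of_polyLoc [IsNoetherianRing R] {f : PolyLoc R →+* S} (hf : IsExceptionalCIMap f) :
    IsExceptionalCIMap (f.comp (algebraMap R (PolyLoc R))) := by
  refine ⟨hf.1.of_polyLoc, ?_⟩
  have h := hf.2
  rw [PolyLoc.embDim_eq, PolyLoc.ringKrullDim_eq, Nat.cast_add, Nat.cast_one, ← add_assoc,
    add_right_comm] at h
  exact (ENat.WithBot.add_natCast_cancel (c := 1)).1 h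

end Descent

section Main

variable {S M : Type u} [CommRing S] [IsLocalRing S] [IsNoetherianRing S] [AddCommGroup M]
  [Module S M] [Module.Finite S M] [Nontrivial M]

theorem embDim_le_and_isExceptionalCIMap_of_sup_eq (l : List (maximalIdeal S)) :
    ∀ {R : Type u} [CommRing R] [IsLocalRing R] [IsNoetherianRing R] [Algebra R S]
      [IsLocalHom (algebraMap R S)] [Module R M] [IsScalarTower R S M] {g d : ℕ},
      (maximalIdeal R).map (algebraMap R S) ⊔ Ideal.span {x | x ∈ l.map Subtype.val} =
        maximalIdeal S → TorInjBound R M g → TorBound R S d → embDim R ≤ g + embDim S ∧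
        (g + embDim S = embDim R → IsExceptionalCIMap (algebraMap R S)) := by
  induction l with
  | nil =>
    intro R _ _ _ _ _ _ _ g d hm hM hS
    exact embDim_le_and_isExceptionalCIMap_of_map_eq (by simpa using hm) hM hS
  | cons y l ih =>
    intro R _ _ _ _ _ _ _ g d hm hM hS
    let φ : PolyLoc R →ₐ[R] S := PolyLoc.lift y
    let _ : Algebra (PolyLoc R) S := φ.toRingHom.toAlgebra
    let _ : Module (PolyLoc R) M := Module.compHom M φ.toRingHom
    have : IsScalarTower R (PolyLoc R) S := .of_algebraMap_eq' φ.comp_algebraMap.symm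
    have : IsScalarTower (PolyLoc R) S M := .of_compHom _ _ _
    have : IsScalarTower R (PolyLoc R) M := ⟨fun r t m => by
      rw [← IsScalarTower.algebraMap_smul S (r • t) m, ← IsScalarTower.algebraMap_smul S t m,
        ← IsScalarTower.algebraMap_smul S r (_ : M), ← mul_smul, Algebra.smul_def, map_mul,
        ← IsScalarTower.algebraMap_apply]⟩
    have hm₁ : (maximalIdeal (PolyLoc R)).map (algebraMap (PolyLoc R) S) =
        (maximalIdeal R).map (algebraMap R S) ⊔ Ideal.span {(y : S)} := by
      rw [PolyLoc.maximalIdeal_eq, Ideal.map_sup, Ideal.map_map, ← IsScalarTower.algebraMap_eq,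
        Ideal.map_span, Set.image_singleton]
      exact congrArg (fun z => _ ⊔ Ideal.span {z}) (PolyLoc.lift_var y)
    have hset : {x | x ∈ (y :: l).map Subtype.val} = {(y : S)} ∪ {x | x ∈ l.map Subtype.val} := by
      ext
      simp
    rw [hset, Ideal.span_union, ← sup_assoc, ← hm₁] at hm
    have : IsLocalHom (algebraMap (PolyLoc R) S) :=
      ((local_hom_TFAE _).out 2 0).1 (le_sup_left.trans hm.le)
    obtain ⟨h₁, h₂⟩ := ih hm (PolyLoc.torInjBound hM) (PolyLoc.torBound hS)
    rw [PolyLoc.embDim_eq] at h₁ h₂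
    refine ⟨by omega, fun h => ?_⟩
    rw [IsScalarTower.algebraMap_eq R (PolyLoc R) S]
    exact (h₂ (by omega)).of_polyLoc

theorem embDim_le_and_isExceptionalCIMap {R : Type u} [CommRing R] [IsLocalRing R]
    [IsNoetherianRing R] [Algebra R S] [IsLocalHom (algebraMap R S)] [Module R M]
    [IsScalarTower R S M] {g d : ℕ} (hM : TorInjBound R M g) (hS : TorBound R S d) :
    embDim R ≤ g + embDim S ∧
      (g + embDim S = embDim R → IsExceptionalCIMap (algebraMap R S)) := by
  obtain ⟨s, hs⟩ := (isNoetherianRing_iff_ideal_fg S).1 inferInstance (maximalIdeal S)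
  have hmem : ∀ x ∈ s.toList, x ∈ maximalIdeal S := fun x hx =>
    hs ▸ Ideal.subset_span (Finset.mem_toList.1 hx)
  refine embDim_le_and_isExceptionalCIMap_of_sup_eq (s.toList.pmap Subtype.mk hmem) ?_ hM hS
  have hset : {x | x ∈ (s.toList.pmap Subtype.mk hmem).map Subtype.val} = (s : Set S) := by
    ext x
    simp only [List.map_pmap, Set.mem_ofPred_eq, SetLike.mem_coe]
    simp
  rw [hset, hs, sup_eq_right]
  exact ((local_hom_TFAE _).out 0 2).1 ‹IsLocalHom (algebraMap R S)›

theorem exists_natCast_eq_sInf {p : ℕ → Prop} (h : sInf (((↑) : ℕ → ℕ∞) '' {n | p n}) < ⊤) :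
    ∃ n : ℕ, p n ∧ sInf (((↑) : ℕ → ℕ∞) '' {n | p n}) = n := by
  have hne : (((↑) : ℕ → ℕ∞) '' {n | p n}).Nonempty := by
    by_contra hempty
    rw [Set.not_nonempty_iff_eq_empty.1 hempty, sInf_empty] at h
    exact lt_irrefl _ h
  obtain ⟨n, hn, h⟩ := csInf_mem hne
  exact ⟨n, hn, h.symm⟩

end Main

/-- If `f : R → S` is a local homomorphism of noetherian local rings with `fd_R S < ∞` and
`M` is a non-zero finitely generated `S`-module, then `Gfd_R M ≥ edim R - edim S`, and if
equality holds then `f` is an exceptional complete intersection map. -/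
theorem gfd_ge_and_eci_of_eq {R S : Type u} [CommRing R] [CommRing S]
    [IsLocalRing R] [IsLocalRing S] [IsNoetherianRing R] [IsNoetherianRing S]
    (f : R →+* S) (hloc : IsLocalHom f) (hfd : flatDimAlong f < ⊤)
    (M : Type u) [AddCommGroup M] [Module S M] [Nontrivial M] [Module.Finite S M] :
    (embDim R : ℕ∞) ≤ gfdAlong f M + embDim S ∧
      (gfdAlong f M + embDim S = (embDim R : ℕ∞) → IsExceptionalCIMap f) := by
  obtain h | h := eq_or_lt_of_le (le_top (a := gfdAlong f M))
  · rw [h, top_add]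
    exact ⟨le_top, fun htop => absurd htop.symm (ENat.natCast_ne_top _)⟩
  let _ : Algebra R S := f.toAlgebra
  let _ : Module R M := Module.compHom M f
  have : IsScalarTower R S M := .of_compHom _ _ _
  have : IsLocalHom (algebraMap R S) := hloc
  obtain ⟨d, hd, -⟩ := exists_natCast_eq_sInf hfd
  obtain ⟨g, hg, hgM⟩ := exists_natCast_eq_sInf h
  replace hgM : gfdAlong f M = g := hgM
  obtain ⟨h₁, h₂⟩ := embDim_le_and_isExceptionalCIMap (TorInjBound.of_gfdLE g M hg)
    (TorBound.of_fdLE d S hd)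
  rw [hgM]
  exact ⟨mod_cast h₁, fun heq => h₂ (mod_cast heq)⟩
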